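/- Let W be a rectilinear polygonal environment with free space F, fix points s_A,s_B,t_A,t_B ∈ F, and suppose the configurations s = (s_A,s_B) and t = (t_A,t_B) belong to the vertex set 𝒱 of the configuration graph 𝒢 and that (s,t) is reachable. Then there exists a path in 𝒢 from s to t, and the minimum total edge weight over all paths in 𝒢 from s to t equals the minimum cost over all feasible (s,t)-plans; in particular this minimum cost is attained by a feasible plan, namely by the plan obtained from a minimum-weight s–t path in 𝒢 by traversing its edges one after another (in each edge, one robot stays parked while the other moves along the corresponding grid edge). -/

import Mathlib

open Set
open scoped ENNReal

noncomputable section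

/-- The ℓ∞ norm of a point of `ℝ²`. -/
def linf (p : ℝ × ℝ) : ℝ := max |p.1| |p.2|

/-- The ℓ₁ norm of a point of `ℝ²`. -/
def l1 (p : ℝ × ℝ) : ℝ := |p.1| + |p.2|

/-- The Euclidean distance between two points of `ℝ²`. -/
def euclDist (p q : ℝ × ℝ) : ℝ := Real.sqrt ((p.1 - q.1) ^ 2 + (p.2 - q.2) ^ 2)

/-- A closed axis-aligned rectangle with nonempty interior. -/
def IsClosedAxisRect (S : Set (ℝ × ℝ)) : Prop :=
  ∃ a b c d : ℝ, a < b ∧ c < d ∧ S = Icc a b ×ˢ Icc c d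

/-- A rectilinear polygonal environment: a nonempty compact subset of the plane that is a
finite union of closed axis-aligned rectangles with nonempty interior, and that equals the
closure of its interior. -/
def IsRectilinearEnv (W : Set (ℝ × ℝ)) : Prop :=
  W.Nonempty ∧ IsCompact W ∧
    (∃ 𝓡 : Finset (Set (ℝ × ℝ)), (∀ S ∈ 𝓡, IsClosedAxisRect S) ∧ W = ⋃ S ∈ 𝓡, S) ∧
    W = closure (interior W)

/-- The free space of a workspace `W`: placements of the center of a closed axis-aligned
unit square keeping the square inside `W`. -/
def freeSpace (W : Set (ℝ × ℝ)) : Set (ℝ × ℝ) :=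
  {p | ∀ q : ℝ × ℝ, linf q ≤ 1 / 2 → p + q ∈ W}

/-- A free configuration of the two robots. -/
def FreeConf (F : Set (ℝ × ℝ)) (c : (ℝ × ℝ) × (ℝ × ℝ)) : Prop :=
  c.1 ∈ F ∧ c.2 ∈ F ∧ 1 ≤ linf (c.1 - c.2)

/-- The ℓ₁-length (total variation w.r.t. the metric induced by the ℓ₁-norm) of a planar
path on a set of times. -/
def l1VarOn (γ : ℝ → ℝ × ℝ) (s : Set ℝ) : ℝ≥0∞ :=
  eVariationOn (fun t => (WithLp.equiv 1 (ℝ × ℝ)).symm (γ t)) s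

/-- An `(s,t)`-plan: a continuous map on `[0,1]` from `s` to `t`. -/
def IsPlan (s t : (ℝ × ℝ) × (ℝ × ℝ)) (pln : ℝ → (ℝ × ℝ) × (ℝ × ℝ)) : Prop :=
  ContinuousOn pln (Icc 0 1) ∧ pln 0 = s ∧ pln 1 = t

/-- A plan is feasible if every configuration along it is free. -/
def Feasible (F : Set (ℝ × ℝ)) (pln : ℝ → (ℝ × ℝ) × (ℝ × ℝ)) : Prop :=
  ∀ lam ∈ Icc (0 : ℝ) 1, FreeConf F (pln lam)

/-- The cost of a plan: the sum of the ℓ₁-lengths of the two robot paths. -/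
def planCost (pln : ℝ → (ℝ × ℝ) × (ℝ × ℝ)) : ℝ≥0∞ :=
  l1VarOn (fun t => (pln t).1) (Icc 0 1) + l1VarOn (fun t => (pln t).2) (Icc 0 1)

/-- An optimal `(s,t)`-plan: feasible, and of cost at most that of every feasible plan. -/
def IsOptimalPlan (F : Set (ℝ × ℝ)) (s t : (ℝ × ℝ) × (ℝ × ℝ))
    (pln : ℝ → (ℝ × ℝ) × (ℝ × ℝ)) : Prop :=
  IsPlan s t pln ∧ Feasible F pln ∧
    ∀ pln', IsPlan s t pln' → Feasible F pln' → planCost pln ≤ planCost pln'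

/-- A decoupled plan: `[0,1]` splits into finitely many subintervals on each of which
one of the two robots is parked. -/
def IsDecoupled (pln : ℝ → (ℝ × ℝ) × (ℝ × ℝ)) : Prop :=
  ∃ (n : ℕ) (τ : ℕ → ℝ), τ 0 = 0 ∧ τ n = 1 ∧ (∀ i, i < n → τ i ≤ τ (i + 1)) ∧
    ∀ i, i < n →
      (∀ a ∈ Icc (τ i) (τ (i + 1)), (pln a).1 = (pln (τ i)).1) ∨
      (∀ a ∈ Icc (τ i) (τ (i + 1)), (pln a).2 = (pln (τ i)).2)

/-- A rectilinear path: piecewise linear, with every linear piece horizontal or vertical. -/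
def IsRectilinearPath (γ : ℝ → ℝ × ℝ) : Prop :=
  ∃ (n : ℕ) (τ : ℕ → ℝ), τ 0 = 0 ∧ τ n = 1 ∧ (∀ i, i < n → τ i ≤ τ (i + 1)) ∧
    ∀ i, i < n → ∃ v : ℝ × ℝ, (v.1 = 0 ∨ v.2 = 0) ∧
      ∀ a ∈ Icc (τ i) (τ (i + 1)), γ a = γ (τ i) + (a - τ i) • v

/-- A rectilinear plan: both robot paths are rectilinear. -/
def IsRectilinearPlan (pln : ℝ → (ℝ × ℝ) × (ℝ × ℝ)) : Prop :=
  IsRectilinearPath (fun t => (pln t).1) ∧ IsRectilinearPath (fun t => (pln t).2)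

/-- An alternating path: horizontal and vertical pieces (possibly of zero length)
alternate. -/
def IsAlternatingPath (γ : ℝ → ℝ × ℝ) : Prop :=
  ∃ (n : ℕ) (τ : ℕ → ℝ) (d : ℕ → Bool), τ 0 = 0 ∧ τ n = 1 ∧
    (∀ i, i < n → τ i ≤ τ (i + 1)) ∧
    (∀ i, i + 1 < n → d (i + 1) = !d i) ∧
    ∀ i, i < n → ∃ v : ℝ × ℝ,
      (if d i = true then v.2 = 0 else v.1 = 0) ∧
      ∀ a ∈ Icc (τ i) (τ (i + 1)), γ a = γ (τ i) + (a - τ i) • v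

/-- An alternating plan. -/
def IsAlternatingPlan (pln : ℝ → (ℝ × ℝ) × (ℝ × ℝ)) : Prop :=
  IsAlternatingPath (fun t => (pln t).1) ∧ IsAlternatingPath (fun t => (pln t).2)

/-- `y` is the height of a horizontal edge of `∂F`. -/
def IsHorizEdgeY (F : Set (ℝ × ℝ)) (y : ℝ) : Prop :=
  ∃ a b : ℝ, a < b ∧ (Icc a b ×ˢ ({y} : Set ℝ)) ⊆ frontier F

/-- `x` is the abscissa of a vertical edge of `∂F`. -/
def IsVertEdgeX (F : Set (ℝ × ℝ)) (x : ℝ) : Prop :=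
  ∃ a b : ℝ, a < b ∧ (({x} : Set ℝ) ×ˢ Icc a b) ⊆ frontier F

/-- `y` is the height of a horizontal `i`-line for some `i ≤ k` (w.r.t. the free space `F`
and the set `P` of the four source/target points). -/
def IsHorizLineY (F : Set (ℝ × ℝ)) (P : Set (ℝ × ℝ)) (k : ℕ) (y : ℝ) : Prop :=
  ∃ i : ℕ, i ≤ k ∧
    ((∃ y₀ : ℝ, IsHorizEdgeY F y₀ ∧ |y - y₀| = (i : ℝ)) ∨ ∃ p ∈ P, |y - p.2| = (i : ℝ))

/-- `x` is the abscissa of a vertical `i`-line for some `i ≤ k`. -/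
def IsVertLineX (F : Set (ℝ × ℝ)) (P : Set (ℝ × ℝ)) (k : ℕ) (x : ℝ) : Prop :=
  ∃ i : ℕ, i ≤ k ∧
    ((∃ x₀ : ℝ, IsVertEdgeX F x₀ ∧ |x - x₀| = (i : ℝ)) ∨ ∃ p ∈ P, |x - p.1| = (i : ℝ))

/-- A grid point: a point of `F` lying on a horizontal grid line and a vertical grid line. -/
def IsGridPoint (F : Set (ℝ × ℝ)) (P : Set (ℝ × ℝ)) (u : ℝ × ℝ) : Prop :=
  u ∈ F ∧ IsHorizLineY F P 2 u.2 ∧ IsVertLineX F P 2 u.1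

/-- A grid edge: a closed segment in `F` joining two grid points on a common grid line, with
no grid point in its relative interior. -/
def IsGridEdge (F P : Set (ℝ × ℝ)) (u v : ℝ × ℝ) : Prop :=
  IsGridPoint F P u ∧ IsGridPoint F P v ∧ (u.1 = v.1 ∨ u.2 = v.2) ∧
    segment ℝ u v ⊆ F ∧ ∀ w ∈ openSegment ℝ u v, ¬ IsGridPoint F P w

/-- A vertex of the configuration graph. -/
def ConfVertex (F P : Set (ℝ × ℝ)) (u : (ℝ × ℝ) × (ℝ × ℝ)) : Prop :=
  IsGridPoint F P u.1 ∧ IsGridPoint F P u.2 ∧ 1 ≤ linf (u.1 - u.2)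

/-- An edge of the configuration graph. -/
def ConfEdge (F P : Set (ℝ × ℝ)) (u v : (ℝ × ℝ) × (ℝ × ℝ)) : Prop :=
  ConfVertex F P u ∧ ConfVertex F P v ∧
    ((u.1 = v.1 ∧ IsGridEdge F P u.2 v.2) ∨ (u.2 = v.2 ∧ IsGridEdge F P u.1 v.1))

/-- A path in `S` from `p` to `q`. -/
def IsPathIn (S : Set (ℝ × ℝ)) (p q : ℝ × ℝ) (γ : ℝ → ℝ × ℝ) : Prop :=
  ContinuousOn γ (Icc 0 1) ∧ γ 0 = p ∧ γ 1 = q ∧ ∀ t ∈ Icc (0 : ℝ) 1, γ t ∈ S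

/-- The ℓ₁-length of a path parameterized over `[0,1]`. -/
def pathLen (γ : ℝ → ℝ × ℝ) : ℝ≥0∞ := l1VarOn γ (Icc 0 1)

/-- A shortest path in `S` from `p` to `q` (w.r.t. ℓ₁-length). -/
def IsShortestPathIn (S : Set (ℝ × ℝ)) (p q : ℝ × ℝ) (γ : ℝ → ℝ × ℝ) : Prop :=
  IsPathIn S p q γ ∧ ∀ γ', IsPathIn S p q γ' → pathLen γ ≤ pathLen γ'

/-- An x-monotone path. -/
def XMonotone (γ : ℝ → ℝ × ℝ) : Prop :=
  MonotoneOn (fun t => (γ t).1) (Icc 0 1) ∨ AntitoneOn (fun t => (γ t).1) (Icc 0 1)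

/-- A y-monotone path. -/
def YMonotone (γ : ℝ → ℝ × ℝ) : Prop :=
  MonotoneOn (fun t => (γ t).2) (Icc 0 1) ∨ AntitoneOn (fun t => (γ t).2) (Icc 0 1)

/-- An xy-monotone path. -/
def XYMonotone (γ : ℝ → ℝ × ℝ) : Prop := XMonotone γ ∧ YMonotone γ

/-- The union of the primary horizontal lines (horizontal 0-lines and 1-lines). -/
def primaryHorizSet (F P : Set (ℝ × ℝ)) : Set (ℝ × ℝ) :=
  {p | IsHorizLineY F P 1 p.2}

/-- A corridor: the closure of a connected component of `F` minus the primary horizontal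
lines. -/
def IsCorridor (F P : Set (ℝ × ℝ)) (R : Set (ℝ × ℝ)) : Prop :=
  ∃ c ∈ F \ primaryHorizSet F P,
    R = closure (connectedComponentIn (F \ primaryHorizSet F P) c)

/-- `C` is a connected component of `S`. -/
def IsCompOf (S C : Set (ℝ × ℝ)) : Prop := ∃ c ∈ S, C = connectedComponentIn S c

/-- An x-separated configuration. -/
def XSep (c : (ℝ × ℝ) × (ℝ × ℝ)) : Prop := 1 ≤ |c.1.1 - c.2.1|

/-- A y-separated configuration. -/
def YSep (c : (ℝ × ℝ) × (ℝ × ℝ)) : Prop := 1 ≤ |c.1.2 - c.2.2|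

/-- Two configurations have the same x-order. -/
def SameXOrder (c d : (ℝ × ℝ) × (ℝ × ℝ)) : Prop :=
  Real.sign (c.1.1 - c.2.1) = Real.sign (d.1.1 - d.2.1)

/-- Two configurations have the same y-order. -/
def SameYOrder (c d : (ℝ × ℝ) × (ℝ × ℝ)) : Prop :=
  Real.sign (c.1.2 - c.2.2) = Real.sign (d.1.2 - d.2.2)

/-- During `[a,b]` the path `γ` traverses (affinely) a straight axis-parallel segment
contained in `F` whose endpoints are grid points. -/
def MoveSeg (F P : Set (ℝ × ℝ)) (γ : ℝ → ℝ × ℝ) (a b : ℝ) : Prop :=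
  IsGridPoint F P (γ a) ∧ IsGridPoint F P (γ b) ∧
    segment ℝ (γ a) (γ b) ⊆ F ∧
    ∃ v : ℝ × ℝ, (v.1 = 0 ∨ v.2 = 0) ∧ ∀ t ∈ Icc a b, γ t = γ a + (t - a) • v

/-- A canonical-grid plan: a rectilinear decoupled plan that is a finite concatenation of
moves in each of which one robot is parked at a grid point while the other traverses a
straight axis-parallel segment of the grid contained in `F`; in particular, every
breakpoint of either robot path is a grid point. -/
def IsCanonicalGridPlan (F P : Set (ℝ × ℝ)) (pln : ℝ → (ℝ × ℝ) × (ℝ × ℝ)) : Prop :=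
  IsRectilinearPlan pln ∧ IsDecoupled pln ∧
    ∃ (n : ℕ) (τ : ℕ → ℝ), τ 0 = 0 ∧ τ n = 1 ∧ (∀ i, i < n → τ i ≤ τ (i + 1)) ∧
      ∀ i, i < n →
        (IsGridPoint F P (pln (τ i)).1 ∧
            (∀ a ∈ Icc (τ i) (τ (i + 1)), (pln a).1 = (pln (τ i)).1) ∧
            MoveSeg F P (fun t => (pln t).2) (τ i) (τ (i + 1))) ∨
        (IsGridPoint F P (pln (τ i)).2 ∧
            (∀ a ∈ Icc (τ i) (τ (i + 1)), (pln a).2 = (pln (τ i)).2) ∧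
            MoveSeg F P (fun t => (pln t).1) (τ i) (τ (i + 1)))

/-- A path in the configuration graph from `s` to `t` with `k` edges. -/
def IsGraphPath (F P : Set (ℝ × ℝ)) (s t : (ℝ × ℝ) × (ℝ × ℝ)) (k : ℕ)
    (u : ℕ → (ℝ × ℝ) × (ℝ × ℝ)) : Prop :=
  u 0 = s ∧ u k = t ∧ ∀ j, j < k → ConfEdge F P (u j) (u (j + 1))

/-- The total weight (ℓ₁-distance in `ℝ⁴`) of a path in the configuration graph. -/
def graphPathWeight (k : ℕ) (u : ℕ → (ℝ × ℝ) × (ℝ × ℝ)) : ℝ :=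
  ∑ j ∈ Finset.range k, (l1 ((u (j + 1)).1 - (u j).1) + l1 ((u (j + 1)).2 - (u j).2))

/-- `pln` traverses the edges of the graph path `u` one after another (linearly
interpolating along each edge). -/
def IsEdgeTraversal (pln : ℝ → (ℝ × ℝ) × (ℝ × ℝ)) (k : ℕ)
    (u : ℕ → (ℝ × ℝ) × (ℝ × ℝ)) : Prop :=
  (k = 0 → ∀ a ∈ Icc (0 : ℝ) 1, pln a = u 0) ∧
    ∀ j, j < k → ∀ a ∈ Icc ((j : ℝ) / k) (((j : ℝ) + 1) / k),
      pln a = u j + ((a - (j : ℝ) / k) * k) • (u (j + 1) - u j)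

/-- A blocked pair for the corridor `[xlo,xhi] × [ylo,yhi]`. -/
def BlockedPair (F : Set (ℝ × ℝ)) (xlo xhi ylo yhi : ℝ) (u v : ℝ × ℝ) : Prop :=
  ∃ ρ ρ' edge : Set (ℝ × ℝ),
    ((ρ = Ico (xlo - 1) xlo ×ˢ Ico (ylo - 1) ylo ∧
        ρ' = Ico (xlo - 1) xlo ×ˢ Ioc yhi (yhi + 1) ∧
        edge = ({xlo} : Set ℝ) ×ˢ Icc (ylo - 1) (yhi + 1)) ∨
      (ρ = Ioc xhi (xhi + 1) ×ˢ Ico (ylo - 1) ylo ∧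
        ρ' = Ioc xhi (xhi + 1) ×ˢ Ioc yhi (yhi + 1) ∧
        edge = ({xhi} : Set ℝ) ×ˢ Icc (ylo - 1) (yhi + 1))) ∧
    ∃ φ φ' : Set (ℝ × ℝ), IsCompOf (ρ ∩ F) φ ∧ IsCompOf (ρ' ∩ F) φ' ∧
      (closure φ ∩ edge).Nonempty ∧ (closure φ' ∩ edge).Nonempty ∧
      ((u ∈ φ ∧ v ∈ φ') ∨ (u ∈ φ' ∧ v ∈ φ))

/-- `[ν₁,ν₂] ⊆ [lam1,lam2]` is an unsafe interval for the plan `pln` w.r.t. the influence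
region `IR`. -/
def IsUnsafeInterval (IR : Set (ℝ × ℝ)) (pln : ℝ → (ℝ × ℝ) × (ℝ × ℝ))
    (lam1 lam2 ν₁ ν₂ : ℝ) : Prop :=
  lam1 ≤ ν₁ ∧ ν₁ ≤ ν₂ ∧ ν₂ ≤ lam2 ∧
    (∀ ν ∈ Icc ν₁ ν₂, (pln ν).2 ∈ IR ∧ YSep (pln ν)) ∧
    (∀ a b : ℝ, lam1 ≤ a → a ≤ ν₁ → ν₂ ≤ b → b ≤ lam2 →
      (∀ ν ∈ Icc a b, (pln ν).2 ∈ IR ∧ YSep (pln ν)) → a = ν₁ ∧ b = ν₂) ∧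
    ∃ ν ∈ Icc ν₁ ν₂, ¬ XSep (pln ν)


namespace TR

/-- A configuration of two robots, with coordinates written out. -/
@[ext] structure Cfg where
  a1 : ℝ
  a2 : ℝ
  b1 : ℝ
  b2 : ℝ

def HSeg (F : ℝ → ℝ → Prop) (y x x' : ℝ) : Prop := ∀ t ∈ uIcc x x', F t y
def VSeg (F : ℝ → ℝ → Prop) (x y y' : ℝ) : Prop := ∀ t ∈ uIcc y y', F x t

def RM (F : ℝ → ℝ → Prop) (x y x' y' : ℝ) : Prop :=
  (y = y' ∧ HSeg F y x x') ∨ (x = x' ∧ VSeg F x y y')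

def SSx (e e' : Cfg) : Prop :=
  (e.a1 + 1 ≤ e.b1 ∧ e'.a1 + 1 ≤ e'.b1) ∨ (e.b1 + 1 ≤ e.a1 ∧ e'.b1 + 1 ≤ e'.a1)
def SSy (e e' : Cfg) : Prop :=
  (e.a2 + 1 ≤ e.b2 ∧ e'.a2 + 1 ≤ e'.b2) ∨ (e.b2 + 1 ≤ e.a2 ∧ e'.b2 + 1 ≤ e'.a2)

def Step (F : ℝ → ℝ → Prop) (e e' : Cfg) : Prop :=
  RM F e.a1 e.a2 e'.a1 e'.a2 ∧ RM F e.b1 e.b2 e'.b1 e'.b2 ∧ (SSx e e' ∨ SSy e e')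

def cost (e e' : Cfg) : ℝ := |e.a1 - e'.a1| + |e.a2 - e'.a2| + |e.b1 - e'.b1| + |e.b2 - e'.b2|

theorem uIcc_mem_left {x x' t : ℝ} (h : t ∈ uIcc x x') {s : ℝ} (hs : s ∈ uIcc x t) :
    s ∈ uIcc x x' := by
  rw [mem_uIcc] at *; grind

section segs
variable {F : ℝ → ℝ → Prop}

theorem HSeg.symm {y x x' : ℝ} (h : HSeg F y x x') : HSeg F y x' x := by
  intro t ht; exact h t (by rwa [uIcc_comm] at ht)
theorem VSeg.symm {y x x' : ℝ} (h : VSeg F y x x') : VSeg F y x' x := by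
  intro t ht; exact h t (by rwa [uIcc_comm] at ht)
theorem HSeg.left {y x x' : ℝ} (h : HSeg F y x x') : F x y := h x left_mem_uIcc
theorem HSeg.right {y x x' : ℝ} (h : HSeg F y x x') : F x' y := h x' right_mem_uIcc
theorem VSeg.left {x y y' : ℝ} (h : VSeg F x y y') : F x y := h y left_mem_uIcc
theorem VSeg.right {x y y' : ℝ} (h : VSeg F x y y') : F x y' := h y' right_mem_uIcc
theorem HSeg.refl {y x : ℝ} (h : F x y) : HSeg F y x x := by
  intro t ht; simp at ht; simpa [ht] using h
theorem VSeg.refl {y x : ℝ} (h : F x y) : VSeg F x y y := by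
  intro t ht; simp at ht; simpa [ht] using h
theorem HSeg.trans {y x x' x'' : ℝ} (h : HSeg F y x x') (h' : HSeg F y x' x'') :
    HSeg F y x x'' := by
  intro t ht
  have : t ∈ uIcc x x' ∨ t ∈ uIcc x' x'' := by
    simp only [mem_uIcc] at *; grind
  exact this.elim (h t) (h' t)
theorem VSeg.trans {y x x' x'' : ℝ} (h : VSeg F y x x') (h' : VSeg F y x' x'') :
    VSeg F y x x'' := by
  intro t ht
  have : t ∈ uIcc x x' ∨ t ∈ uIcc x' x'' := by
    simp only [mem_uIcc] at *; grind
  exact this.elim (h t) (h' t)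
theorem HSeg.sub {y x x' s s' : ℝ} (h : HSeg F y x x') (hs : s ∈ uIcc x x')
    (hs' : s' ∈ uIcc x x') : HSeg F y s s' :=
  fun t ht => h t (by simp only [mem_uIcc] at *; grind)
theorem VSeg.sub {y x x' s s' : ℝ} (h : VSeg F y x x') (hs : s ∈ uIcc x x')
    (hs' : s' ∈ uIcc x x') : VSeg F y s s' :=
  fun t ht => h t (by simp only [mem_uIcc] at *; grind)
theorem RM.symm {x y x' y' : ℝ} (h : RM F x y x' y') : RM F x' y' x y := by
  rcases h with ⟨rfl, h⟩ | ⟨rfl, h⟩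
  · exact Or.inl ⟨rfl, h.symm⟩
  · exact Or.inr ⟨rfl, h.symm⟩
theorem RM.refl {x y : ℝ} (h : F x y) : RM F x y x y := Or.inl ⟨rfl, HSeg.refl h⟩
theorem RM.left {x y x' y' : ℝ} (h : RM F x y x' y') : F x y := by
  rcases h with ⟨rfl, h⟩ | ⟨rfl, h⟩
  · exact h.left
  · exact h.left
theorem RM.right {x y x' y' : ℝ} (h : RM F x y x' y') : F x' y' := h.symm.left
theorem RM.hseg {x y x' y' : ℝ} (h : RM F x y x' y') (hy : y = y') : HSeg F y x x' := by
  rcases h with ⟨_, h⟩ | ⟨rfl, h⟩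
  · exact h
  · exact HSeg.refl h.left
theorem RM.vseg {x y x' y' : ℝ} (h : RM F x y x' y') (hy : y ≠ y') : x = x' ∧ VSeg F x y y' := by
  rcases h with ⟨h, _⟩ | ⟨rfl, h⟩
  · exact absurd h hy
  · exact ⟨rfl, h⟩
end segs

/-- The abstract environment for the treatment of heights. -/
structure Env where
  F : ℝ → ℝ → Prop
  X : Set ℝ
  Y : Set ℝ
  B : Set ℝ
  C : ℝ
  R : ℝ
  bdd : ∀ x y, F x y → |y| ≤ R
  hC : 4 * R + 1 ≤ C
  gap : ∀ x y y', F x y → F x y' → |y - y'| ≤ 1 → VSeg F x y y'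
  BY : B ⊆ Y
  Yp : ∀ y ∈ Y, y + 1 ∈ Y
  Ym : ∀ y ∈ Y, y - 1 ∈ Y
  succ : ∀ y ∈ Y, ∃ z ∈ Y, y < z ∧ ∀ w ∈ Y, ¬ (y < w ∧ w < z)
  pred : ∀ y ∈ Y, ∃ z ∈ Y, z < y ∧ ∀ w ∈ Y, ¬ (z < w ∧ w < y)
  colU : ∀ x, ∀ y ∈ Y, ∀ z ∈ Y, y < z → (∀ w ∈ Y, ¬ (y < w ∧ w < z)) →
    ∀ t, y < t → VSeg F x y t → VSeg F x y z
  colD : ∀ x, ∀ y ∈ Y, ∀ z ∈ Y, z < y → (∀ w ∈ Y, ¬ (z < w ∧ w < y)) →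
    ∀ t, t < y → VSeg F x y t → VSeg F x y z
  rise : ∀ x x' y z, y ≤ z → x ≠ x' → HSeg F y x x' → (∀ b ∈ B, ¬ (y ≤ b ∧ b < z)) →
    ∀ t ∈ uIcc x x', VSeg F t y z
  fall : ∀ x x' y z, z ≤ y → x ≠ x' → HSeg F y x x' → (∀ b ∈ B, ¬ (z < b ∧ b ≤ y)) →
    ∀ t ∈ uIcc x x', VSeg F t y z
  discU : ∀ y, ∃ z, y < z ∧ ∀ b ∈ B, ¬ (y < b ∧ b < z)
  discD : ∀ y, ∃ z, z < y ∧ ∀ b ∈ B, ¬ (z < b ∧ b < y)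

def near (E : Env) (o m : ℝ) : Prop :=
  o + 1 ≤ m ∧ ∀ b ∈ E.B, ¬ (o ≤ b ∧ b ≤ m - 1) ∧ ¬ (o + 1 ≤ b ∧ b ≤ m)

def TBU (E : Env) (x m : ℝ) : Prop :=
  ∃ e, m ≤ e ∧ VSeg E.F x m e ∧ (∀ z, e < z → ¬ VSeg E.F x e z) ∧ ∀ b ∈ E.B, ¬ (m ≤ b ∧ b ≤ e)
def TBD (E : Env) (x m : ℝ) : Prop :=
  ∃ e, e ≤ m ∧ VSeg E.F x m e ∧ (∀ z, z < e → ¬ VSeg E.F x e z) ∧ ∀ b ∈ E.B, ¬ (e ≤ b ∧ b ≤ m)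

def Sub (E : Env) (y x y' x' : ℝ) : Prop := ∀ t, HSeg E.F y x t → HSeg E.F y' x' t

def Up (E : Env) (ox o mx m : ℝ) : Prop := TBD E ox o ∨ (Sub E m mx o ox ∧ ¬ TBU E mx m)
def Dn (E : Env) (ox o mx m : ℝ) : Prop := TBU E mx m ∨ (Sub E o ox m mx ∧ ¬ TBD E ox o)

open Classical in
def ind (p : Prop) : ℝ := if p then 1 else 0

theorem ind_nonneg (p : Prop) : 0 ≤ ind p := by unfold ind; split_ifs <;> norm_num
theorem ind_le (p : Prop) : ind p ≤ 1 := by unfold ind; split_ifs <;> norm_num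
theorem ind_true {p : Prop} (h : p) : ind p = 1 := by simp [ind, h]
theorem ind_false {p : Prop} (h : ¬ p) : ind p = 0 := by simp [ind, h]
theorem ind_congr {p q : Prop} (h : p ↔ q) : ind p = ind q := by rw [propext h]

open Classical in
def vv (E : Env) (ox o mx m : ℝ) : ℝ :=
  if near E o m then E.C + (1 + ind (Dn E ox o mx m)) * o - (1 + ind (Up E ox o mx m)) * m else 0

def val (E : Env) (e : Cfg) : ℝ := vv E e.a1 e.a2 e.b1 e.b2 + vv E e.b1 e.b2 e.a1 e.a2

open Classical in
def kk (e e' : Cfg) : ℕ := if SSx e e' then 0 else 1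

open Classical in
def pp (E : Env) (e e' : Cfg) : ℝ := if SSx e e' then 0 else val E e + val E e'

def qq (E : Env) (e e' : Cfg) : ℝ := E.C + (e.a2 + e.b2 + e'.a2 + e'.b2)

structure Grid (E : Env) (e : Cfg) : Prop where
  fa : E.F e.a1 e.a2
  fb : E.F e.b1 e.b2
  xa : e.a1 ∈ E.X
  xb : e.b1 ∈ E.X
  ya : e.a2 ∈ E.Y
  yb : e.b2 ∈ E.Y

inductive Wk (E : Env) : Cfg → Cfg → ℝ → ℕ → ℝ → ℝ → Prop
  | nil (e : Cfg) : Grid E e → Wk E e e 0 0 0 0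
  | cons (e e' e'' : Cfg) (c : ℝ) (k : ℕ) (p q : ℝ) : Grid E e → Step E.F e e' →
      Wk E e' e'' c k p q →
      Wk E e e'' (cost e e' + c) (kk e e' + k) (pp E e e' + p) (qq E e e' + q)

section basic
variable {E : Env}

theorem vv_bound (E : Env) {ox o mx m : ℝ} (ho : E.F ox o) (hm : E.F mx m) :
    (near E o m → 0 < vv E ox o mx m) := by
  intro hn
  unfold vv
  rw [if_pos hn]
  have h1 := E.bdd _ _ ho
  have h2 := E.bdd _ _ hm
  have := E.hC
  rw [abs_le] at h1 h2
  have hd := ind_nonneg (Dn E ox o mx m)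
  have hd' := ind_le (Dn E ox o mx m)
  have hu := ind_nonneg (Up E ox o mx m)
  have hu' := ind_le (Up E ox o mx m)
  nlinarith

theorem vv_nonneg (E : Env) {ox o mx m : ℝ} (ho : E.F ox o) (hm : E.F mx m) :
    0 ≤ vv E ox o mx m := by
  by_cases hn : near E o m
  · exact (vv_bound E ho hm hn).le
  · simp [vv, hn]

theorem val_nonneg {e : Cfg} (h : Grid E e) : 0 ≤ val E e :=
  add_nonneg (vv_nonneg E h.fa h.fb) (vv_nonneg E h.fb h.fa)

theorem pp_nonneg {e e' : Cfg} (h : Grid E e) (h' : Grid E e') : 0 ≤ pp E e e' := by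
  unfold pp; split_ifs
  · exact le_rfl
  · exact add_nonneg (val_nonneg h) (val_nonneg h')

theorem qq_nonneg {e e' : Cfg} (h : Grid E e) (h' : Grid E e') : 0 ≤ qq E e e' := by
  have h1 := E.bdd _ _ h.fa
  have h2 := E.bdd _ _ h.fb
  have h3 := E.bdd _ _ h'.fa
  have h4 := E.bdd _ _ h'.fb
  have := E.hC
  rw [abs_le] at *
  unfold qq; linarith

theorem cost_nonneg (e e' : Cfg) : 0 ≤ cost e e' := by unfold cost; positivity

theorem cost_comm (e e' : Cfg) : cost e e' = cost e' e := by
  unfold cost; rw [abs_sub_comm e.a1, abs_sub_comm e.a2, abs_sub_comm e.b1, abs_sub_comm e.b2]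

theorem cost_self (e : Cfg) : cost e e = 0 := by simp [cost]

theorem cost_tri (e e' e'' : Cfg) : cost e e'' ≤ cost e e' + cost e' e'' := by
  unfold cost
  have h1 := abs_sub_le e.a1 e'.a1 e''.a1
  have h2 := abs_sub_le e.a2 e'.a2 e''.a2
  have h3 := abs_sub_le e.b1 e'.b1 e''.b1
  have h4 := abs_sub_le e.b2 e'.b2 e''.b2
  linarith

theorem SSx.symm {e e' : Cfg} (h : SSx e e') : SSx e' e := by unfold SSx at *; tauto
theorem SSy.symm {e e' : Cfg} (h : SSy e e') : SSy e' e := by unfold SSy at *; tauto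
theorem SSx_comm {e e' : Cfg} : SSx e e' ↔ SSx e' e := ⟨SSx.symm, SSx.symm⟩
theorem Step.symm {F} {e e' : Cfg} (h : Step F e e') : Step F e' e :=
  ⟨h.1.symm, h.2.1.symm, h.2.2.imp SSx.symm SSy.symm⟩
theorem kk_comm (e e' : Cfg) : kk e e' = kk e' e := by
  unfold kk; rw [propext (SSx_comm (e := e) (e' := e'))]
theorem pp_comm (e e' : Cfg) : pp E e e' = pp E e' e := by
  unfold pp; rw [propext (SSx_comm (e := e) (e' := e')), add_comm]
theorem qq_comm (e e' : Cfg) : qq E e e' = qq E e' e := by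
  unfold qq; ring

theorem Wk.gridL {e e' c k p q} (h : Wk E e e' c k p q) : Grid E e := by
  cases h <;> assumption
theorem Wk.gridR {e e' c k p q} (h : Wk E e e' c k p q) : Grid E e' := by
  induction h <;> assumption

theorem Wk.trans {e e' e'' c k p q c' k' p' q'} (h : Wk E e e' c k p q)
    (h' : Wk E e' e'' c' k' p' q') : Wk E e e'' (c + c') (k + k') (p + p') (q + q') := by
  induction h with
  | nil => simpa using h'
  | cons e f g c k p q hg hs _ ih =>
    have := Wk.cons e f e'' _ _ _ _ hg hs (ih h')
    simpa [add_assoc] using this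

theorem Wk.single {e e'} (h : Grid E e) (h' : Grid E e') (hs : Step E.F e e') :
    Wk E e e' (cost e e') (kk e e') (pp E e e') (qq E e e') := by
  simpa using Wk.cons e e' e' 0 0 0 0 h hs (Wk.nil e' h')

theorem Wk.free {e e'} (h : Grid E e) (h' : Grid E e')
    (ha : RM E.F e.a1 e.a2 e'.a1 e'.a2) (hb : RM E.F e.b1 e.b2 e'.b1 e'.b2)
    (hs : SSx e e') : Wk E e e' (cost e e') 0 0 (qq E e e') := by
  have := Wk.single h h' ⟨ha, hb, Or.inl hs⟩
  simpa [kk, pp, hs] using this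

theorem Wk.rev {e e' c k p q} (h : Wk E e e' c k p q) : Wk E e' e c k p q := by
  induction h with
  | nil e he => exact Wk.nil e he
  | cons e f g c k p q hg hs hw ih =>
    have := ih.trans (Wk.single hw.gridL hg hs.symm)
    rw [cost_comm, kk_comm, pp_comm, qq_comm] at this
    simpa [add_comm] using this

theorem Wk.nonneg {e e' c k p q} (h : Wk E e e' c k p q) : 0 ≤ c ∧ 0 ≤ p ∧ 0 ≤ q := by
  induction h with
  | nil => simp
  | cons e f g c k p q hg hs hw ih =>
    exact ⟨add_nonneg (cost_nonneg _ _) ih.1, add_nonneg (pp_nonneg hg hw.gridL) ih.2.1,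
      add_nonneg (qq_nonneg hg hw.gridL) ih.2.2⟩

def Walk (E : Env) (n : ℕ) (u : ℕ → Cfg) : Prop :=
  (∀ i ≤ n, Grid E (u i)) ∧ ∀ i < n, Step E.F (u i) (u (i + 1))

open Finset in
theorem Walk.wk {n u} (h : Walk E n u) : ∀ j ≤ n, ∀ i ≤ j, Wk E (u i) (u j)
    (∑ l ∈ Finset.Ico i j, cost (u l) (u (l + 1)))
    (∑ l ∈ Finset.Ico i j, kk (u l) (u (l + 1)))
    (∑ l ∈ Finset.Ico i j, pp E (u l) (u (l + 1)))
    (∑ l ∈ Finset.Ico i j, qq E (u l) (u (l + 1))) := by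
  intro j
  induction j with
  | zero =>
    intro _ i hi
    obtain rfl : i = 0 := by omega
    simpa using Wk.nil _ (h.1 0 (by omega))
  | succ j ih =>
    intro hj i hi
    rcases Nat.eq_or_lt_of_le hi with rfl | hlt
    · simpa using Wk.nil _ (h.1 _ hj)
    · have := (ih (by omega) i (by omega)).trans
        (Wk.single (h.1 j (by omega)) (h.1 (j + 1) hj) (h.2 j (by omega)))
      simpa [Finset.sum_Ico_succ_top (show i ≤ j by omega)] using this

theorem Wk.toWalk {e e' c k p q} (h : Wk E e e' c k p q) : ∃ n u, Walk E n u ∧ u 0 = e ∧ u n = e' ∧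
    c = ∑ l ∈ Finset.range n, cost (u l) (u (l + 1)) ∧
    k = ∑ l ∈ Finset.range n, kk (u l) (u (l + 1)) ∧
    p = ∑ l ∈ Finset.range n, pp E (u l) (u (l + 1)) ∧
    q = ∑ l ∈ Finset.range n, qq E (u l) (u (l + 1)) := by
  induction h with
  | nil e he => exact ⟨0, fun _ => e, ⟨fun _ _ => he, by simp⟩, rfl, rfl, by simp⟩
  | cons e f g c k p q hg hs hw ih =>
    obtain ⟨n, u, hu, h0, hn, hc, hk, hp, hq⟩ := ih
    refine ⟨n + 1, fun i => if i = 0 then e else u (i - 1), ⟨?_, ?_⟩, by simp, by simpa using hn, ?_⟩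
    · intro i hi
      rcases i with _ | i
      · simpa using hg
      · simpa using hu.1 i (by omega)
    · intro i hi
      rcases i with _ | i
      · simpa [h0] using hs
      · simpa using hu.2 i (by omega)
    · simp only [Finset.sum_range_succ', hc, hk, hp, hq]
      simp [h0, add_comm]

/-- Optimality with respect to cost, number of K-steps, and potential. -/
structure Opt3 (E : Env) (n : ℕ) (u : ℕ → Cfg) : Prop where
  walk : Walk E n u
  a0 : (u 0).a2 ∈ E.B
  b0 : (u 0).b2 ∈ E.B
  an : (u n).a2 ∈ E.B
  bn : (u n).b2 ∈ E.B
  min : ∀ c k p q, Wk E (u 0) (u n) c k p q →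
    (∑ l ∈ Finset.range n, cost (u l) (u (l + 1)) ≤ c ∧
      (c ≤ ∑ l ∈ Finset.range n, cost (u l) (u (l + 1)) →
        ∑ l ∈ Finset.range n, kk (u l) (u (l + 1)) ≤ k ∧
        (k ≤ ∑ l ∈ Finset.range n, kk (u l) (u (l + 1)) →
          ∑ l ∈ Finset.range n, pp E (u l) (u (l + 1)) ≤ p)))

/-- Also optimal for the sum of heights. -/
structure Opt (E : Env) (n : ℕ) (u : ℕ → Cfg) : Prop extends Opt3 E n u where
  minq : ∀ c k p q, Wk E (u 0) (u n) c k p q →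
    c ≤ ∑ l ∈ Finset.range n, cost (u l) (u (l + 1)) →
    k ≤ ∑ l ∈ Finset.range n, kk (u l) (u (l + 1)) →
    p ≤ ∑ l ∈ Finset.range n, pp E (u l) (u (l + 1)) →
    ∑ l ∈ Finset.range n, qq E (u l) (u (l + 1)) ≤ q

/-- step `i` is not x-separated -/
def KK (u : ℕ → Cfg) (i : ℕ) : Prop := ¬ SSx (u i) (u (i + 1))

theorem Opt3.ex {n u} (h : Opt3 E n u) {i j l : ℕ} (hij : i ≤ l) (hl : l < j) (hj : j ≤ n)
    (hK : KK u l) {c q} (hw : Wk E (u i) (u j) c 0 0 q)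
    (hc : c ≤ ∑ l ∈ Finset.Ico i j, cost (u l) (u (l + 1))) : False := by
  have w1 := h.walk.wk i (by omega) 0 (by omega)
  have w2 := h.walk.wk n le_rfl j hj
  have w := h.min _ _ _ _ ((w1.trans hw).trans w2)
  have e : ∀ {M : Type} [AddCommMonoid M] (f : ℕ → M), ∑ l ∈ Finset.range n, f l =
      ∑ l ∈ Finset.Ico 0 i, f l + ∑ l ∈ Finset.Ico i j, f l + ∑ l ∈ Finset.Ico j n, f l := by
    intro M _ f
    rw [Finset.sum_Ico_consecutive _ (by omega) (by omega),
      Finset.sum_Ico_consecutive _ (by omega) (by omega), Finset.range_eq_Ico]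
  rw [e, e, e] at w
  have := (w.2 (by linarith)).1
  have hk : 1 ≤ ∑ l ∈ Finset.Ico i j, kk (u l) (u (l + 1)) := by
    have h1 : kk (u l) (u (l + 1)) = 1 := by unfold KK at hK; simp [kk, hK]
    refine h1.symm.le.trans ?_
    exact Finset.single_le_sum (f := fun l => kk (u l) (u (l + 1))) (fun _ _ => Nat.zero_le _)
      (Finset.mem_Ico.2 ⟨hij, hl⟩)
  omega

end basic

end TR

namespace TR

theorem neg_mem_uIcc {t x x' : ℝ} : -t ∈ uIcc x x' ↔ t ∈ uIcc (-x) (-x') := by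
  simp only [mem_uIcc]; constructor <;> rintro (h | h) <;> first | (left; constructor <;> linarith [h.1, h.2]) | (right; constructor <;> linarith [h.1, h.2])

theorem HSeg_fx {F : ℝ → ℝ → Prop} {y x x'} :
    HSeg (fun x y => F (-x) y) y x x' ↔ HSeg F y (-x) (-x') := by
  constructor
  · intro h t ht
    have := h (-t) (by rw [neg_mem_uIcc]; exact ht)
    simpa using this
  · intro h t ht
    exact h (-t) (by rw [neg_mem_uIcc]; simpa using ht)
theorem VSeg_fx {F : ℝ → ℝ → Prop} {y x x'} :
    VSeg (fun x y => F (-x) y) y x x' ↔ VSeg F (-y) x x' := Iff.rfl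
theorem VSeg_fy {F : ℝ → ℝ → Prop} {y x x'} :
    VSeg (fun x y => F x (-y)) y x x' ↔ VSeg F y (-x) (-x') := by
  constructor
  · intro h t ht
    have := h (-t) (by rw [neg_mem_uIcc]; exact ht)
    simpa using this
  · intro h t ht
    exact h (-t) (by rw [neg_mem_uIcc]; simpa using ht)
theorem HSeg_fy {F : ℝ → ℝ → Prop} {y x x'} :
    HSeg (fun x y => F x (-y)) y x x' ↔ HSeg F (-y) x x' := Iff.rfl

def Env.fx (E : Env) : Env where
  F := fun x y => E.F (-x) y
  X := {x | -x ∈ E.X}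
  Y := E.Y
  B := E.B
  C := E.C
  R := E.R
  bdd := fun x y h => E.bdd _ _ h
  hC := E.hC
  gap := fun x y y' h h' hh => VSeg_fx.2 (E.gap _ _ _ h h' hh)
  BY := E.BY
  Yp := E.Yp
  Ym := E.Ym
  succ := E.succ
  pred := E.pred
  colU := fun x y hy z hz h1 h2 t h3 h4 => VSeg_fx.2 (E.colU _ y hy z hz h1 h2 t h3 (VSeg_fx.1 h4))
  colD := fun x y hy z hz h1 h2 t h3 h4 => VSeg_fx.2 (E.colD _ y hy z hz h1 h2 t h3 (VSeg_fx.1 h4))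
  rise := fun x x' y z h1 h2 h3 h4 t ht => VSeg_fx.2 (E.rise (-x) (-x') y z h1 (by simpa using h2)
    (HSeg_fx.1 h3) h4 (-t) (by rw [neg_mem_uIcc]; simpa using ht))
  fall := fun x x' y z h1 h2 h3 h4 t ht => VSeg_fx.2 (E.fall (-x) (-x') y z h1 (by simpa using h2)
    (HSeg_fx.1 h3) h4 (-t) (by rw [neg_mem_uIcc]; simpa using ht))
  discU := E.discU
  discD := E.discD

def Env.fy (E : Env) : Env where
  F := fun x y => E.F x (-y)
  X := E.X
  Y := {y | -y ∈ E.Y}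
  B := {y | -y ∈ E.B}
  C := E.C
  R := E.R
  bdd := fun x y h => by simpa using E.bdd _ _ h
  hC := E.hC
  gap := fun x y y' h h' hh => VSeg_fy.2 (E.gap _ _ _ h h' (by
    rw [show -y - -y' = -(y - y') by ring, abs_neg]; exact hh))
  BY := fun y hy => E.BY hy
  Yp := fun y hy => by
    have := E.Ym _ hy
    show -(y + 1) ∈ E.Y
    rwa [show -(y + 1) = -y - 1 by ring]
  Ym := fun y hy => by
    have := E.Yp _ hy
    show -(y - 1) ∈ E.Y
    rwa [show -(y - 1) = -y + 1 by ring]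
  succ := fun y hy => by
    obtain ⟨z, hz, h1, h2⟩ := E.pred _ hy
    refine ⟨-z, by simpa using hz, by linarith, fun w hw h => h2 _ hw ⟨by linarith, by linarith⟩⟩
  pred := fun y hy => by
    obtain ⟨z, hz, h1, h2⟩ := E.succ _ hy
    refine ⟨-z, by simpa using hz, by linarith, fun w hw h => h2 _ hw ⟨by linarith, by linarith⟩⟩
  colU := fun x y hy z hz h1 h2 t h3 h4 => VSeg_fy.2 (E.colD _ (-y) hy (-z) hz (by linarith)
    (fun w hw h => h2 (-w) (by simpa using hw) ⟨by linarith, by linarith⟩)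
     (-t) (by linarith) (VSeg_fy.1 h4))
  colD := fun x y hy z hz h1 h2 t h3 h4 => VSeg_fy.2 (E.colU _ (-y) hy (-z) hz (by linarith)
    (fun w hw h => h2 (-w) (by simpa using hw) ⟨by linarith, by linarith⟩)
     (-t) (by linarith) (VSeg_fy.1 h4))
  rise := fun x x' y z h1 h2 h3 h4 t ht => VSeg_fy.2 (E.fall x x' (-y) (-z) (by linarith) h2
    h3 (fun b hb h => h4 (-b) (by simpa using hb) ⟨by linarith, by linarith⟩) t ht)
  fall := fun x x' y z h1 h2 h3 h4 t ht => VSeg_fy.2 (E.rise x x' (-y) (-z) (by linarith) h2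
    h3 (fun b hb h => h4 (-b) (by simpa using hb) ⟨by linarith, by linarith⟩) t ht)
  discU := fun y => by
    obtain ⟨z, h1, h2⟩ := E.discD (-y)
    exact ⟨-z, by linarith, fun b hb h => h2 (-b) hb ⟨by linarith, by linarith⟩⟩
  discD := fun y => by
    obtain ⟨z, h1, h2⟩ := E.discU (-y)
    exact ⟨-z, by linarith, fun b hb h => h2 (-b) hb ⟨by linarith, by linarith⟩⟩

def Cfg.sw (e : Cfg) : Cfg := ⟨e.b1, e.b2, e.a1, e.a2⟩
def Cfg.fx (e : Cfg) : Cfg := ⟨-e.a1, e.a2, -e.b1, e.b2⟩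
def Cfg.fy (e : Cfg) : Cfg := ⟨e.a1, -e.a2, e.b1, -e.b2⟩

@[simp] theorem Cfg.sw_a1 (e : Cfg) : e.sw.a1 = e.b1 := rfl
@[simp] theorem Cfg.sw_a2 (e : Cfg) : e.sw.a2 = e.b2 := rfl
@[simp] theorem Cfg.sw_b1 (e : Cfg) : e.sw.b1 = e.a1 := rfl
@[simp] theorem Cfg.sw_b2 (e : Cfg) : e.sw.b2 = e.a2 := rfl
@[simp] theorem Cfg.fx_a1 (e : Cfg) : e.fx.a1 = -e.a1 := rfl
@[simp] theorem Cfg.fx_a2 (e : Cfg) : e.fx.a2 = e.a2 := rfl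
@[simp] theorem Cfg.fx_b1 (e : Cfg) : e.fx.b1 = -e.b1 := rfl
@[simp] theorem Cfg.fx_b2 (e : Cfg) : e.fx.b2 = e.b2 := rfl
@[simp] theorem Cfg.fy_a1 (e : Cfg) : e.fy.a1 = e.a1 := rfl
@[simp] theorem Cfg.fy_a2 (e : Cfg) : e.fy.a2 = -e.a2 := rfl
@[simp] theorem Cfg.fy_b1 (e : Cfg) : e.fy.b1 = e.b1 := rfl
@[simp] theorem Cfg.fy_b2 (e : Cfg) : e.fy.b2 = -e.b2 := rfl
@[simp] theorem Cfg.sw_sw (e : Cfg) : e.sw.sw = e := rfl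
@[simp] theorem Cfg.fx_fx (e : Cfg) : e.fx.fx = e := by ext <;> simp
@[simp] theorem Cfg.fy_fy (e : Cfg) : e.fy.fy = e := by ext <;> simp

/-- A symmetry between two environments. -/
structure Symm (E E' : Env) (φ : Cfg → Cfg) : Prop where
  inv : ∀ e, φ (φ e) = e
  grid : ∀ e, Grid E e → Grid E' (φ e)
  grid' : ∀ e, Grid E' e → Grid E (φ e)
  step : ∀ e e', Step E.F e e' → Step E'.F (φ e) (φ e')
  step' : ∀ e e', Step E'.F e e' → Step E.F (φ e) (φ e')
  cost : ∀ e e', cost (φ e) (φ e') = TR.cost e e'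
  ssx : ∀ e e', SSx (φ e) (φ e') ↔ SSx e e'
  val : ∀ e, val E' (φ e) = TR.val E e
  bdy : ∀ e, e.a2 ∈ E.B → e.b2 ∈ E.B → (φ e).a2 ∈ E'.B ∧ (φ e).b2 ∈ E'.B

theorem Symm.kk {E E' φ} (s : Symm E E' φ) (e e' : Cfg) : kk (φ e) (φ e') = TR.kk e e' := by
  unfold TR.kk; rw [propext (s.ssx e e')]
theorem Symm.pp {E E' φ} (s : Symm E E' φ) (e e' : Cfg) : pp E' (φ e) (φ e') = TR.pp E e e' := by
  unfold TR.pp; rw [propext (s.ssx e e'), s.val, s.val]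
theorem Symm.wk {E E' φ} (s : Symm E E' φ) {e e' c k p q} (h : Wk E' e e' c k p q) :
    ∃ q', Wk E (φ e) (φ e') c k p q' := by
  induction h with
  | nil e he => exact ⟨0, Wk.nil _ (s.grid' _ he)⟩
  | cons e f g c k p q hg hs hw ih =>
    obtain ⟨q', ih⟩ := ih
    refine ⟨qq E (φ e) (φ f) + q', ?_⟩
    have := Wk.cons (φ e) (φ f) (φ g) c k p q' (s.grid' _ hg) (s.step' _ _ hs) ih
    have h1 : TR.cost (φ e) (φ f) = TR.cost e f := s.cost e f
    have h2 : TR.kk (φ e) (φ f) = TR.kk e f := s.kk e f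
    have h3 : TR.pp E (φ e) (φ f) = TR.pp E' e f := by
      rw [← s.pp, s.inv, s.inv]
    rw [h1, h2, h3] at this
    exact this

theorem Symm.opt3 {E E' φ} (s : Symm E E' φ) {n u} (h : Opt3 E n u) :
    Opt3 E' n (fun i => φ (u i)) := by
  refine ⟨⟨fun i hi => s.grid _ (h.walk.1 i hi), fun i hi => s.step _ _ (h.walk.2 i hi)⟩,
    (s.bdy _ h.a0 h.b0).1, (s.bdy _ h.a0 h.b0).2, (s.bdy _ h.an h.bn).1, (s.bdy _ h.an h.bn).2, ?_⟩
  intro c k p q hw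
  obtain ⟨q', hw⟩ := s.wk hw
  rw [s.inv, s.inv] at hw
  have := h.min _ _ _ _ hw
  simpa [s.kk, s.pp, s.cost] using this

theorem symm_sw (E : Env) : Symm E E Cfg.sw where
  inv := by simp
  grid := fun e h => ⟨h.fb, h.fa, h.xb, h.xa, h.yb, h.ya⟩
  grid' := fun e h => ⟨h.fb, h.fa, h.xb, h.xa, h.yb, h.ya⟩
  step := fun e e' h => ⟨h.2.1, h.1, h.2.2.imp Or.symm Or.symm⟩
  step' := fun e e' h => ⟨h.2.1, h.1, h.2.2.imp Or.symm Or.symm⟩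
  cost := fun e e' => by simp [cost]; ring
  ssx := fun e e' => by simp [SSx]; tauto
  val := fun e => by simp [val]; ring
  bdy := fun e h h' => ⟨h', h⟩

theorem RM_fx {F x y x' y'} : RM F x y x' y' ↔ RM (fun x y => F (-x) y) (-x) y (-x') y' := by
  unfold RM; rw [HSeg_fx, VSeg_fx]; simp
theorem RM_fy {F x y x' y'} : RM F x y x' y' ↔ RM (fun x y => F x (-y)) x (-y) x' (-y') := by
  unfold RM; rw [HSeg_fy, VSeg_fy]; simp

theorem TBU_fx {E : Env} {x m} : TBU E.fx (-x) m ↔ TBU E x m := by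
  unfold TBU Env.fx; simp only [VSeg_fx, neg_neg]
theorem TBD_fx {E : Env} {x m} : TBD E.fx (-x) m ↔ TBD E x m := by
  unfold TBD Env.fx; simp only [VSeg_fx, neg_neg]
theorem Sub_fx {E : Env} {y x y' x'} : Sub E.fx y (-x) y' (-x') ↔ Sub E y x y' x' := by
  unfold Sub Env.fx; simp only [HSeg_fx, neg_neg]
  exact ⟨fun h t => by simpa using h (-t), fun h t => h (-t)⟩
theorem TBU_fy {E : Env} {x m} : TBU E.fy x (-m) ↔ TBD E x m := by
  unfold TBU TBD Env.fy; simp only [VSeg_fy, neg_neg]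
  constructor
  · rintro ⟨e, h1, h2, h3, h4⟩
    exact ⟨-e, by linarith, h2, fun z hz => by simpa using h3 (-z) (by linarith),
      fun b hb h => h4 (-b) (by simpa using hb) ⟨by linarith [h.2], by linarith [h.1]⟩⟩
  · rintro ⟨e, h1, h2, h3, h4⟩
    exact ⟨-e, by linarith, by simpa using h2, fun z hz => by simpa using h3 (-z) (by linarith),
      fun b hb h => h4 (-b) (by simpa using hb) ⟨by linarith [h.2], by linarith [h.1]⟩⟩
theorem TBD_fy {E : Env} {x m} : TBD E.fy x (-m) ↔ TBU E x m := by
  unfold TBU TBD Env.fy; simp only [VSeg_fy, neg_neg]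
  constructor
  · rintro ⟨e, h1, h2, h3, h4⟩
    exact ⟨-e, by linarith, h2, fun z hz => by simpa using h3 (-z) (by linarith),
      fun b hb h => h4 (-b) (by simpa using hb) ⟨by linarith [h.2], by linarith [h.1]⟩⟩
  · rintro ⟨e, h1, h2, h3, h4⟩
    exact ⟨-e, by linarith, by simpa using h2, fun z hz => by simpa using h3 (-z) (by linarith),
      fun b hb h => h4 (-b) (by simpa using hb) ⟨by linarith [h.2], by linarith [h.1]⟩⟩
theorem Sub_fy {E : Env} {y x y' x'} : Sub E.fy (-y) x (-y') x' ↔ Sub E y x y' x' := by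
  unfold Sub Env.fy; simp only [HSeg_fy, neg_neg]
theorem near_fy {E : Env} {o m} : near E.fy (-m) (-o) ↔ near E o m := by
  unfold near
  constructor
  · rintro ⟨h1, h2⟩
    refine ⟨by linarith, fun b hb => ⟨fun h => (h2 (-b) (by simpa [Env.fy] using hb)).2 ⟨by linarith [h.1, h.2], by linarith [h.1, h.2]⟩, fun h => (h2 (-b) (by simpa [Env.fy] using hb)).1 ⟨by linarith [h.1, h.2], by linarith [h.1, h.2]⟩⟩⟩
  · rintro ⟨h1, h2⟩
    refine ⟨by linarith, fun b hb => ⟨fun h => (h2 (-b) (by simpa [Env.fy] using hb)).2 ⟨by linarith [h.1, h.2], by linarith [h.1, h.2]⟩, fun h => (h2 (-b) (by simpa [Env.fy] using hb)).1 ⟨by linarith [h.1, h.2], by linarith [h.1, h.2]⟩⟩⟩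
theorem near_fx {E : Env} {o m} : near E.fx o m ↔ near E o m := Iff.rfl

theorem vv_fx {E : Env} {ox o mx m} : vv E.fx (-ox) o (-mx) m = vv E ox o mx m := by
  unfold vv
  rw [propext (near_fx (E := E) (o := o) (m := m))]
  have h1 : ind (Dn E.fx (-ox) o (-mx) m) = ind (Dn E ox o mx m) := by
    apply ind_congr; unfold Dn; rw [TBU_fx, TBD_fx, Sub_fx]
  have h2 : ind (Up E.fx (-ox) o (-mx) m) = ind (Up E ox o mx m) := by
    apply ind_congr; unfold Up; rw [TBU_fx, TBD_fx, Sub_fx]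
  rw [h1, h2]; rfl
theorem vv_fy {E : Env} {ox o mx m} : vv E.fy mx (-m) ox (-o) = vv E ox o mx m := by
  unfold vv
  rw [propext (near_fy (E := E) (o := o) (m := m))]
  have h1 : ind (Dn E.fy mx (-m) ox (-o)) = ind (Up E ox o mx m) := by
    apply ind_congr; unfold Up Dn; rw [TBU_fy, TBD_fy, Sub_fy]
  have h2 : ind (Up E.fy mx (-m) ox (-o)) = ind (Dn E ox o mx m) := by
    apply ind_congr; unfold Up Dn; rw [TBU_fy, TBD_fy, Sub_fy]
  rw [h1, h2]
  congr 1
  show E.C + _ - _ = _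
  ring

theorem abs_nn (a b : ℝ) : |(-a) - (-b)| = |a - b| := by
  rw [show -a - -b = -(a - b) by ring, abs_neg]

theorem SSx_fx (e e' : Cfg) : SSx e.fx e'.fx ↔ SSx e e' := by
  unfold SSx; simp only [Cfg.fx_a1, Cfg.fx_b1]
  constructor
  · rintro (h | h)
    · right; constructor <;> linarith [h.1, h.2]
    · left; constructor <;> linarith [h.1, h.2]
  · rintro (h | h)
    · right; constructor <;> linarith [h.1, h.2]
    · left; constructor <;> linarith [h.1, h.2]
theorem SSy_fy (e e' : Cfg) : SSy e.fy e'.fy ↔ SSy e e' := by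
  unfold SSy; simp only [Cfg.fy_a2, Cfg.fy_b2]
  constructor
  · rintro (h | h)
    · right; constructor <;> linarith [h.1, h.2]
    · left; constructor <;> linarith [h.1, h.2]
  · rintro (h | h)
    · right; constructor <;> linarith [h.1, h.2]
    · left; constructor <;> linarith [h.1, h.2]

theorem Step_fx {E : Env} {e e' : Cfg} : Step E.fx.F e.fx e'.fx ↔ Step E.F e e' := by
  unfold Step
  rw [SSx_fx]
  simp only [Cfg.fx_a1, Cfg.fx_b1, Cfg.fx_a2, Cfg.fx_b2]
  rw [RM_fx (F := E.F), RM_fx (F := E.F)]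
  exact Iff.rfl
theorem Step_fy {E : Env} {e e' : Cfg} : Step E.fy.F e.fy e'.fy ↔ Step E.F e e' := by
  unfold Step
  rw [SSy_fy]
  simp only [Cfg.fy_a1, Cfg.fy_b1, Cfg.fy_a2, Cfg.fy_b2]
  rw [RM_fy (F := E.F), RM_fy (F := E.F)]
  exact Iff.rfl

theorem symm_fx (E : Env) : Symm E E.fx Cfg.fx where
  inv := by simp
  grid := fun e h => ⟨by simpa [Env.fx] using h.fa, by simpa [Env.fx] using h.fb, by simpa [Env.fx] using h.xa, by simpa [Env.fx] using h.xb, h.ya, h.yb⟩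
  grid' := fun e h => ⟨h.fa, h.fb, h.xa, h.xb, h.ya, h.yb⟩
  step := fun e e' h => Step_fx.2 h
  step' := fun e e' h => by rw [← Step_fx]; simpa using h
  cost := fun e e' => by simp only [cost, Cfg.fx_a1, Cfg.fx_b1, Cfg.fx_a2, Cfg.fx_b2, abs_nn]
  ssx := SSx_fx
  val := fun e => by simp only [val, Cfg.fx_a1, Cfg.fx_b1, Cfg.fx_a2, Cfg.fx_b2, vv_fx]
  bdy := fun e h h' => ⟨h, h'⟩

theorem symm_fy (E : Env) : Symm E E.fy Cfg.fy where
  inv := by simp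
  grid := fun e h => ⟨by simpa [Env.fy] using h.fa, by simpa [Env.fy] using h.fb, h.xa, h.xb, by simpa [Env.fy] using h.ya, by simpa [Env.fy] using h.yb⟩
  grid' := fun e h => ⟨h.fa, h.fb, h.xa, h.xb, h.ya, h.yb⟩
  step := fun e e' h => Step_fy.2 h
  step' := fun e e' h => by rw [← Step_fy]; simpa using h
  cost := fun e e' => by simp only [cost, Cfg.fy_a1, Cfg.fy_b1, Cfg.fy_a2, Cfg.fy_b2, abs_nn]
  ssx := fun e e' => Iff.rfl
  val := fun e => by simp only [val, Cfg.fy_a1, Cfg.fy_b1, Cfg.fy_a2, Cfg.fy_b2, vv_fy]; ring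
  bdy := fun e h h' => ⟨by simpa [Env.fy] using h, by simpa [Env.fy] using h'⟩

theorem KK_sw {u : ℕ → Cfg} {i} : KK (fun i => (u i).sw) i ↔ KK u i := by
  unfold KK SSx; simp only [Cfg.sw_a1, Cfg.sw_b1]; tauto
theorem KK_fx {u : ℕ → Cfg} {i} : KK (fun i => (u i).fx) i ↔ KK u i := by
  unfold KK; rw [SSx_fx]
theorem KK_fy {u : ℕ → Cfg} {i} : KK (fun i => (u i).fy) i ↔ KK u i := Iff.rfl
theorem KK_rev {u : ℕ → Cfg} {n i} (h : i < n) : KK (fun i => u (n - i)) i ↔ KK u (n - 1 - i) := by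
  unfold KK; rw [SSx_comm]
  rw [show n - 1 - i = n - (i + 1) by omega, show n - (i+1) + 1 = n - i by omega]

theorem sum_rev {M : Type*} [AddCommMonoid M] (f : Cfg → Cfg → M) (hf : ∀ e e', f e e' = f e' e) (n : ℕ)
    (u : ℕ → Cfg) : ∑ l ∈ Finset.range n, f (u (n - l)) (u (n - (l + 1))) =
      ∑ l ∈ Finset.range n, f (u l) (u (l + 1)) := by
  rw [← Finset.sum_range_reflect]
  apply Finset.sum_congr rfl
  intro j hj
  rw [Finset.mem_range] at hj
  rw [hf]
  congr 2 <;> omega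

theorem Opt3.rev {E n u} (h : Opt3 E n u) : Opt3 E n (fun i => u (n - i)) := by
  refine ⟨⟨fun i hi => h.walk.1 _ (by omega), fun i hi => ?_⟩, by simpa using h.an, by simpa using h.bn,
    by simpa using h.a0, by simpa using h.b0, ?_⟩
  · have := (h.walk.2 (n - (i + 1)) (by omega)).symm
    rwa [show n - (i+1) + 1 = n - i by omega] at this
  · intro c k p q hw
    simp only [Nat.sub_self, Nat.sub_zero] at hw
    have := h.min _ _ _ _ hw.rev
    rwa [sum_rev _ cost_comm, sum_rev _ kk_comm, sum_rev _ pp_comm]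

/-- Repeat the configuration with index `r`. -/
def stut (r : ℕ) (u : ℕ → Cfg) : ℕ → Cfg := fun i => if i ≤ r then u i else u (i - 1)

theorem stut_le {r i : ℕ} (h : i ≤ r) (u : ℕ → Cfg) : stut r u i = u i := by simp [stut, h]
theorem stut_gt {r i : ℕ} (h : r < i) (u : ℕ → Cfg) : stut r u i = u (i - 1) := by
  simp [stut, Nat.not_le.2 h]

theorem sum_stut {M : Type*} [AddCommMonoid M] (f : Cfg → Cfg → M) (u : ℕ → Cfg) (n r : ℕ) (hr : r ≤ n)
    (h0 : f (u r) (u r) = 0) : ∑ l ∈ Finset.range (n + 1), f (stut r u l) (stut r u (l + 1)) =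
      ∑ l ∈ Finset.range n, f (u l) (u (l + 1)) := by
  rw [Finset.range_eq_Ico, Finset.range_eq_Ico, ← Finset.sum_Ico_consecutive _ (Nat.zero_le r) (by omega : r ≤ n + 1),
    ← Finset.sum_Ico_consecutive _ (Nat.zero_le r) hr]
  congr 1
  · apply Finset.sum_congr rfl
    intro i hi
    rw [Finset.mem_Ico] at hi
    rw [stut_le (by omega), stut_le (by omega)]
  · rw [Finset.sum_eq_sum_Ico_succ_bot (by omega : r < n + 1), stut_le le_rfl, stut_gt (by omega)]
    simp only [Nat.add_sub_cancel, h0, zero_add]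
    rw [Finset.sum_Ico_eq_sum_range, Finset.sum_Ico_eq_sum_range]
    rw [show n + 1 - (r + 1) = n - r by omega]
    apply Finset.sum_congr rfl
    intro i _
    rw [stut_gt (by omega), stut_gt (by omega)]
    congr 2 <;> omega

def XSp (e : Cfg) : Prop := e.a1 + 1 ≤ e.b1 ∨ e.b1 + 1 ≤ e.a1

theorem XSp.ssx {e : Cfg} (h : XSp e) : SSx e e := by
  rcases h with h | h
  · exact Or.inl ⟨h, h⟩
  · exact Or.inr ⟨h, h⟩

theorem Opt3.stut {E n u} (h : Opt3 E n u) {r : ℕ} (hr : r ≤ n) (hx : XSp (u r)) :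
    Opt3 E (n + 1) (stut r u) := by
  have e0 : TR.stut r u 0 = u 0 := stut_le (by omega) u
  have en : TR.stut r u (n + 1) = u n := stut_gt (by omega) u
  refine ⟨⟨?_, ?_⟩, by rw [e0]; exact h.a0, by rw [e0]; exact h.b0, by rw [en]; exact h.an,
    by rw [en]; exact h.bn, ?_⟩
  · intro i hi
    by_cases hir : i ≤ r
    · rw [stut_le hir]; exact h.walk.1 i (by omega)
    · rw [stut_gt (by omega)]; exact h.walk.1 _ (by omega)
  · intro i hi
    rcases lt_trichotomy i r with hir | rfl | hir
    · rw [stut_le (by omega), stut_le (by omega)]; exact h.walk.2 i (by omega)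
    · rw [stut_le le_rfl, stut_gt (by omega), Nat.add_sub_cancel]
      have := h.walk.1 i hr
      exact ⟨RM.refl this.fa, RM.refl this.fb, Or.inl hx.ssx⟩
    · rw [stut_gt (by omega), stut_gt (by omega), Nat.add_sub_cancel]
      have := h.walk.2 (i - 1) (by omega)
      rwa [show i - 1 + 1 = i by omega] at this
  · intro c k p q hw
    rw [e0, en] at hw
    rw [sum_stut _ _ _ _ hr (cost_self _), sum_stut _ _ _ _ hr (by simp [kk, hx.ssx]),
      sum_stut _ _ _ _ hr (by simp [pp, hx.ssx])]
    exact h.min _ _ _ _ hw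

end TR

namespace TR

variable {E : Env}

/-- consecutive elements of the height lattice -/
def nb (E : Env) (h h' : ℝ) : Prop :=
  h ∈ E.Y ∧ h' ∈ E.Y ∧ h ≠ h' ∧ ∀ w ∈ E.Y, ¬ (h < w ∧ w < h') ∧ ¬ (h' < w ∧ w < h)

def Gd (E : Env) (x h h' : ℝ) : Prop := h' = h ∨ (nb E h h' ∧ VSeg E.F x h h')

theorem nb.symm {h h'} (a : nb E h h') : nb E h' h :=
  ⟨a.2.1, a.1, a.2.2.1.symm, fun w hw => (a.2.2.2 w hw).symm⟩

theorem exists_nb_up {h} (hh : h ∈ E.Y) : ∃ h', h < h' ∧ nb E h h' := by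
  obtain ⟨z, hz, h1, h2⟩ := E.succ h hh
  exact ⟨z, h1, hh, hz, h1.ne, fun w hw => ⟨h2 w hw, fun ⟨a, b⟩ => by linarith⟩⟩
theorem exists_nb_dn {h} (hh : h ∈ E.Y) : ∃ h', h' < h ∧ nb E h h' := by
  obtain ⟨z, hz, h1, h2⟩ := E.pred h hh
  exact ⟨z, h1, hh, hz, h1.ne', fun w hw => ⟨fun ⟨a, b⟩ => by linarith, h2 w hw⟩⟩

theorem nb.le_of_lt {h h' g} (a : nb E h h') (hlt : h < h') (hg : g ∈ E.Y) (hh : h < g) : h' ≤ g := by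
  by_contra hc; exact (a.2.2.2 g hg).1 ⟨hh, not_le.1 hc⟩
theorem nb.ge_of_gt {h h' g} (a : nb E h h') (hlt : h' < h) (hg : g ∈ E.Y) (hh : g < h) : g ≤ h' := by
  by_contra hc; exact (a.2.2.2 g hg).2 ⟨not_le.1 hc, hh⟩

theorem nb.noB_up {h h'} (a : nb E h h') (hB : h ∉ E.B) : ∀ b ∈ E.B, ¬ (h ≤ b ∧ b < h') := by
  rintro b hb ⟨h1, h2⟩
  rcases h1.eq_or_lt with rfl | h1
  · exact hB hb
  · exact (a.2.2.2 b (E.BY hb)).1 ⟨h1, h2⟩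
theorem nb.noB_dn {h h'} (a : nb E h h') (hB : h ∉ E.B) : ∀ b ∈ E.B, ¬ (h' < b ∧ b ≤ h) := by
  rintro b hb ⟨h1, h2⟩
  rcases h2.eq_or_lt with rfl | h2
  · exact hB hb
  · exact (a.2.2.2 b (E.BY hb)).2 ⟨h1, h2⟩

theorem nb.vert {h h' x x'} (a : nb E h h') (hB : h ∉ E.B) (hne : x ≠ x') (hs : HSeg E.F h x x') :
    ∀ t ∈ uIcc x x', VSeg E.F t h h' := by
  rcases lt_or_gt_of_ne a.2.2.1 with hl | hl
  · exact E.rise x x' h h' hl.le hne hs (a.noB_up hB)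
  · exact E.fall x x' h h' hl.le hne hs (a.noB_dn hB)

theorem nb.hseg {h h' x x'} (a : nb E h h') (hB : h ∉ E.B) (hne : x ≠ x') (hs : HSeg E.F h x x') :
    HSeg E.F h' x x' := fun t ht => (a.vert hB hne hs t ht).right

theorem Gd.f {x h h'} (g : Gd E x h h') (hF : E.F x h) : E.F x h' := by
  rcases g with rfl | ⟨_, g⟩
  · exact hF
  · exact g.right
theorem Gd.y {x h h'} (g : Gd E x h h') (hF : h ∈ E.Y) : h' ∈ E.Y := by
  rcases g with rfl | ⟨g, _⟩
  · exact hF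
  · exact g.2.1
theorem Gd.v {x h h'} (g : Gd E x h h') (hF : E.F x h) : VSeg E.F x h h' := by
  rcases g with rfl | ⟨_, g⟩
  · exact VSeg.refl hF
  · exact g

theorem RM.shift {x y x' y' α α'} (h : RM E.F x y x' y') (g : Gd E x y α) (g' : Gd E x' y' α')
    (hc : x = x' ∨ (y = y' ∧ α = α')) (hB : α ≠ y → y ∉ E.B) : RM E.F x α x' α' := by
  by_cases hx : x = x'
  · subst hx
    right
    refine ⟨rfl, ((g.v h.left).symm.trans ?_).trans (g'.v h.right)⟩
    rcases h with ⟨rfl, h⟩ | ⟨_, h⟩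
    · exact VSeg.refl h.left
    · exact h
  · obtain ⟨rfl, rfl⟩ := hc.resolve_left hx
    left
    refine ⟨rfl, ?_⟩
    rcases g with rfl | ⟨g, _⟩
    · exact h.hseg rfl
    · exact g.hseg (hB g.2.2.1.symm) hx (h.hseg rfl)

theorem row_inv {x h h'} (g : Gd E x h h') (hB : h ∉ E.B) (hB' : h' ∉ E.B) (hF : E.F x h) (t : ℝ) :
    HSeg E.F h x t ↔ HSeg E.F h' x t := by
  rcases g with rfl | ⟨a, g⟩
  · exact Iff.rfl
  · by_cases hx : x = t
    · subst hx
      exact ⟨fun _ => HSeg.refl g.right, fun _ => HSeg.refl g.left⟩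
    · exact ⟨a.hseg hB hx, a.symm.hseg hB' hx⟩

theorem TBU_aux {x h h'} (a : nb E h h') (g : VSeg E.F x h h') (hl : h < h') (hB : h ∉ E.B) :
    TBU E x h ↔ TBU E x h' := by
  constructor
  · rintro ⟨e, h1, h2, h3, h4⟩
    have : h' ≤ e := by
      by_contra hc
      push Not at hc
      exact h3 h' hc (g.sub (by rw [mem_uIcc]; left; exact ⟨h1, hc.le⟩) right_mem_uIcc)
    exact ⟨e, this, h2.sub (by rw [mem_uIcc]; left; exact ⟨hl.le, this⟩) right_mem_uIcc, h3,
      fun b hb hh => h4 b hb ⟨hl.le.trans hh.1, hh.2⟩⟩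
  · rintro ⟨e, h1, h2, h3, h4⟩
    refine ⟨e, hl.le.trans h1, g.trans h2, h3, fun b hb hh => ?_⟩
    by_cases hc : b < h'
    · exact a.noB_up hB b hb ⟨hh.1, hc⟩
    · exact h4 b hb ⟨not_lt.1 hc, hh.2⟩
theorem TBD_aux {x h h'} (a : nb E h h') (g : VSeg E.F x h h') (hl : h' < h) (hB : h ∉ E.B) :
    TBD E x h ↔ TBD E x h' := by
  constructor
  · rintro ⟨e, h1, h2, h3, h4⟩
    have : e ≤ h' := by
      by_contra hc
      push Not at hc
      exact h3 h' hc (g.sub (by rw [mem_uIcc]; right; exact ⟨hc.le, h1⟩) right_mem_uIcc)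
    exact ⟨e, this, h2.sub (by rw [mem_uIcc]; right; exact ⟨this, hl.le⟩) right_mem_uIcc, h3,
      fun b hb hh => h4 b hb ⟨hh.1, hh.2.trans hl.le⟩⟩
  · rintro ⟨e, h1, h2, h3, h4⟩
    refine ⟨e, h1.trans hl.le, g.trans h2, h3, fun b hb hh => ?_⟩
    by_cases hc : h' < b
    · exact a.noB_dn hB b hb ⟨hc, hh.2⟩
    · exact h4 b hb ⟨hh.1, not_lt.1 hc⟩

theorem TBU_inv {x h h'} (g : Gd E x h h') (hB : h ∉ E.B) (hB' : h' ∉ E.B) : TBU E x h ↔ TBU E x h' := by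
  rcases g with rfl | ⟨a, g⟩
  · exact Iff.rfl
  · rcases lt_or_gt_of_ne a.2.2.1 with hl | hl
    · exact TBU_aux a g hl hB
    · exact (TBU_aux a.symm g.symm hl hB').symm
theorem TBD_inv {x h h'} (g : Gd E x h h') (hB : h ∉ E.B) (hB' : h' ∉ E.B) : TBD E x h ↔ TBD E x h' := by
  rcases g with rfl | ⟨a, g⟩
  · exact Iff.rfl
  · rcases lt_or_gt_of_ne a.2.2.1 with hl | hl
    · exact (TBD_aux a.symm g.symm hl hB').symm
    · exact TBD_aux a g hl hB

theorem near.o {o m} (h : near E o m) : o ∉ E.B := fun hb => (h.2 o hb).1 ⟨le_rfl, by linarith [h.1]⟩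
theorem near.o1 {o m} (h : near E o m) : o + 1 ∉ E.B := fun hb => (h.2 _ hb).2 ⟨le_rfl, h.1⟩
theorem near.m {o m} (h : near E o m) : m ∉ E.B := fun hb => (h.2 _ hb).2 ⟨h.1, le_rfl⟩
theorem near.m1 {o m} (h : near E o m) : m - 1 ∉ E.B := fun hb => (h.2 _ hb).1 ⟨by linarith [h.1], le_rfl⟩

/-- near configurations reached by a good shift were near before -/
theorem near_back {ox o o' mx m m'} (go : Gd E ox o o') (gm : Gd E mx m m') (hom : o + 1 ≤ m)
    (ho : o' ≠ o → o ∉ E.B ∧ o + 1 ∉ E.B) (hm : m' ≠ m → m ∉ E.B ∧ m - 1 ∉ E.B)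
    (hn : near E o' m') : near E o m := by
  refine ⟨hom, fun b hb => ⟨fun hh => ?_, fun hh => ?_⟩⟩
  · have hbY := E.BY hb
    by_cases h1 : b < o'
    · rcases go with rfl | ⟨a, _⟩
      · linarith [hh.1]
      · exact a.noB_up (ho a.2.2.1.symm).1 b hb ⟨hh.1, h1⟩
    · by_cases h2 : m' - 1 < b
      · rcases gm with rfl | ⟨a, _⟩
        · linarith [hh.2]
        · have : b = m - 1 := by
            by_contra hne
            have : b < m - 1 := lt_of_le_of_ne hh.2 hne
            exact (a.2.2.2 (b + 1) (E.Yp b hbY)).2 ⟨by linarith, by linarith⟩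
          exact (hm a.2.2.1.symm).2 (this ▸ hb)
      · exact (hn.2 b hb).1 ⟨not_lt.1 h1, not_lt.1 h2⟩
  · have hbY := E.BY hb
    by_cases h1 : m' < b
    · rcases gm with rfl | ⟨a, _⟩
      · linarith [hh.2]
      · exact a.noB_dn (hm a.2.2.1.symm).1 b hb ⟨h1, hh.2⟩
    · by_cases h2 : b < o' + 1
      · rcases go with rfl | ⟨a, _⟩
        · linarith [hh.1]
        · have : b = o + 1 := by
            by_contra hne
            have : o + 1 < b := lt_of_le_of_ne hh.1 (Ne.symm hne)
            exact (a.2.2.2 (b - 1) (E.Ym b hbY)).1 ⟨by linarith, by linarith⟩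
          exact (ho a.2.2.1.symm).2 (this ▸ hb)
      · exact (hn.2 b hb).2 ⟨not_lt.1 h2, not_lt.1 h1⟩

open Classical in
def wL (E : Env) (ox o mx m : ℝ) : ℝ := if near E o m then 1 + ind (Dn E ox o mx m) else 0
open Classical in
def wU (E : Env) (ox o mx m : ℝ) : ℝ := if near E o m then 1 + ind (Up E ox o mx m) else 0

theorem wL_nonneg (ox o mx m : ℝ) : 0 ≤ wL E ox o mx m := by
  unfold wL; split_ifs
  · linarith [ind_nonneg (Dn E ox o mx m)]
  · exact le_rfl
theorem wU_nonneg (ox o mx m : ℝ) : 0 ≤ wU E ox o mx m := by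
  unfold wU; split_ifs
  · linarith [ind_nonneg (Up E ox o mx m)]
  · exact le_rfl
theorem wL_pos {o m : ℝ} (h : near E o m) (ox mx : ℝ) : 0 < wL E ox o mx m := by
  unfold wL; rw [if_pos h]; linarith [ind_nonneg (Dn E ox o mx m)]
theorem wU_pos {o m : ℝ} (h : near E o m) (ox mx : ℝ) : 0 < wU E ox o mx m := by
  unfold wU; rw [if_pos h]; linarith [ind_nonneg (Up E ox o mx m)]

theorem vv_shift {ox o o' mx m m'} (fo : E.F ox o) (fm : E.F mx m)
    (go : Gd E ox o o') (gm : Gd E mx m m') (hom : o + 1 ≤ m)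
    (ho : o' ≠ o → o ∉ E.B ∧ o + 1 ∉ E.B) (hm : m' ≠ m → m ∉ E.B ∧ m - 1 ∉ E.B) :
    vv E ox o' mx m' ≤ vv E ox o mx m + wL E ox o mx m * (o' - o) - wU E ox o mx m * (m' - m) := by
  by_cases hn : near E o m
  · by_cases hn' : near E o' m'
    · have e1 : ind (Dn E ox o' mx m') = ind (Dn E ox o mx m) := by
        apply ind_congr
        unfold Dn Sub
        rw [← TBU_inv gm hn.m hn'.m, ← TBD_inv go hn.o hn'.o]
        simp only [← row_inv gm hn.m hn'.m fm, ← row_inv go hn.o hn'.o fo]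
      have e2 : ind (Up E ox o' mx m') = ind (Up E ox o mx m) := by
        apply ind_congr
        unfold Up Sub
        rw [← TBU_inv gm hn.m hn'.m, ← TBD_inv go hn.o hn'.o]
        simp only [← row_inv gm hn.m hn'.m fm, ← row_inv go hn.o hn'.o fo]
      unfold vv wL wU
      rw [if_pos hn, if_pos hn', if_pos hn, if_pos hn, e1, e2]
      apply le_of_eq; ring
    · unfold vv wL wU
      rw [if_pos hn, if_neg hn', if_pos hn, if_pos hn]
      have h1 := E.bdd _ _ (go.f fo)
      have h2 := E.bdd _ _ (gm.f fm)
      have := E.hC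
      rw [abs_le] at h1 h2
      have hd := ind_nonneg (Dn E ox o mx m)
      have hd' := ind_le (Dn E ox o mx m)
      have hu := ind_nonneg (Up E ox o mx m)
      have hu' := ind_le (Up E ox o mx m)
      nlinarith
  · have hn' : ¬ near E o' m' := fun h => hn (near_back go gm hom ho hm h)
    unfold vv wL wU
    rw [if_neg hn, if_neg hn', if_neg hn, if_neg hn]; simp

theorem vv_zero {ox o mx m} (h : m < o + 1) : vv E ox o mx m = 0 := by
  unfold vv; rw [if_neg]; intro hn; linarith [hn.1]

/-- moved configuration -/
def mkc (u : ℕ → Cfg) (α β : ℕ → ℝ) (i : ℕ) : Cfg := ⟨(u i).a1, α i, (u i).b1, β i⟩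

def Con (u : ℕ → Cfg) (n i : ℕ) : Prop := (i < n ∧ KK u i) ∨ (∃ j, j + 1 = i ∧ i ≤ n ∧ KK u j)

theorem Walk.ssy {n u} (h : Walk E n u) {i} (hi : i < n) (hk : KK u i) : SSy (u i) (u (i + 1)) :=
  (h.2 i hi).2.2.resolve_left hk

structure ShiftData (E : Env) (n : ℕ) (u : ℕ → Cfg) (α β : ℕ → ℝ) : Prop where
  ga : ∀ i ≤ n, Gd E (u i).a1 (u i).a2 (α i)
  gb : ∀ i ≤ n, Gd E (u i).b1 (u i).b2 (β i)
  sa : ∀ i < n, (u i).a1 = (u (i + 1)).a1 ∨ ((u i).a2 = (u (i + 1)).a2 ∧ α i = α (i + 1))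
  sb : ∀ i < n, (u i).b1 = (u (i + 1)).b1 ∨ ((u i).b2 = (u (i + 1)).b2 ∧ β i = β (i + 1))
  ba : ∀ i ≤ n, α i ≠ (u i).a2 → (u i).a2 ∉ E.B
  bb : ∀ i ≤ n, β i ≠ (u i).b2 → (u i).b2 ∉ E.B
  ky : ∀ i < n, KK u i → SSy (mkc u α β i) (mkc u α β (i + 1))

theorem mkc_eq {u : ℕ → Cfg} {α β i} (ha : α i = (u i).a2) (hb : β i = (u i).b2) : mkc u α β i = u i := by
  ext <;> simp [mkc, ha, hb]

theorem ShiftData.walk {n u α β} (s : ShiftData E n u α β) (h : Walk E n u) : Walk E n (mkc u α β) := by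
  refine ⟨fun i hi => ?_, fun i hi => ⟨?_, ?_, ?_⟩⟩
  · have := h.1 i hi
    exact ⟨(s.ga i hi).f this.fa, (s.gb i hi).f this.fb, this.xa, this.xb, (s.ga i hi).y this.ya,
      (s.gb i hi).y this.yb⟩
  · exact (h.2 i hi).1.shift (s.ga i hi.le) (s.ga (i + 1) hi) (s.sa i hi) (s.ba i hi.le)
  · exact (h.2 i hi).2.1.shift (s.gb i hi.le) (s.gb (i + 1) hi) (s.sb i hi) (s.bb i hi.le)
  · by_cases hK : KK u i
    · exact Or.inr (s.ky i hi hK)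
    · left; unfold KK at hK; push Not at hK; exact hK

theorem ShiftData.ends {n u α β} (s : ShiftData E n u α β) (h : Opt3 E n u) :
    mkc u α β 0 = u 0 ∧ mkc u α β n = u n := by
  constructor
  · apply mkc_eq
    · by_contra hc; exact s.ba 0 (by omega) hc h.a0
    · by_contra hc; exact s.bb 0 (by omega) hc h.b0
  · apply mkc_eq
    · by_contra hc; exact s.ba n le_rfl hc h.an
    · by_contra hc; exact s.bb n le_rfl hc h.bn

theorem cost_mk (u : ℕ → Cfg) (α β : ℕ → ℝ) (i : ℕ) :
    cost (mkc u α β i) (mkc u α β (i + 1)) - cost (u i) (u (i + 1)) =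
    (|α i - α (i + 1)| - |(u i).a2 - (u (i + 1)).a2|) +
    (|β i - β (i + 1)| - |(u i).b2 - (u (i + 1)).b2|) := by
  simp only [cost, mkc]; ring

theorem ShiftData.wkn {n u α β} (s : ShiftData E n u α β) (h : Opt3 E n u) :
    Wk E (u 0) (u n)
    (∑ l ∈ Finset.range n, cost (mkc u α β l) (mkc u α β (l + 1)))
    (∑ l ∈ Finset.range n, kk (u l) (u (l + 1)))
    (∑ l ∈ Finset.range n, pp E (mkc u α β l) (mkc u α β (l + 1)))
    (∑ l ∈ Finset.range n, qq E (mkc u α β l) (mkc u α β (l + 1))) := by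
  have := (s.walk h.walk).wk n le_rfl 0 (by omega)
  rw [(s.ends h).1, (s.ends h).2] at this
  simp only [← Finset.range_eq_Ico] at this
  exact this

open Classical in
theorem pp_mk (u : ℕ → Cfg) (α β : ℕ → ℝ) (i : ℕ) :
    pp E (mkc u α β i) (mkc u α β (i + 1)) - pp E (u i) (u (i + 1)) =
    if KK u i then (val E (mkc u α β i) - val E (u i)) + (val E (mkc u α β (i + 1)) - val E (u (i + 1)))
      else 0 := by
  have e : SSx (mkc u α β i) (mkc u α β (i + 1)) ↔ SSx (u i) (u (i + 1)) := Iff.rfl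
  unfold pp KK
  by_cases h : SSx (u i) (u (i + 1))
  · rw [if_pos h, if_pos (e.2 h)]; simp [h]
  · rw [if_neg h, if_neg (fun h' => h (e.1 h'))]; simp [h]; ring

/-- cost change of a shift -/
def dcost (n : ℕ) (f α : ℕ → ℝ) : ℝ := ∑ i ∈ Finset.range n, (|α i - α (i + 1)| - |f i - f (i + 1)|)

theorem sum_cost_mk (n : ℕ) (u : ℕ → Cfg) (α β : ℕ → ℝ) :
    ∑ l ∈ Finset.range n, cost (mkc u α β l) (mkc u α β (l + 1)) =
    ∑ l ∈ Finset.range n, cost (u l) (u (l + 1)) + (dcost n (fun i => (u i).a2) α +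
      dcost n (fun i => (u i).b2) β) := by
  unfold dcost
  rw [← Finset.sum_add_distrib, ← Finset.sum_add_distrib]
  apply Finset.sum_congr rfl
  intro i _
  have := cost_mk u α β i
  linarith

theorem ShiftData.dc {n u α β} (s : ShiftData E n u α β) (h : Opt3 E n u) :
    0 ≤ dcost n (fun i => (u i).a2) α + dcost n (fun i => (u i).b2) β := by
  have := (h.min _ _ _ _ (s.wkn h)).1
  rw [sum_cost_mk] at this; linarith

theorem ShiftData.pc {n u α β} (s : ShiftData E n u α β) (h : Opt3 E n u)
    (hc : dcost n (fun i => (u i).a2) α + dcost n (fun i => (u i).b2) β ≤ 0) :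
    ∑ l ∈ Finset.range n, pp E (u l) (u (l + 1)) ≤
    ∑ l ∈ Finset.range n, pp E (mkc u α β l) (mkc u α β (l + 1)) := by
  have := (((h.min _ _ _ _ (s.wkn h)).2 (by rw [sum_cost_mk]; linarith)).2 le_rfl)
  exact this

theorem ShiftData.no {n u α β} (s : ShiftData E n u α β) (h : Opt3 E n u)
    (hc : dcost n (fun i => (u i).a2) α + dcost n (fun i => (u i).b2) β ≤ 0)
    (hv : ∀ i ≤ n, Con u n i → val E (mkc u α β i) ≤ val E (u i))
    (hs : ∃ i ≤ n, Con u n i ∧ val E (mkc u α β i) < val E (u i)) : False := by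
  have h1 := s.pc h hc
  refine absurd h1 (not_le.2 ?_)
  have con1 : ∀ i, i < n → KK u i → Con u n i := fun i hi hk => Or.inl ⟨hi, hk⟩
  have con2 : ∀ i, i < n → KK u i → Con u n (i + 1) := fun i hi hk => Or.inr ⟨i, rfl, hi, hk⟩
  apply Finset.sum_lt_sum
  · intro i hi
    rw [Finset.mem_range] at hi
    have := pp_mk (E := E) u α β i
    by_cases hk : KK u i
    · rw [if_pos hk] at this
      linarith [hv i hi.le (con1 i hi hk), hv (i + 1) hi (con2 i hi hk)]
    · rw [if_neg hk] at this; linarith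
  · obtain ⟨i, hin, hcon, hlt⟩ := hs
    rcases hcon with ⟨hi, hk⟩ | ⟨j, rfl, hj, hk⟩
    · refine ⟨i, Finset.mem_range.2 hi, ?_⟩
      have := pp_mk (E := E) u α β i
      rw [if_pos hk] at this
      linarith [hv (i + 1) hi (con2 i hi hk)]
    · refine ⟨j, Finset.mem_range.2 (by omega), ?_⟩
      have := pp_mk (E := E) u α β j
      rw [if_pos hk] at this
      linarith [hv j (by omega) (con1 j (by omega) hk)]

theorem dcost_zero (n : ℕ) (f : ℕ → ℝ) : dcost n f f = 0 := by simp [dcost]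

/-- shift of an interval of indices `l+1..r` -/
def ish (f : ℕ → ℝ) (l r : ℕ) (h' : ℝ) : ℕ → ℝ := fun i => if l < i ∧ i ≤ r then h' else f i

theorem ish_in {f : ℕ → ℝ} {l r : ℕ} {h' : ℝ} {i : ℕ} (h : l < i ∧ i ≤ r) : ish f l r h' i = h' := by
  simp [ish, h]
theorem ish_out {f : ℕ → ℝ} {l r : ℕ} {h' : ℝ} {i : ℕ} (h : ¬ (l < i ∧ i ≤ r)) :
    ish f l r h' i = f i := by
  unfold ish; rw [if_neg h]

theorem dcost_ish (n : ℕ) (f : ℕ → ℝ) (l r : ℕ) (h h' : ℝ) (hlr : l < r) (hr : r < n)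
    (hf : ∀ i, l < i → i ≤ r → f i = h) :
    dcost n f (ish f l r h') = (|f l - h'| - |f l - h|) + (|f (r + 1) - h'| - |f (r + 1) - h|) := by
  unfold dcost
  have : ∀ i ∈ Finset.range n, |ish f l r h' i - ish f l r h' (i + 1)| - |f i - f (i + 1)| =
      (if i = l then |f l - h'| - |f l - h| else 0) +
      (if i = r then |f (r + 1) - h'| - |f (r + 1) - h| else 0) := by
    intro i _
    rcases lt_trichotomy i l with h1 | h1 | h1
    · rw [ish_out (by omega), ish_out (by omega), if_neg (by omega), if_neg (by omega)]; simp
    · subst h1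
      rw [ish_out (by omega), ish_in (by omega), if_pos rfl, if_neg (by omega), hf (i + 1) (by omega) (by omega)]
      simp
    · rw [if_neg (by omega), zero_add]
      rcases lt_trichotomy i r with h2 | h2 | h2
      · rw [ish_in (by omega), ish_in (by omega), hf i (by omega) (by omega),
          hf (i + 1) (by omega) (by omega), if_neg (by omega)]; simp
      · subst h2
        rw [ish_in (by omega), ish_out (by omega), if_pos rfl, hf i (by omega) (by omega),
          abs_sub_comm h', abs_sub_comm h]
      · rw [ish_out (by omega), ish_out (by omega), if_neg (by omega)]; simp
  rw [Finset.sum_congr rfl this, Finset.sum_add_distrib]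
  simp [show l < n by omega, hr]

theorem nb.absu {h h' g} (a : nb E h h') (hl : h < h') (hg : g ∈ E.Y) (hh : h < g) :
    |g - h'| - |g - h| = -(h' - h) := by
  have := a.le_of_lt hl hg hh
  rw [abs_of_nonneg (by linarith), abs_of_nonneg (by linarith)]; ring
theorem nb.absu' {h h' g : ℝ} (hl : h < h') (hh : g ≤ h) :
    |g - h'| - |g - h| = h' - h := by
  rw [abs_of_nonpos (by linarith), abs_of_nonpos (by linarith)]; ring
theorem nb.absd {h h' g} (a : nb E h h') (hl : h' < h) (hg : g ∈ E.Y) (hh : g < h) :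
    |g - h'| - |g - h| = -(h - h') := by
  have := a.ge_of_gt hl hg hh
  rw [abs_of_nonpos (by linarith), abs_of_nonpos (by linarith)]; ring
theorem nb.absd' {h h' g : ℝ} (hl : h' < h) (hh : h ≤ g) :
    |g - h'| - |g - h| = h - h' := by
  rw [abs_of_nonneg (by linarith), abs_of_nonneg (by linarith)]; ring

end TR

namespace TR

variable {E : Env}

/-- admissible change of heights for one robot -/
structure RSh (E : Env) (n : ℕ) (x y α : ℕ → ℝ) : Prop where
  g : ∀ i ≤ n, Gd E (x i) (y i) (α i)
  s : ∀ i < n, x i = x (i + 1) ∨ (y i = y (i + 1) ∧ α i = α (i + 1))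
  b : ∀ i ≤ n, α i ≠ y i → y i ∉ E.B

theorem RSh.id {n x y} (hRM : ∀ i < n, RM E.F (x i) (y i) (x (i + 1)) (y (i + 1))) : RSh E n x y y where
  g := fun i _ => Or.inl rfl
  s := fun i hi => by
    rcases hRM i hi with ⟨h, _⟩ | ⟨h, _⟩
    · exact Or.inr ⟨h, h⟩
    · exact Or.inl h
  b := fun i _ h => absurd rfl h

theorem RSh.toShift {n u α β} (a : RSh E n (fun i => (u i).a1) (fun i => (u i).a2) α)
    (b : RSh E n (fun i => (u i).b1) (fun i => (u i).b2) β)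
    (ky : ∀ i < n, KK u i → SSy (mkc u α β i) (mkc u α β (i + 1))) : ShiftData E n u α β :=
  ⟨a.g, b.g, a.s, b.s, a.b, b.b, ky⟩

theorem row_conn {n : ℕ} {x y : ℕ → ℝ} (hRM : ∀ i < n, RM E.F (x i) (y i) (x (i + 1)) (y (i + 1)))
    {h : ℝ} {i j : ℕ} (hij : i ≤ j) (hj : j ≤ n) (hF : E.F (x i) h)
    (hf : ∀ l, i ≤ l → l ≤ j → y l = h) : HSeg E.F h (x i) (x j) := by
  induction j, hij using Nat.le_induction with
  | base => exact HSeg.refl hF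
  | succ j hij ih =>
    have h1 := hf j (by omega) (by omega)
    have h2 := hf (j + 1) (by omega) le_rfl
    have := (hRM j (by omega)).hseg (by rw [h1, h2])
    rw [h1] at this
    exact (ih (by omega) (fun l a b => hf l a (by omega))).trans this

theorem row_vert {h h' x x' : ℝ} (a : nb E h h') (hB : h ∉ E.B) (hs : HSeg E.F h x x')
    (hv : VSeg E.F x h h') : VSeg E.F x' h h' := by
  by_cases hx : x = x'
  · exact hx ▸ hv
  · exact a.vert hB hx hs _ right_mem_uIcc

theorem RSh.ish {n x y} (hRM : ∀ i < n, RM E.F (x i) (y i) (x (i + 1)) (y (i + 1)))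
    {l r : ℕ} {h h' : ℝ} (hrn : r < n)
    (hf : ∀ i, l < i → i ≤ r → y i = h) (a : nb E h h') (hB : h ∉ E.B)
    {i0 : ℕ} (hi0 : l < i0) (hi0' : i0 ≤ r) (hv : VSeg E.F (x i0) h h')
    (hl : x l = x (l + 1)) (hr : x r = x (r + 1)) : RSh E n x y (ish y l r h') where
  g := fun i hi => by
    by_cases hin : l < i ∧ i ≤ r
    · rw [ish_in hin, hf i hin.1 hin.2]
      refine Or.inr ⟨a, ?_⟩
      rcases le_total i0 i with hh | hh
      · exact row_vert a hB (row_conn hRM hh (by omega) hv.left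
          (fun l h1 h2 => hf l (by omega) (by omega))) hv
      · have hF : E.F (x i) h := by
          rw [← hf i hin.1 hin.2]
          exact (hRM i (by omega)).left
        exact row_vert a hB (row_conn hRM hh (by omega) hF
          (fun l h1 h2 => hf l (by omega) (by omega))).symm hv
    · rw [ish_out hin]; exact Or.inl rfl
  s := fun i hi => by
    have key : x i = x (i + 1) ∨ y i = y (i + 1) := by
      rcases hRM i hi with ⟨h, _⟩ | ⟨h, _⟩
      · exact Or.inr h
      · exact Or.inl h
    rcases eq_or_ne i l with rfl | h1
    · exact Or.inl hl
    rcases eq_or_ne i r with rfl | h2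
    · exact Or.inl hr
    refine key.imp_right fun hy => ⟨hy, ?_⟩
    by_cases hin : l < i ∧ i ≤ r
    · rw [ish_in hin, ish_in (by omega)]
    · rw [ish_out hin, ish_out (by omega), hy]
  b := fun i hi hne => by
    by_cases hin : l < i ∧ i ≤ r
    · rw [hf i hin.1 hin.2]; exact hB
    · rw [ish_out hin] at hne; exact absurd rfl hne

theorem Walk.ra {n u} (h : Walk E n u) : ∀ i < n, RM E.F (u i).a1 (u i).a2 (u (i+1)).a1 (u (i+1)).a2 :=
  fun i hi => (h.2 i hi).1
theorem Walk.rb {n u} (h : Walk E n u) : ∀ i < n, RM E.F (u i).b1 (u i).b2 (u (i+1)).b1 (u (i+1)).b2 :=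
  fun i hi => (h.2 i hi).2.1

theorem val_shift1 {e : Cfg} (fa : E.F e.a1 e.a2) (fb : E.F e.b1 e.b2) {α β}
    (ga : Gd E e.a1 e.a2 α) (gb : Gd E e.b1 e.b2 β) (h1 : e.a2 + 1 ≤ e.b2) (h2 : α + 1 ≤ β)
    (ha : α ≠ e.a2 → e.a2 ∉ E.B ∧ e.a2 + 1 ∉ E.B) (hb : β ≠ e.b2 → e.b2 ∉ E.B ∧ e.b2 - 1 ∉ E.B) :
    val E ⟨e.a1, α, e.b1, β⟩ ≤ val E e + wL E e.a1 e.a2 e.b1 e.b2 * (α - e.a2)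
      - wU E e.a1 e.a2 e.b1 e.b2 * (β - e.b2) := by
  have := vv_shift fa fb ga gb h1 ha hb
  have z1 : vv E e.b1 β e.a1 α = 0 := vv_zero (by linarith)
  have z2 : vv E e.b1 e.b2 e.a1 e.a2 = 0 := vv_zero (by linarith)
  unfold val
  simp only [z1, z2]; linarith

theorem val_shift2 {e : Cfg} (fa : E.F e.a1 e.a2) (fb : E.F e.b1 e.b2) {α β}
    (ga : Gd E e.a1 e.a2 α) (gb : Gd E e.b1 e.b2 β) (h1 : e.b2 + 1 ≤ e.a2) (h2 : β + 1 ≤ α)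
    (ha : α ≠ e.a2 → e.a2 ∉ E.B ∧ e.a2 - 1 ∉ E.B) (hb : β ≠ e.b2 → e.b2 ∉ E.B ∧ e.b2 + 1 ∉ E.B) :
    val E ⟨e.a1, α, e.b1, β⟩ ≤ val E e + wL E e.b1 e.b2 e.a1 e.a2 * (β - e.b2)
      - wU E e.b1 e.b2 e.a1 e.a2 * (α - e.a2) := by
  have := vv_shift fb fa gb ga h1 hb ha
  have z1 : vv E e.a1 α e.b1 β = 0 := vv_zero (by linarith)
  have z2 : vv E e.a1 e.a2 e.b1 e.b2 = 0 := vv_zero (by linarith)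
  unfold val
  simp only [z1, z2]; linarith

theorem wU_zero {ox o mx m} (h : ¬ near E o m) : wU E ox o mx m = 0 := by simp [wU, h]
theorem wL_zero {ox o mx m} (h : ¬ near E o m) : wL E ox o mx m = 0 := by simp [wL, h]

/-- Lowering robot A on the indices `l+1..r` is impossible. -/
theorem lower_no {n u} (h : Opt3 E n u) {l r : ℕ} {g g' : ℝ} (hlr : l < r) (hrn : r < n)
    (hf : ∀ i, l < i → i ≤ r → (u i).a2 = g) (a : nb E g g') (hlt : g' < g) (hB : g ∉ E.B)
    (hl : (u l).a1 = (u (l + 1)).a1) (hr : (u r).a1 = (u (r + 1)).a1)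
    {i0 : ℕ} (hi0 : l < i0) (hi0' : i0 ≤ r) (hv : VSeg E.F (u i0).a1 g g')
    (hc : (|(u l).a2 - g'| - |(u l).a2 - g|) + (|(u (r + 1)).a2 - g'| - |(u (r + 1)).a2 - g|) ≤ 0)
    (hcon : ∀ i, l < i → i ≤ r → Con u n i → ((u i).a2 + 1 ≤ (u i).b2 ∧ g + 1 ∉ E.B) ∨
      ((u i).b2 + 1 ≤ g' ∧ g - 1 ∉ E.B ∧ ¬ near E (u i).b2 g))
    (hs : ∃ i, l < i ∧ i ≤ r ∧ Con u n i ∧ near E g (u i).b2) : False := by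
  set α := ish (fun i => (u i).a2) l r g' with hα
  have hαle : ∀ i, α i ≤ (u i).a2 := by
    intro i
    by_cases hin : l < i ∧ i ≤ r
    · rw [hα, ish_in hin, hf i hin.1 hin.2]; exact hlt.le
    · rw [hα, ish_out hin]
  have ra : RSh E n (fun i => (u i).a1) (fun i => (u i).a2) α :=
    RSh.ish h.walk.ra hrn hf a hB hi0 hi0' hv hl hr
  have rb : RSh E n (fun i => (u i).b1) (fun i => (u i).b2) (fun i => (u i).b2) := RSh.id h.walk.rb
  have hup : ∀ i, Con u n i → (u i).b2 + 1 ≤ (u i).a2 → (u i).b2 + 1 ≤ α i := by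
    intro i hci hh
    by_cases hin : l < i ∧ i ≤ r
    · rw [hα, ish_in hin]
      rcases hcon i hin.1 hin.2 hci with h1 | h1
      · linarith [h1.1]
      · exact h1.1
    · rw [hα, ish_out hin]; exact hh
  have sd : ShiftData E n u α (fun i => (u i).b2) := by
    refine ra.toShift rb fun i hi hk => ?_
    have c1 : Con u n i := Or.inl ⟨hi, hk⟩
    have c2 : Con u n (i + 1) := Or.inr ⟨i, rfl, hi, hk⟩
    rcases h.walk.ssy hi hk with ⟨h1, h2⟩ | ⟨h1, h2⟩
    · exact Or.inl ⟨(by simp only [mkc]; linarith [hαle i]), (by simp only [mkc]; linarith [hαle (i + 1)])⟩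
    · exact Or.inr ⟨hup i c1 h1, hup _ c2 h2⟩
  have hval : ∀ i, l < i → i ≤ r → Con u n i → val E (mkc u α (fun i => (u i).b2) i) ≤ val E (u i) +
      wL E (u i).a1 (u i).a2 (u i).b1 (u i).b2 * (g' - g) := by
    intro i h1 h2 hci
    have hin : l < i ∧ i ≤ r := ⟨h1, h2⟩
    have gr := h.walk.1 i (by omega)
    have e1 : α i = g' := by rw [hα, ish_in hin]
    have e2 := hf i h1 h2
    rcases hcon i h1 h2 hci with h3 | h3
    · have := val_shift1 gr.fa gr.fb (ra.g i (by omega)) (rb.g i (by omega)) h3.1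
        (by have := hαle i; linarith [h3.1]) (fun _ => by rw [e2]; exact ⟨hB, h3.2⟩) (by simp)
      rw [e1, e2] at this
      simp only [mkc, e1, e2]
      linarith
    · have := val_shift2 gr.fa gr.fb (ra.g i (by omega)) (rb.g i (by omega))
        (by rw [e2]; linarith [h3.1]) (by simp only [e1]; exact h3.1)
        (fun _ => by rw [e2]; exact ⟨hB, h3.2.1⟩) (by simp)
      rw [e1, e2, wU_zero h3.2.2] at this
      have hw : wL E (u i).a1 g (u i).b1 (u i).b2 = 0 := by
        apply wL_zero; intro hn; linarith [hn.1, h3.1]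
      simp only [mkc, e1, e2, hw]
      linarith
  refine sd.no h ?_ ?_ ?_
  · rw [dcost_zero, add_zero, hα, dcost_ish n _ l r g g' hlr hrn hf]
    exact hc
  · intro i hi hci
    by_cases hin : l < i ∧ i ≤ r
    · have := hval i hin.1 hin.2 hci
      have w := wL_nonneg (E := E) (u i).a1 (u i).a2 (u i).b1 (u i).b2
      nlinarith
    · rw [mkc_eq]
      · rw [hα, ish_out hin]
      · rfl
  · obtain ⟨i, h1, h2, hci, hn⟩ := hs
    refine ⟨i, by omega, hci, ?_⟩
    have := hval i h1 h2 hci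
    have w := wL_pos (E := E) (o := (u i).a2) (by rw [hf i h1 h2]; exact hn) (u i).a1 (u i).b1
    nlinarith

theorem KK_stut_lt {r l : ℕ} (h : l < r) (u : ℕ → Cfg) : KK (stut r u) l ↔ KK u l := by
  unfold KK; rw [stut_le (by omega), stut_le (by omega)]
theorem KK_stut_eq {r : ℕ} (u : ℕ → Cfg) (hx : XSp (u r)) : ¬ KK (stut r u) r := by
  unfold KK; rw [stut_le le_rfl, stut_gt (by omega)]; simpa using hx.ssx
theorem KK_stut_gt {r l : ℕ} (h : r < l) (u : ℕ → Cfg) : KK (stut r u) l ↔ KK u (l - 1) := by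
  unfold KK; rw [stut_gt (by omega), stut_gt (by omega)]
  rw [show l - 1 + 1 = l + 1 - 1 by omega]

theorem xsp_of_not_KK {u : ℕ → Cfg} {i : ℕ} (h : ¬ KK u i) : XSp (u i) ∧ XSp (u (i + 1)) := by
  unfold KK at h; push Not at h
  rcases h with h | h
  · exact ⟨Or.inl h.1, Or.inl h.2⟩
  · exact ⟨Or.inr h.1, Or.inr h.2⟩

/-- the lower robot does not rise into a near configuration -/
theorem R1a {n u} (h : Opt3 E n u) {i : ℕ} (hi : i < n) (hK : KK u i)
    (hr : (u i).a2 < (u (i + 1)).a2) (hn : near E (u (i + 1)).a2 (u (i + 1)).b2) : False := by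
  set g := (u (i + 1)).a2 with hg
  have hgY : g ∈ E.Y := (h.walk.1 (i + 1) hi).ya
  obtain ⟨g', hlt, a⟩ := exists_nb_dn hgY
  have hB := hn.o
  have hge : (u i).a2 ≤ g' := a.ge_of_gt hlt (h.walk.1 i hi.le).ya hr
  obtain ⟨hx, hv⟩ := (h.walk.ra i hi).vseg hr.ne
  have hv' : VSeg E.F (u (i + 1)).a1 g g' := by
    rw [hx] at hv
    exact hv.symm.sub left_mem_uIcc (by rw [mem_uIcc]; right; exact ⟨hge, hlt.le⟩)
  have hex : ∃ r, i < r ∧ (r < n → ¬ KK u r ∨ (u (r + 1)).a2 ≠ g) := ⟨n, hi, fun h => absurd h (lt_irrefl _)⟩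
  classical
  let r := Nat.find hex
  obtain ⟨hir, hrn'⟩ : i < r ∧ (r < n → ¬ KK u r ∨ (u (r + 1)).a2 ≠ g) := Nat.find_spec hex
  have hmin : ∀ j, i < j → j < r → (j < n ∧ KK u j ∧ (u (j + 1)).a2 = g) := by
    intro j h1 h2
    have := Nat.find_min hex h2
    push Not at this
    exact this h1
  have hrle : r ≤ n := Nat.find_min' hex ⟨hi, fun h => absurd h (lt_irrefl _)⟩
  have hpl : ∀ j, i < j → j ≤ r → (u j).a2 = g := by
    intro j h1 h2
    rcases Nat.lt_or_ge (i + 1) j with h3 | h3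
    · have := (hmin (j - 1) (by omega) (by omega)).2.2
      rwa [show j - 1 + 1 = j by omega] at this
    · rw [show j = i + 1 by omega]
  have hrn : r < n := by
    rcases Nat.lt_or_ge r n with h1 | h1
    · exact h1
    · exfalso
      have := hpl r hir le_rfl
      rw [show r = n by omega] at this
      exact hB (this ▸ h.an)
  have hlow : ∀ j, i < j → j ≤ r → (u j).a2 + 1 ≤ (u j).b2 := by
    intro j
    induction j with
    | zero => intro h1; omega
    | succ j ih =>
      intro h1 h2
      rcases Nat.lt_or_ge i j with h3 | h3
      · have h4 := ih h3 (by omega)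
        rcases h.walk.ssy (by omega) (hmin j h3 (by omega)).2.1 with h5 | h5
        · exact h5.2
        · linarith [h5.1]
      · rw [show j = i by omega]; exact hn.1
  have conj : Con u n (i + 1) := Or.inr ⟨i, rfl, hi, hK⟩
  have e1 : |(u i).a2 - g'| - |(u i).a2 - g| = -(g - g') := a.absd hlt (h.walk.1 i hi.le).ya hr
  by_cases hKr : KK u r
  · have hne := (hrn' hrn).resolve_left (fun h => h hKr)
    refine lower_no h hir hrn hpl a hlt hB hx ?_ (i0 := i + 1) (by omega) hir hv' ?_
      (fun j h1 h2 _ => Or.inl ⟨hlow j h1 h2, hn.o1⟩) ⟨i + 1, by omega, hir, conj, hn⟩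
    · exact ((h.walk.ra r hrn).vseg (by rw [hpl r hir le_rfl]; exact hne.symm)).1
    · rw [e1]
      have : |(u (r + 1)).a2 - g'| - |(u (r + 1)).a2 - g| ≤ g - g' := by
        have := abs_sub_le (u (r + 1)).a2 g g'
        rw [abs_of_pos (show 0 < g - g' by linarith)] at this; linarith
      linarith
  · have hxs := (xsp_of_not_KK hKr).1
    have h' := h.stut hrn.le hxs
    have es : ∀ j, j ≤ r → stut r u j = u j := fun j hj => stut_le hj u
    have er : stut r u (r + 1) = u r := stut_gt (by omega) u
    refine lower_no h' (l := i) (r := r) (g := g) (g' := g') hir (by omega)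
      (fun j h1 h2 => by rw [es j h2]; exact hpl j h1 h2) a hlt hB
      (by rw [es i (by omega), es (i + 1) (by omega)]; exact hx) (by rw [er, es r le_rfl]) (i0 := i + 1) (by omega) hir
      (by rw [es (i + 1) hir]; exact hv') ?_
      (fun j h1 h2 _ => Or.inl ⟨by rw [es j h2]; exact hlow j h1 h2, hn.o1⟩)
      ⟨i + 1, by omega, hir, Or.inr ⟨i, rfl, by omega, (KK_stut_lt hir u).2 hK⟩, by rw [es _ hir]; exact hn⟩
    rw [es i (by omega), er, e1, hpl r hir le_rfl, abs_of_pos (show 0 < g - g' by linarith)]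
    simp

/-- the upper robot does not descend into a near configuration -/
theorem R1b {n u} (h : Opt3 E n u) {i : ℕ} (hi : i < n) (hK : KK u i)
    (hr : (u (i + 1)).b2 < (u i).b2) (hn : near E (u (i + 1)).a2 (u (i + 1)).b2) : False := by
  have h' := (symm_sw E.fy).opt3 ((symm_fy E).opt3 h)
  refine R1a h' (i := i) hi ?_ ?_ ?_
  · exact KK_sw.2 hK
  · simp; exact hr
  · simpa using near_fy.2 hn

/-- heights are constant in a K-step into a near configuration -/
theorem R1 {n u} (h : Opt3 E n u) {i : ℕ} (hi : i < n) (hK : KK u i)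
    (hn : near E (u (i + 1)).a2 (u (i + 1)).b2) :
    (u i).a2 = (u (i + 1)).a2 ∧ (u i).b2 = (u (i + 1)).b2 := by
  have h1 : ¬ (u i).a2 < (u (i + 1)).a2 := fun hh => R1a h hi hK hh hn
  have h2 : ¬ (u (i + 1)).b2 < (u i).b2 := fun hh => R1b h hi hK hh hn
  push Not at h1 h2
  have hord : (u i).a2 + 1 ≤ (u i).b2 := by
    rcases h.walk.ssy hi hK with h5 | h5
    · exact h5.1
    · linarith [h5.2, hn.1]
  have hn' : near E (u i).a2 (u i).b2 :=
    ⟨hord, fun b hb => ⟨fun hh => (hn.2 b hb).1 ⟨by linarith [hh.1], by linarith [hh.2]⟩,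
      fun hh => (hn.2 b hb).2 ⟨by linarith [hh.1], by linarith [hh.2]⟩⟩⟩
  have hr := h.rev
  have hk : KK (fun i => u (n - i)) (n - 1 - i) := by
    rw [KK_rev (by omega)]; rwa [show n - 1 - (n - 1 - i) = i by omega]
  have i1 : n - (n - 1 - i) = i + 1 := by omega
  have i2 : n - (n - 1 - i + 1) = i := by omega
  constructor
  · by_contra hne
    refine R1a hr (i := n - 1 - i) (by omega) hk ?_ ?_
    · simp only [i1, i2]; exact lt_of_le_of_ne h1 (Ne.symm hne)
    · simp only [i2]; exact hn'
  · by_contra hne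
    refine R1b hr (i := n - 1 - i) (by omega) hk ?_ ?_
    · simp only [i1, i2]; exact lt_of_le_of_ne h2 hne
    · simp only [i2]; exact hn'

theorem R1' {n u} (h : Opt3 E n u) {i : ℕ} (hi : i < n) (hK : KK u i)
    (hn : near E (u i).a2 (u i).b2) :
    (u i).a2 = (u (i + 1)).a2 ∧ (u i).b2 = (u (i + 1)).b2 := by
  have hr := h.rev
  have hk : KK (fun i => u (n - i)) (n - 1 - i) := by
    rw [KK_rev (by omega)]; rwa [show n - 1 - (n - 1 - i) = i by omega]
  have i1 : n - (n - 1 - i) = i + 1 := by omega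
  have i2 : n - (n - 1 - i + 1) = i := by omega
  have := R1 hr (i := n - 1 - i) (by omega) hk (by simp only [i2]; exact hn)
  simp only [i1, i2] at this
  exact ⟨this.1.symm, this.2.symm⟩

/-- total variation of a sequence -/
def TV (f : ℕ → ℝ) (i j : ℕ) : ℝ := ∑ l ∈ Finset.Ico i j, |f l - f (l + 1)|

theorem TV_nonneg (f : ℕ → ℝ) (i j : ℕ) : 0 ≤ TV f i j := Finset.sum_nonneg fun _ _ => abs_nonneg _
theorem TV_add (f : ℕ → ℝ) {i j k : ℕ} (h1 : i ≤ j) (h2 : j ≤ k) : TV f i k = TV f i j + TV f j k :=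
  (Finset.sum_Ico_consecutive _ h1 h2).symm
theorem abs_le_TV (f : ℕ → ℝ) {i j : ℕ} (h : i ≤ j) : |f i - f j| ≤ TV f i j := by
  induction j, h using Nat.le_induction with
  | base => simp [TV]
  | succ j hij ih =>
    have := abs_sub_le (f i) (f j) (f (j + 1))
    unfold TV at *
    rw [Finset.sum_Ico_succ_top hij]; linarith
theorem sum_cost_TV (u : ℕ → Cfg) (i j : ℕ) : ∑ l ∈ Finset.Ico i j, cost (u l) (u (l + 1)) =
    TV (fun l => (u l).a1) i j + TV (fun l => (u l).a2) i j + TV (fun l => (u l).b1) i j +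
      TV (fun l => (u l).b2) i j := by
  unfold TV cost; simp only [Finset.sum_add_distrib]
theorem cost_le_sum (u : ℕ → Cfg) {i j : ℕ} (h : i ≤ j) :
    cost (u i) (u j) ≤ ∑ l ∈ Finset.Ico i j, cost (u l) (u (l + 1)) := by
  rw [sum_cost_TV]
  have h1 := abs_le_TV (fun l => (u l).a1) h
  have h2 := abs_le_TV (fun l => (u l).a2) h
  have h3 := abs_le_TV (fun l => (u l).b1) h
  have h4 := abs_le_TV (fun l => (u l).b2) h
  unfold cost; linarith

/-- A maximal run of K-steps with constant heights, in which the robots change sides. -/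
structure Win (n : ℕ) (u : ℕ → Cfg) (i j : ℕ) : Prop where
  lt : i < j
  pos : 0 < i
  ltn : j < n
  k : ∀ l, i ≤ l → l < j → KK u l
  kl : ¬ KK u (i - 1)
  kr : ¬ KK u j
  ha : ∀ l, i ≤ l → l ≤ j → (u l).a2 = (u i).a2
  hb : ∀ l, i ≤ l → l ≤ j → (u l).b2 = (u i).b2
  side : ((u i).a1 + 1 ≤ (u i).b1 ∧ (u j).b1 + 1 ≤ (u j).a1) ∨
    ((u i).b1 + 1 ≤ (u i).a1 ∧ (u j).a1 + 1 ≤ (u j).b1)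

theorem win_right {n u} (h : Opt3 E n u) {j : ℕ} (hj : j ≤ n) (hn : near E (u j).a2 (u j).b2) :
    ∃ r, j ≤ r ∧ r < n ∧ ¬ KK u r ∧ (∀ l, j ≤ l → l < r → KK u l) ∧
      ∀ l, j ≤ l → l ≤ r → (u l).a2 = (u j).a2 ∧ (u l).b2 = (u j).b2 := by
  have hex : ∃ r, j ≤ r ∧ (r < n → ¬ KK u r) := ⟨n, hj, fun h => absurd h (lt_irrefl _)⟩
  classical
  let r := Nat.find hex
  obtain ⟨hir, hrn'⟩ : j ≤ r ∧ (r < n → ¬ KK u r) := Nat.find_spec hex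
  have hmin : ∀ l, j ≤ l → l < r → (l < n ∧ KK u l) := by
    intro l h1 h2
    have := Nat.find_min hex h2
    push Not at this
    exact this h1
  have hrle : r ≤ n := Nat.find_min' hex ⟨hj, fun h => absurd h (lt_irrefl _)⟩
  have hc : ∀ l, j ≤ l → l ≤ r → (u l).a2 = (u j).a2 ∧ (u l).b2 = (u j).b2 := by
    intro l hl
    induction l, hl using Nat.le_induction with
    | base => intro _; exact ⟨rfl, rfl⟩
    | succ l hl ih =>
      intro hlr
      have i1 := ih (by omega)
      have := R1' h (hmin l hl (by omega)).1 (hmin l hl (by omega)).2 (by rw [i1.1, i1.2]; exact hn)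
      exact ⟨this.1.symm.trans i1.1, this.2.symm.trans i1.2⟩
  have hrn : r < n := by
    rcases Nat.lt_or_ge r n with h1 | h1
    · exact h1
    · exfalso
      have := (hc r hir le_rfl).1
      rw [show r = n by omega] at this
      exact hn.o (this ▸ h.an)
  exact ⟨r, hir, hrn, hrn' hrn, fun l h1 h2 => (hmin l h1 h2).2, hc⟩

theorem win_left {n u} (h : Opt3 E n u) {j : ℕ} (hj : j ≤ n) (hn : near E (u j).a2 (u j).b2) :
    ∃ r, r ≤ j ∧ 0 < r ∧ ¬ KK u (r - 1) ∧ (∀ l, r ≤ l → l < j → KK u l) ∧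
      ∀ l, r ≤ l → l ≤ j → (u l).a2 = (u j).a2 ∧ (u l).b2 = (u j).b2 := by
  have jj : n - (n - j) = j := by omega
  obtain ⟨r, h1, h2, h3, h4, h5⟩ := win_right h.rev (j := n - j) (by omega) (by simp only [jj]; exact hn)
  refine ⟨n - r, by omega, by omega, ?_, ?_, ?_⟩
  · rw [KK_rev h2] at h3
    rwa [show n - r - 1 = n - 1 - r by omega]
  · intro l a b
    have := h4 (n - 1 - l) (by omega) (by omega)
    rw [KK_rev (by omega)] at this
    rwa [show n - 1 - (n - 1 - l) = l by omega] at this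
  · intro l a b
    have := h5 (n - l) (by omega) (by omega)
    simpa only [jj, show n - (n - l) = l by omega] using this

theorem Walk.rowA {n u} (h : Walk E n u) {i j : ℕ} {g : ℝ} (hij : i ≤ j) (hj : j ≤ n)
    (hf : ∀ l, i ≤ l → l ≤ j → (u l).a2 = g) : HSeg E.F g (u i).a1 (u j).a1 :=
  row_conn (x := fun i => (u i).a1) (y := fun i => (u i).a2) h.ra hij hj
    (by have := (h.1 i (by omega)).fa; rwa [hf i le_rfl hij] at this) hf
theorem Walk.rowB {n u} (h : Walk E n u) {i j : ℕ} {g : ℝ} (hij : i ≤ j) (hj : j ≤ n)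
    (hf : ∀ l, i ≤ l → l ≤ j → (u l).b2 = g) : HSeg E.F g (u i).b1 (u j).b1 :=
  row_conn (x := fun i => (u i).b1) (y := fun i => (u i).b2) h.rb hij hj
    (by have := (h.1 i (by omega)).fb; rwa [hf i le_rfl hij] at this) hf

theorem CW {n u} (h : Opt3 E n u) {j : ℕ} (hj : j ≤ n) (hn : near E (u j).a2 (u j).b2)
    (hc : Con u n j) : ∃ i r, i ≤ j ∧ j ≤ r ∧ Win n u i r := by
  obtain ⟨r, r1, r2, r3, r4, r5⟩ := win_right h hj hn
  obtain ⟨i, i1, i2, i3, i4, i5⟩ := win_left h hj hn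
  have hir : i < r := by
    by_contra hh
    have e1 : i = j := by omega
    have e2 : r = j := by omega
    rcases hc with ⟨_, hk⟩ | ⟨l, hl, _, hk⟩
    · exact r3 (e2 ▸ hk)
    · apply i3; rwa [show i - 1 = l by omega]
  have hk : ∀ l, i ≤ l → l < r → KK u l := fun l a b =>
    if hh : l < j then i4 l a hh else r4 l (by omega) b
  have hij := i5 i le_rfl i1
  have hh : ∀ l, i ≤ l → l ≤ r → (u l).a2 = (u i).a2 ∧ (u l).b2 = (u i).b2 := fun l a b => by
    rw [hij.1, hij.2]
    exact if hh : l ≤ j then i5 l a hh else r5 l (by omega) b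
  refine ⟨i, r, i1, r1, hir, i2, r2, hk, i3, r3, fun l a b => (hh l a b).1, fun l a b => (hh l a b).2, ?_⟩
  have xi := (xsp_of_not_KK i3).2
  rw [show i - 1 + 1 = i by omega] at xi
  have xr := (xsp_of_not_KK r3).1
  have key : ¬ SSx (u i) (u r) := by
    intro hs
    have w := Wk.free (h.walk.1 i (by omega)) (h.walk.1 r r2.le)
      (Or.inl ⟨(hh r hir.le le_rfl).1.symm, h.walk.rowA hir.le r2.le (fun l a b => (hh l a b).1)⟩)
      (Or.inl ⟨(hh r hir.le le_rfl).2.symm, h.walk.rowB hir.le r2.le (fun l a b => (hh l a b).2)⟩) hs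
    exact h.ex le_rfl hir r2.le (hk i le_rfl hir) w (cost_le_sum u hir.le)
  unfold SSx at key
  push Not at key
  rcases xi with xi | xi <;> rcases xr with xr | xr
  · linarith [key.1 xi]
  · exact Or.inl ⟨xi, xr⟩
  · exact Or.inr ⟨xi, xr⟩
  · linarith [key.2 xi]

end TR

namespace TR

variable {E : Env}

/-- x-separated walks -/
def FW (E : Env) (e e' : Cfg) (c : ℝ) : Prop := ∃ q, Wk E e e' c 0 0 q

theorem FW.trans {e e' e'' c c'} (h : FW E e e' c) (h' : FW E e' e'' c') : FW E e e'' (c + c') := by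
  obtain ⟨q, h⟩ := h
  obtain ⟨q', h'⟩ := h'
  have := h.trans h'
  rw [add_zero, add_zero] at this
  exact ⟨_, this⟩
theorem FW.rev {e e' c} (h : FW E e e' c) : FW E e' e c := by
  obtain ⟨q, h⟩ := h
  exact ⟨_, h.rev⟩
theorem FW.step {e e'} (h : Grid E e) (h' : Grid E e')
    (ha : RM E.F e.a1 e.a2 e'.a1 e'.a2) (hb : RM E.F e.b1 e.b2 e'.b1 e'.b2)
    (hs : SSx e e') : FW E e e' (cost e e') := ⟨_, Wk.free h h' ha hb hs⟩
theorem FW.nil {e} (h : Grid E e) : FW E e e 0 := ⟨_, Wk.nil e h⟩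

theorem Opt3.exF {n u} (h : Opt3 E n u) {i j l : ℕ} (hij : i ≤ l) (hl : l < j) (hj : j ≤ n)
    (hK : KK u l) {c} (hw : FW E (u i) (u j) c)
    (hc : c ≤ ∑ l ∈ Finset.Ico i j, cost (u l) (u (l + 1))) : False := by
  obtain ⟨q, hw⟩ := hw
  exact h.ex hij hl hj hK hw hc

theorem HSeg.mid {F : ℝ → ℝ → Prop} {y x p q t : ℝ} (h1 : HSeg F y x p) (h2 : HSeg F y x q)
    (ht : t ∈ uIcc p q) : HSeg F y x t :=
  h1.trans ((h1.symm.trans h2).sub left_mem_uIcc ht)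

theorem mem_uIcc_of {a b t : ℝ} (h1 : a ≤ t) (h2 : t ≤ b) : t ∈ uIcc a b := by
  rw [mem_uIcc]; left; exact ⟨h1, h2⟩
theorem mem_uIcc_of' {a b t : ℝ} (h1 : b ≤ t) (h2 : t ≤ a) : t ∈ uIcc a b := by
  rw [mem_uIcc]; right; exact ⟨h1, h2⟩

theorem near_up {h w x x' t : ℝ} (hn : near E h w) (hne : x ≠ x') (hs : HSeg E.F h x x')
    (ht : t ∈ uIcc x x') (hF : E.F t w) : VSeg E.F t h w := by
  have := E.rise x x' h (w - 1) (by linarith [hn.1]) hne hs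
    (fun b hb hh => (hn.2 b hb).1 ⟨hh.1, hh.2.le⟩) t ht
  exact this.trans (E.gap t (w - 1) w this.right hF (by simp))
theorem near_dn {h w x x' t : ℝ} (hn : near E w h) (hne : x ≠ x') (hs : HSeg E.F h x x')
    (ht : t ∈ uIcc x x') (hF : E.F t w) : VSeg E.F t h w := by
  have := E.fall x x' h (w + 1) (by linarith [hn.1]) hne hs
    (fun b hb hh => (hn.2 b hb).2 ⟨hh.1.le, hh.2⟩) t ht
  exact this.trans (E.gap t (w + 1) w this.right hF (by simp))

theorem abs_mid {a m b : ℝ} (h : m ∈ uIcc a b) : |a - m| + |m - b| = |a - b| := by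
  rw [mem_uIcc] at h
  rcases h with ⟨h1, h2⟩ | ⟨h1, h2⟩
  · rw [abs_of_nonpos (by linarith), abs_of_nonpos (by linarith), abs_of_nonpos (by linarith)]; ring
  · rw [abs_of_nonneg (by linarith), abs_of_nonneg (by linarith), abs_of_nonneg (by linarith)]; ring

/-- detour of B via the height `y0`, the robot A staying in its row -/
theorem via {p1 p2 x1 x2 w1 w2 h p' x' y0 : ℝ} (g1 : Grid E ⟨p1, h, x1, w1⟩) (g2 : Grid E ⟨p2, h, x2, w2⟩)
    (s1 : p1 + 1 ≤ x1) (s2 : p2 + 1 ≤ x2) (hp : HSeg E.F h p1 p2) (hx1 : HSeg E.F h p1 x1)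
    (y0Y : y0 ∈ E.Y)
    (v1 : ∀ z, HSeg E.F h p1 z → E.F z w1 → VSeg E.F z w1 y0)
    (v2 : ∀ z, HSeg E.F h p1 z → E.F z w2 → VSeg E.F z y0 w2)
    (hh : ∀ z z', HSeg E.F h p1 z → HSeg E.F h p1 z' → HSeg E.F y0 z z')
    (pX : p' ∈ E.X) (hp' : HSeg E.F h p1 p') (hx' : HSeg E.F w2 x' x2) (hxp : x' ≤ p') :
    FW E ⟨p1, h, x1, w1⟩ ⟨p2, h, x2, w2⟩ (|p1 - p2| + |x1 - x2| + (|w1 - y0| + |w2 - y0|)) := by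
  have key : ∀ z ∈ E.X, x1 ≤ z → z ≤ x2 → HSeg E.F h p1 z → HSeg E.F w2 z x2 →
      FW E ⟨p1, h, x1, w1⟩ ⟨p2, h, x2, w2⟩ (|p1 - p2| + |x1 - x2| + (|w1 - y0| + |w2 - y0|)) := by
    intro z zX h1 h2 hz hzx
    have a1 := v1 x1 hx1 g1.fb
    have a2 := v2 z hz hzx.left
    have a3 := hh x1 z hx1 hz
    have f1 : FW E ⟨p1, h, x1, w1⟩ ⟨p1, h, x1, y0⟩ _ :=
      FW.step g1 ⟨g1.fa, a1.right, g1.xa, g1.xb, g1.ya, y0Y⟩ (RM.refl g1.fa) (Or.inr ⟨rfl, a1⟩)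
        (Or.inl ⟨s1, s1⟩)
    have f2 : FW E ⟨p1, h, x1, y0⟩ ⟨p1, h, z, y0⟩ _ :=
      FW.step ⟨g1.fa, a1.right, g1.xa, g1.xb, g1.ya, y0Y⟩ ⟨g1.fa, a2.left, g1.xa, zX, g1.ya, y0Y⟩
        (RM.refl g1.fa) (Or.inl ⟨rfl, a3⟩) (Or.inl ⟨s1, by simp only at *; linarith⟩)
    have f3 : FW E ⟨p1, h, z, y0⟩ ⟨p1, h, z, w2⟩ _ :=
      FW.step ⟨g1.fa, a2.left, g1.xa, zX, g1.ya, y0Y⟩ ⟨g1.fa, a2.right, g1.xa, zX, g1.ya, g2.yb⟩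
        (RM.refl g1.fa) (Or.inr ⟨rfl, a2⟩) (Or.inl ⟨by simp only at *; linarith, by simp only at *; linarith⟩)
    have f4 : FW E ⟨p1, h, z, w2⟩ ⟨p2, h, x2, w2⟩ _ :=
      FW.step ⟨g1.fa, a2.right, g1.xa, zX, g1.ya, g2.yb⟩ g2
        (Or.inl ⟨rfl, hp⟩) (Or.inl ⟨rfl, hzx⟩) (Or.inl ⟨by simp only at *; linarith, s2⟩)
    convert ((f1.trans f2).trans f3).trans f4 using 1
    simp only [cost, sub_self, abs_zero]
    rw [← abs_mid (mem_uIcc_of h1 h2), abs_sub_comm y0 w2]; ring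
  by_cases hx2 : HSeg E.F h p1 x2
  · rcases le_total x1 x2 with h1 | h1
    · exact key x2 g2.xb h1 le_rfl hx2 (HSeg.refl g2.fb)
    · have a1 := v1 x1 hx1 g1.fb
      have a2 := v2 x2 hx2 g2.fb
      have a3 := hh x1 x2 hx1 hx2
      have f1 : FW E ⟨p1, h, x1, w1⟩ ⟨p2, h, x1, y0⟩ _ :=
        FW.step g1 ⟨g2.fa, a1.right, g2.xa, g1.xb, g1.ya, y0Y⟩ (Or.inl ⟨rfl, hp⟩) (Or.inr ⟨rfl, a1⟩)
          (Or.inl ⟨s1, by simp only at *; linarith⟩)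
      have f2 : FW E ⟨p2, h, x1, y0⟩ ⟨p2, h, x2, y0⟩ _ :=
        FW.step ⟨g2.fa, a1.right, g2.xa, g1.xb, g1.ya, y0Y⟩ ⟨g2.fa, a2.left, g2.xa, g2.xb, g1.ya, y0Y⟩
          (RM.refl g2.fa) (Or.inl ⟨rfl, a3⟩) (Or.inl ⟨by simp only at *; linarith, by simp only at *; linarith⟩)
      have f3 : FW E ⟨p2, h, x2, y0⟩ ⟨p2, h, x2, w2⟩ _ :=
        FW.step ⟨g2.fa, a2.left, g2.xa, g2.xb, g1.ya, y0Y⟩ g2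
          (RM.refl g2.fa) (Or.inr ⟨rfl, a2⟩) (Or.inl ⟨by simp only at *; linarith, by simp only at *; linarith⟩)
      convert (f1.trans f2).trans f3 using 1
      simp only [cost, sub_self, abs_zero]
      rw [abs_sub_comm y0 w2]; ring
  · have c1 : x1 < x2 := by
      by_contra hc; push Not at hc
      exact hx2 (hp.mid hx1 (mem_uIcc_of (by linarith) hc))
    have c2 : p' < x2 := by
      by_contra hc; push Not at hc
      exact hx2 (hp.mid hp' (mem_uIcc_of (by linarith) hc))
    refine key (max x1 p') ?_ (le_max_left _ _) (max_le c1.le c2.le) ?_ ?_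
    · rcases max_choice x1 p' with h | h <;> rw [h]
      · exact g1.xb
      · exact pX
    · rcases max_choice x1 p' with h | h <;> rw [h]
      · exact hx1
      · exact hp'
    · exact hx'.sub (mem_uIcc_of (hxp.trans (le_max_right _ _)) (max_le c1.le c2.le)) right_mem_uIcc

/-- two near contacts above, both outside the row of A -/
theorem aa_out {p1 p2 x1 x2 w1 w2 h x1' p' x' : ℝ} (g1 : Grid E ⟨p1, h, x1, w1⟩) (g2 : Grid E ⟨p2, h, x2, w2⟩)
    (s1 : p1 + 1 ≤ x1) (s2 : p2 + 1 ≤ x2) (hp : HSeg E.F h p1 p2)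
    (n1 : near E h w1) (n2 : near E h w2) (hx1 : ¬ HSeg E.F h p1 x1) (h12 : x1 ≤ x2)
    (hx1' : HSeg E.F w1 x1' x1) (hne : x1' ≠ x1)
    (hp' : HSeg E.F h p1 p') (hx' : HSeg E.F w2 x' x2) (hxp : x' ≤ p') :
    FW E ⟨p1, h, x1, w1⟩ ⟨p2, h, x2, w2⟩ (cost ⟨p1, h, x1, w1⟩ ⟨p2, h, x2, w2⟩) := by
  have c1 : p' < x1 := by
    by_contra hc; push Not at hc
    exact hx1 ((HSeg.refl g1.fa).mid hp' (mem_uIcc_of (by linarith) hc))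
  have m : x1 ∈ uIcc x' x2 := mem_uIcc_of (by linarith) h12
  have v : VSeg E.F x1 w1 w2 := by
    rcases le_total w1 w2 with hw | hw
    · exact E.rise x1' x1 w1 w2 hw hne hx1' (fun b hb hh => (n2.2 b hb).2 ⟨by linarith [n1.1, hh.1], hh.2.le⟩) _
        right_mem_uIcc
    · exact E.fall x1' x1 w1 w2 hw hne hx1' (fun b hb hh => (n1.2 b hb).2 ⟨by linarith [n2.1, hh.1], hh.2⟩) _
        right_mem_uIcc
  have f1 : FW E ⟨p1, h, x1, w1⟩ ⟨p1, h, x1, w2⟩ _ :=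
    FW.step g1 ⟨g1.fa, v.right, g1.xa, g1.xb, g1.ya, g2.yb⟩ (RM.refl g1.fa) (Or.inr ⟨rfl, v⟩) (Or.inl ⟨s1, s1⟩)
  have f2 : FW E ⟨p1, h, x1, w2⟩ ⟨p2, h, x2, w2⟩ _ :=
    FW.step ⟨g1.fa, v.right, g1.xa, g1.xb, g1.ya, g2.yb⟩ g2 (Or.inl ⟨rfl, hp⟩)
      (Or.inl ⟨rfl, hx'.sub m right_mem_uIcc⟩) (Or.inl ⟨s1, s2⟩)
  convert f1.trans f2 using 1
  simp only [cost, sub_self, abs_zero]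
  ring

/-- clipping a path of almost constant height to `x ≥ c` -/
theorem clip {x y : ℕ → ℝ} {t1 t2 : ℕ} (ht : t1 ≤ t2)
    (hRM : ∀ i, t1 ≤ i → i < t2 → RM E.F (x i) (y i) (x (i + 1)) (y (i + 1)))
    (hx : ∀ i, t1 ≤ i → i ≤ t2 → x i ∈ E.X) (hy : ∀ i, t1 ≤ i → i ≤ t2 → y i ∈ E.Y)
    (hd : ∀ i j, t1 ≤ i → i ≤ t2 → t1 ≤ j → j ≤ t2 → |y i - y j| ≤ 1)
    {c p h : ℝ} (cX : c ∈ E.X) (pX : p ∈ E.X) (hYY : h ∈ E.Y) (hF : E.F p h) (hF1 : E.F (x t1) (y t1)) (hpc : p + 1 ≤ c)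
    (hc1 : c ≤ x t1) (hc2 : c ≤ x t2) :
    ∃ d, FW E ⟨p, h, x t1, y t1⟩ ⟨p, h, x t2, y t2⟩ d ∧ d ≤ TV x t1 t2 + TV y t1 t2 := by
  have main : ∀ j, t1 ≤ j → j ≤ t2 →
      (c ≤ x j ∧ ∃ d, FW E ⟨p, h, x t1, y t1⟩ ⟨p, h, x j, y j⟩ d ∧ d ≤ TV x t1 j + TV y t1 j) ∨
      (x j < c ∧ ∃ k, t1 ≤ k ∧ k ≤ t2 ∧ ∃ d, FW E ⟨p, h, x t1, y t1⟩ ⟨p, h, c, y k⟩ d ∧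
        d + |y k - y j| + (c - x j) ≤ TV x t1 j + TV y t1 j) := by
    intro j hj
    induction j, hj using Nat.le_induction with
    | base =>
      intro _
      exact Or.inl ⟨hc1, 0, FW.nil ⟨hF, hF1, pX, hx _ le_rfl ht, hYY, hy _ le_rfl ht⟩, by simp [TV]⟩
    | succ j hj ih =>
      intro hj2
      have rm := hRM j hj (by omega)
      have ex : TV x t1 (j + 1) = TV x t1 j + |x j - x (j + 1)| := Finset.sum_Ico_succ_top hj _
      have ey : TV y t1 (j + 1) = TV y t1 j + |y j - y (j + 1)| := Finset.sum_Ico_succ_top hj _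
      have gg : ∀ k, t1 ≤ k → k ≤ t2 → E.F c (y k) → Grid E ⟨p, h, c, y k⟩ := fun k k1 k2 hf =>
        ⟨hF, hf, pX, cX, hYY, hy k k1 k2⟩
      have gj : Grid E ⟨p, h, x j, y j⟩ := ⟨hF, rm.left, pX, hx j hj (by omega), hYY, hy j hj (by omega)⟩
      have gj1 : Grid E ⟨p, h, x (j+1), y (j+1)⟩ :=
        ⟨hF, rm.right, pX, hx _ (by omega) (by omega), hYY, hy _ (by omega) (by omega)⟩
      rcases ih (by omega) with ⟨h1, d, fw, hd'⟩ | ⟨h1, k, k1, k2, d, fw, hd'⟩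
      · rcases le_or_gt c (x (j + 1)) with h2 | h2
        · refine Or.inl ⟨h2, _, fw.trans (FW.step gj gj1 (RM.refl hF) rm
            (Or.inl ⟨by simp only; linarith, by simp only; linarith⟩)), ?_⟩
          simp only [cost, sub_self, abs_zero]; linarith
        · have hne : y j = y (j + 1) := by
            by_contra hne; have := (rm.vseg hne).1; linarith
          have hs := rm.hseg hne
          have hm : c ∈ uIcc (x j) (x (j + 1)) := mem_uIcc_of' h2.le h1
          have := FW.step gj (gg j hj (by omega) (hs c hm)) (RM.refl hF)
            (Or.inl ⟨rfl, hs.sub left_mem_uIcc hm⟩) (Or.inl ⟨by simp only; linarith, by simp only; linarith⟩)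
          refine Or.inr ⟨h2, j, hj, by omega, _, fw.trans this, ?_⟩
          simp only [cost, sub_self, abs_zero]
          rw [ex, ey, hne, abs_of_nonneg (show 0 ≤ x j - c by linarith),
            abs_of_nonneg (show 0 ≤ x j - x (j+1) by linarith)]
          simp only [sub_self, abs_zero]
          linarith
      · rcases le_or_gt c (x (j + 1)) with h2 | h2
        · have hne : y j = y (j + 1) := by
            by_contra hne; have := (rm.vseg hne).1; linarith
          have hs := rm.hseg hne
          have hm : c ∈ uIcc (x j) (x (j + 1)) := mem_uIcc_of h1.le h2
          have hv := E.gap c (y k) (y j) fw.rev.choose_spec.gridL.fb (hs c hm) (hd k j k1 k2 hj (by omega))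
          have f1 := FW.step (gg k k1 k2 hv.left) (gg j hj (by omega) (hs c hm)) (RM.refl hF)
            (Or.inr ⟨rfl, hv⟩) (Or.inl ⟨by simp only; linarith, by simp only; linarith⟩)
          have f2 := FW.step (gg j hj (by omega) (hs c hm)) gj1 (RM.refl hF)
            (Or.inl ⟨hne, hs.sub hm right_mem_uIcc⟩) (Or.inl ⟨by simp only; linarith, by simp only; linarith⟩)
          refine Or.inl ⟨h2, _, (fw.trans f1).trans f2, ?_⟩
          simp only [cost, sub_self, abs_zero]
          rw [ex, ey, hne, abs_of_nonpos (show c - x (j+1) ≤ 0 by linarith),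
            abs_of_nonpos (show x j - x (j+1) ≤ 0 by linarith)]
          simp only [sub_self, abs_zero]
          rw [hne] at hd'
          linarith
        · refine Or.inr ⟨h2, k, k1, k2, d, fw, ?_⟩
          have i1 := abs_sub_le (y k) (y j) (y (j + 1))
          have i2 := neg_abs_le (x j - x (j + 1))
          have i3 := le_abs_self (x j - x (j + 1))
          linarith
  rcases main t2 ht le_rfl with ⟨_, h1⟩ | ⟨h1, _⟩
  · exact h1
  · linarith

end TR

namespace TR

variable {E : Env}

theorem Win.fx {n u i j} (w : Win n u i j) : Win n (fun i => (u i).fx) i j where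
  lt := w.lt
  pos := w.pos
  ltn := w.ltn
  k := fun l a b => KK_fx.2 (w.k l a b)
  kl := fun h => w.kl (KK_fx.1 h)
  kr := fun h => w.kr (KK_fx.1 h)
  ha := fun l a b => w.ha l a b
  hb := fun l a b => w.hb l a b
  side := by
    rcases w.side with ⟨h1, h2⟩ | ⟨h1, h2⟩
    · right; simp only [Cfg.fx_a1, Cfg.fx_b1]; exact ⟨by linarith, by linarith⟩
    · left; simp only [Cfg.fx_a1, Cfg.fx_b1]; exact ⟨by linarith, by linarith⟩
theorem Win.fy {n u i j} (w : Win n u i j) : Win n (fun i => (u i).fy) i j where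
  lt := w.lt
  pos := w.pos
  ltn := w.ltn
  k := fun l a b => KK_fy.2 (w.k l a b)
  kl := fun h => w.kl (KK_fy.1 h)
  kr := fun h => w.kr (KK_fy.1 h)
  ha := fun l a b => by simpa using w.ha l a b
  hb := fun l a b => by simpa using w.hb l a b
  side := w.side
theorem Win.sw {n u i j} (w : Win n u i j) : Win n (fun i => (u i).sw) i j where
  lt := w.lt
  pos := w.pos
  ltn := w.ltn
  k := fun l a b => KK_sw.2 (w.k l a b)
  kl := fun h => w.kl (KK_sw.1 h)
  kr := fun h => w.kr (KK_sw.1 h)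
  ha := fun l a b => w.hb l a b
  hb := fun l a b => w.ha l a b
  side := w.side.symm
theorem Win.rev {n u i j} (w : Win n u i j) : Win n (fun i => u (n - i)) (n - j) (n - i) where
  lt := by have := w.lt; have := w.ltn; omega
  pos := by have := w.ltn; omega
  ltn := by have := w.lt; have := w.ltn; have := w.pos; omega
  k := fun l a b => by
    have := w.lt; have := w.ltn; have := w.pos
    rw [KK_rev (by omega)]; exact w.k _ (by omega) (by omega)
  kl := fun h => by
    have := w.lt; have := w.ltn; have := w.pos
    rw [KK_rev (by omega)] at h; apply w.kr; rwa [show n - 1 - (n - j - 1) = j by omega] at h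
  kr := fun h => by
    have := w.lt; have := w.ltn; have := w.pos
    rw [KK_rev (by omega)] at h; apply w.kl; rwa [show n - 1 - (n - i) = i - 1 by omega] at h
  ha := fun l a b => by
    have := w.lt; have := w.ltn; have := w.pos
    simp only [show n - (n - j) = j by omega]
    rw [w.ha j w.lt.le le_rfl]; exact w.ha _ (by omega) (by omega)
  hb := fun l a b => by
    have := w.lt; have := w.ltn; have := w.pos
    simp only [show n - (n - j) = j by omega]
    rw [w.hb j w.lt.le le_rfl]; exact w.hb _ (by omega) (by omega)
  side := by
    have := w.lt; have := w.ltn; have := w.pos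
    simp only [show n - (n - j) = j by omega, show n - (n - i) = i by omega]
    rcases w.side with ⟨h1, h2⟩ | ⟨h1, h2⟩
    · right; exact ⟨h2, h1⟩
    · left; exact ⟨h2, h1⟩

/-- windows starting at different indices are disjoint -/
theorem Win.sep {n u i j k l} (w : Win n u i j) (w' : Win n u k l) (h : i < k) : j < k := by
  by_contra hc
  exact w'.kl (w.k (k - 1) (by omega) (by omega))

/-- given a window, an end where B is to the right of A, and the other end -/
theorem Win.ends {n u i j} (w : Win n u i j) : ∃ s t, i ≤ s ∧ s ≤ j ∧ i ≤ t ∧ t ≤ j ∧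
    (u s).a1 + 1 ≤ (u s).b1 ∧ (u t).b1 + 1 ≤ (u t).a1 := by
  have := w.lt
  rcases w.side with ⟨h1, h2⟩ | ⟨h1, h2⟩
  · exact ⟨i, j, by omega, by omega, by omega, by omega, h1, h2⟩
  · exact ⟨j, i, by omega, by omega, by omega, by omega, h2, h1⟩

theorem rowA' {n u} (w : Walk E n u) {i j s t : ℕ} {g : ℝ} (hj : j ≤ n)
    (hf : ∀ l, i ≤ l → l ≤ j → (u l).a2 = g) (h1 : i ≤ s) (h2 : s ≤ j) (h3 : i ≤ t) (h4 : t ≤ j) :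
    HSeg E.F g (u s).a1 (u t).a1 := by
  rcases le_total s t with h | h
  · exact w.rowA h (by omega) (fun l a b => hf l (by omega) (by omega))
  · exact (w.rowA h (by omega) (fun l a b => hf l (by omega) (by omega))).symm
theorem rowB' {n u} (w : Walk E n u) {i j s t : ℕ} {g : ℝ} (hj : j ≤ n)
    (hf : ∀ l, i ≤ l → l ≤ j → (u l).b2 = g) (h1 : i ≤ s) (h2 : s ≤ j) (h3 : i ≤ t) (h4 : t ≤ j) :
    HSeg E.F g (u s).b1 (u t).b1 := by
  rcases le_total s t with h | h
  · exact w.rowB h (by omega) (fun l a b => hf l (by omega) (by omega))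
  · exact (w.rowB h (by omega) (fun l a b => hf l (by omega) (by omega))).symm

/-- detour, two near contacts above, the first one over the row of A -/
theorem aa_via {p1 p2 x1 x2 w1 w2 h p' x' : ℝ} (g1 : Grid E ⟨p1, h, x1, w1⟩) (g2 : Grid E ⟨p2, h, x2, w2⟩)
    (s1 : p1 + 1 ≤ x1) (s2 : p2 + 1 ≤ x2) (hp : HSeg E.F h p1 p2) (hx1 : HSeg E.F h p1 x1)
    (n1 : near E h w1) (n2 : near E h w2)
    (pX : p' ∈ E.X) (hp' : HSeg E.F h p1 p') (hx' : HSeg E.F w2 x' x2) (hxp : x' ≤ p') :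
    FW E ⟨p1, h, x1, w1⟩ ⟨p2, h, x2, w2⟩ (|p1 - p2| + |x1 - x2| +
      (|w1 - (max w1 w2 - 1)| + |w2 - (max w1 w2 - 1)|)) := by
  have hM : ∀ b ∈ E.B, ¬ (h ≤ b ∧ b < max w1 w2 - 1) := by
    intro b hb hh
    rcases max_choice w1 w2 with hm | hm <;> rw [hm] at hh
    · exact (n1.2 b hb).1 ⟨hh.1, hh.2.le⟩
    · exact (n2.2 b hb).1 ⟨hh.1, hh.2.le⟩
  have hh : h ≤ max w1 w2 - 1 := by have := le_max_left w1 w2; linarith [n1.1]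
  have hr : ∀ z, HSeg E.F h p1 z → VSeg E.F z h (max w1 w2 - 1) := by
    intro z hz
    by_cases hzp : p1 = z
    · subst hzp
      exact E.rise p1 x1 h _ hh (by linarith) hx1 hM p1 left_mem_uIcc
    · exact E.rise p1 z h _ hh hzp hz hM z right_mem_uIcc
  have hv : ∀ w, near E h w → w ≤ max w1 w2 → ∀ z, HSeg E.F h p1 z → E.F z w →
      VSeg E.F z w (max w1 w2 - 1) := by
    intro w hw hwm z hz hF
    rcases le_or_gt w (max w1 w2 - 1) with hc | hc
    · exact (hr z hz).sub (mem_uIcc_of (by linarith [hw.1]) hc) right_mem_uIcc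
    · exact E.gap z _ _ hF (hr z hz).right (by rw [abs_le]; constructor <;> linarith)
  refine via g1 g2 s1 s2 hp hx1 ?_ (hv w1 n1 (le_max_left _ _))
    (fun z hz hF => (hv w2 n2 (le_max_right _ _) z hz hF).symm) ?_ pX hp' hx' hxp
  · apply E.Ym
    rcases max_choice w1 w2 with hm | hm <;> rw [hm]
    · exact g1.yb
    · exact g2.yb
  · intro z z' hz hz' t ht
    exact (hr t (hz.mid hz' ht)).right

theorem aa_core {n u} (w : Walk E n u) {t1 t2 : ℕ} {h : ℝ} (ht : t1 ≤ t2) (hn : t2 ≤ n)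
    (hA : ∀ l, t1 ≤ l → l ≤ t2 → (u l).a2 = h)
    (s1 : (u t1).a1 + 1 ≤ (u t1).b1) (s2 : (u t2).a1 + 1 ≤ (u t2).b1)
    (n1 : near E h (u t1).b2) (n2 : near E h (u t2).b2) {p1' x1' p2' x2' : ℝ}
    (p1X : p1' ∈ E.X) (p2X : p2' ∈ E.X)
    (hp1 : HSeg E.F h (u t1).a1 p1') (hx1 : HSeg E.F (u t1).b2 x1' (u t1).b1) (c1 : x1' + 1 ≤ p1')
    (hp2 : HSeg E.F h (u t2).a1 p2') (hx2 : HSeg E.F (u t2).b2 x2' (u t2).b1) (c2 : x2' + 1 ≤ p2') :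
    ∃ d, FW E (u t1) (u t2) d ∧ d ≤ ∑ l ∈ Finset.Ico t1 t2, cost (u l) (u (l + 1)) := by
  have g1 := w.1 t1 (by omega)
  have g2 := w.1 t2 hn
  have hp : HSeg E.F h (u t1).a1 (u t2).a1 := w.rowA ht hn hA
  have e1 : u t1 = ⟨(u t1).a1, h, (u t1).b1, (u t1).b2⟩ := by rw [← hA t1 le_rfl ht]
  have e2 : u t2 = ⟨(u t2).a1, h, (u t2).b1, (u t2).b2⟩ := by rw [← hA t2 ht le_rfl]
  have ta := abs_le_TV (fun l => (u l).a1) ht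
  have tb := abs_le_TV (fun l => (u l).b1) ht
  have tc := abs_le_TV (fun l => (u l).b2) ht
  have td := TV_nonneg (fun l => (u l).a2) t1 t2
  have hb := fun i j (a : t1 ≤ i) (b : i ≤ j) (c : j ≤ t2) => abs_le_TV (fun l => (u l).b2) b
  rw [sum_cost_TV]
  by_cases hV : TV (fun l => (u l).b2) t1 t2 <
    |(u t1).b2 - (max (u t1).b2 (u t2).b2 - 1)| + |(u t2).b2 - (max (u t1).b2 (u t2).b2 - 1)|
  · -- clip
    have hd : ∀ i j, t1 ≤ i → i ≤ t2 → t1 ≤ j → j ≤ t2 → |(u i).b2 - (u j).b2| ≤ 1 := by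
      have key : ∀ i j, t1 ≤ i → i ≤ j → j ≤ t2 → |(u i).b2 - (u j).b2| ≤ 1 := by
        intro i j a b c
        have q1 := abs_le_TV (fun l => (u l).b2) a
        have q2 := abs_le_TV (fun l => (u l).b2) b
        have q3 := abs_le_TV (fun l => (u l).b2) c
        have q4 := TV_add (fun l => (u l).b2) a b
        have q5 := TV_add (fun l => (u l).b2) (a.trans b) c
        grind
      intro i j a b c d
      rcases le_total i j with hij | hij
      · exact key i j a hij d
      · rw [abs_sub_comm]; exact key j i c hij b
    have cl := fun (c p : ℝ) (cX : c ∈ E.X) (pX : p ∈ E.X) (hF : E.F p h) (hpc : p + 1 ≤ c) h1 h2 =>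
      clip (E := E) (x := fun l => (u l).b1) (y := fun l => (u l).b2) ht
      (fun i _ h2 => w.rb i (by omega)) (fun i _ h2 => (w.1 i (by omega)).xb)
      (fun i _ h2 => (w.1 i (by omega)).yb) hd cX pX (hA t1 le_rfl ht ▸ g1.ya) hF g1.fb hpc h1 h2
    rcases le_total (u t1).b1 (u t2).b1 with hc | hc
    · obtain ⟨d, f, hd'⟩ := cl (u t1).b1 (u t1).a1 g1.xb g1.xa hp.left s1 le_rfl hc
      rw [← e1] at f
      refine ⟨_, f.trans (FW.step f.rev.choose_spec.gridL g2 ?_ (RM.refl g2.fb) (Or.inl ⟨by simp only; linarith, s2⟩)), ?_⟩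
      · exact Or.inl ⟨(hA t2 ht le_rfl).symm, hp⟩
      · simp only [cost, sub_self, abs_zero, hA t2 ht le_rfl]; linarith
    · obtain ⟨d, f, hd'⟩ := cl (u t2).b1 (u t2).a1 g2.xb g2.xa hp.right s2 hc le_rfl
      rw [← e2] at f
      refine ⟨_, (FW.step g1 f.choose_spec.gridL ?_ (RM.refl g1.fb) (Or.inl ⟨s1, by simp only; linarith⟩)).trans f, ?_⟩
      · exact Or.inl ⟨hA t1 le_rfl ht, by rw [hA t1 le_rfl ht]; exact hp⟩
      · simp only [cost, sub_self, abs_zero, hA t1 le_rfl ht]; linarith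
  · push Not at hV
    rw [e1] at g1
    rw [e2] at g2
    rw [e1, e2]
    by_cases i1 : HSeg E.F h (u t1).a1 (u t1).b1
    · exact ⟨_, aa_via g1 g2 s1 s2 hp i1 n1 n2 p2X (hp.trans hp2) hx2 (by linarith), by linarith⟩
    by_cases i2 : HSeg E.F h (u t2).a1 (u t2).b1
    · refine ⟨_, (aa_via g2 g1 s2 s1 hp.symm i2 n2 n1 p1X (hp.symm.trans hp1) hx1 (by linarith)).rev, ?_⟩
      rw [max_comm, abs_sub_comm (u t2).a1, abs_sub_comm (u t2).b1]; linarith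
    have hdc : cost ⟨(u t1).a1, h, (u t1).b1, (u t1).b2⟩ ⟨(u t2).a1, h, (u t2).b1, (u t2).b2⟩ ≤
       TV (fun l => (u l).a1) t1 t2 + TV (fun l => (u l).a2) t1 t2 + TV (fun l => (u l).b1) t1 t2 +
      TV (fun l => (u l).b2) t1 t2 := by
      simp only [cost, sub_self, abs_zero] at *; linarith
    have ne1 : x1' ≠ (u t1).b1 := fun hc => i1 ((HSeg.refl hp.left).mid hp1 (mem_uIcc_of (by linarith) (by linarith)))
    have ne2 : x2' ≠ (u t2).b1 := fun hc => i2 ((HSeg.refl hp.right).mid hp2 (mem_uIcc_of (by linarith) (by linarith)))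
    rcases le_total (u t1).b1 (u t2).b1 with hc | hc
    · exact ⟨_, aa_out g1 g2 s1 s2 hp n1 n2 i1 hc hx1 ne1 (hp.trans hp2) hx2 (by linarith), hdc⟩
    · refine ⟨_, (aa_out g2 g1 s2 s1 hp.symm n2 n1 i2 hc hx2 ne2 (hp.symm.trans hp1) hx1 (by linarith)).rev, ?_⟩
      rwa [cost_comm]

theorem AA_right {n u} (o : Opt3 E n u) {i j k l : ℕ} (w : Win n u i j) (w' : Win n u k l) (hik : i < k)
    (hA : ∀ m, i ≤ m → m ≤ l → (u m).a2 = (u i).a2) (n1 : near E (u i).a2 (u i).b2)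
    (n2 : near E (u k).a2 (u k).b2) (hr : (u i).a1 + 1 ≤ (u i).b1) : False := by
  have hjk := w.sep w' hik
  have q1 := w.lt
  have q2 := w'.lt
  have q3 := w'.ltn
  have hj : (u j).b1 + 1 ≤ (u j).a1 := by
    rcases w.side with h | h
    · exact h.2
    · linarith [h.1]
  obtain ⟨s, t, h1, h2, h3, h4, h5, h6⟩ := w'.ends
  rw [hA k hik.le q2.le] at n2
  have hs : (u s).b2 = (u k).b2 := w'.hb s h1 h2
  have hw := o.walk
  obtain ⟨d, f, hd⟩ := aa_core hw (t1 := i) (t2 := s) (h := (u i).a2) (by omega) (by omega)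
    (fun m a b => hA m (by omega) (by omega)) hr h5 n1 (by rw [hs]; exact n2)
    (p1' := (u j).a1) (x1' := (u j).b1) (p2' := (u t).a1) (x2' := (u t).b1)
    (hw.1 j (by omega)).xa (hw.1 t (by omega)).xa
    (rowA' hw (i := i) (j := l) (by omega) hA (by omega) (by omega) (by omega) (by omega))
    (rowB' hw (i := i) (j := j) (by omega) w.hb (by omega) (by omega) (by omega) (by omega)) hj
    (rowA' hw (i := i) (j := l) (by omega) hA (by omega) (by omega) (by omega) (by omega))
    (by rw [hs]; exact rowB' hw (i := k) (j := l) (by omega) w'.hb (by omega) (by omega) (by omega) (by omega)) h6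
  exact o.exF (l := i) le_rfl (by omega) (by omega) (w.k i le_rfl w.lt) f hd

/-- at most one near-above contact on a plateau of A -/
theorem AA {n u} (o : Opt3 E n u) {i j k l : ℕ} (w : Win n u i j) (w' : Win n u k l) (hik : i < k)
    (hA : ∀ m, i ≤ m → m ≤ l → (u m).a2 = (u i).a2) (n1 : near E (u i).a2 (u i).b2)
    (n2 : near E (u k).a2 (u k).b2) : False := by
  rcases w.side with h | h
  · exact AA_right o w w' hik hA n1 n2 h.1
  · exact AA_right ((symm_fx E).opt3 o) w.fx w'.fx hik hA n1 n2 (by simp; linarith [h.1])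

/-- at most one near-below contact on a plateau of A -/
theorem BB {n u} (o : Opt3 E n u) {i j k l : ℕ} (w : Win n u i j) (w' : Win n u k l) (hik : i < k)
    (hA : ∀ m, i ≤ m → m ≤ l → (u m).a2 = (u i).a2) (n1 : near E (u i).b2 (u i).a2)
    (n2 : near E (u k).b2 (u k).a2) : False :=
  AA ((symm_fy E).opt3 o) w.fy w'.fy hik (fun m a b => by simpa using hA m a b) (near_fy.2 n1) (near_fy.2 n2)

theorem AB_right {n u} (o : Opt3 E n u) {i j k l : ℕ} (w : Win n u i j) (w' : Win n u k l) (hik : i < k)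
    (hA : ∀ m, i ≤ m → m ≤ l → (u m).a2 = (u i).a2) (n1 : near E (u i).b2 (u i).a2)
    (n2 : near E (u k).a2 (u k).b2)
    (hI : ∀ m, k ≤ m → m ≤ l → HSeg E.F (u i).a2 (u m).a1 (u m).b1)
    (hr : (u i).a1 + 1 ≤ (u i).b1) : False := by
  have hjk := w.sep w' hik
  have q1 := w.lt
  have q2 := w'.lt
  have q3 := w'.ltn
  have hj : (u j).b1 + 1 ≤ (u j).a1 := by
    rcases w.side with h | h
    · exact h.2
    · linarith [h.1]
  obtain ⟨s, t, h1, h2, h3, h4, h5, h6⟩ := w'.ends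
  have hs : (u s).b2 = (u k).b2 := w'.hb s h1 h2
  rw [hA k hik.le q2.le, ← hs] at n2
  have hw := o.walk
  have e1 : u i = ⟨(u i).a1, (u i).a2, (u i).b1, (u i).b2⟩ := rfl
  have e2 : u s = ⟨(u s).a1, (u i).a2, (u s).b1, (u s).b2⟩ := by rw [← hA s (by omega) (by omega)]
  have g1 := hw.1 i (by omega)
  have g2 := hw.1 s (by omega)
  rw [e2] at g2
  have hne : (u s).a1 ≠ (u s).b1 := by linarith
  have hx := hI s h1 h2
  have hz : ∀ z, HSeg E.F (u i).a2 (u s).a1 z → ∃ x x', x ≠ x' ∧ HSeg E.F (u i).a2 x x' ∧ z ∈ uIcc x x' := by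
    intro z h
    by_cases hc : (u s).a1 = z
    · exact ⟨_, _, hne, hx, hc ▸ left_mem_uIcc⟩
    · exact ⟨_, _, hc, h, right_mem_uIcc⟩
  have hrow := fun a b (h1 : i ≤ a) (h2 : a ≤ l) (h3 : i ≤ b) (h4 : b ≤ l) =>
    rowA' hw (i := i) (j := l) (s := a) (t := b) (by omega) hA h1 h2 h3 h4
  have f := via (E := E) g2 g1 (y0 := (u i).a2) h5 hr (hrow s i (by omega) (by omega) (by omega) (by omega)) hx
    g1.ya (fun z h hF => by
      obtain ⟨x, x', a, b, c⟩ := hz z h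
      exact (near_up n2 a b c hF).symm)
    (fun z h hF => by
      obtain ⟨x, x', a, b, c⟩ := hz z h
      exact near_dn n1 a b c hF) (fun z z' h h' => h.symm.trans h')
    (p' := (u j).a1) (x' := (u j).b1) (hw.1 j (by omega)).xa
    (hrow s j (by omega) (by omega) (by omega) (by omega))
    (rowB' hw (i := i) (j := j) (by omega) w.hb (by omega) (by omega) (by omega) (by omega)) (by linarith)
  have f' := f.rev
  rw [← e2, ← e1] at f'
  refine o.exF (l := i) le_rfl (show i < s by omega) (by omega) (w.k i le_rfl w.lt) f' ?_
  have := cost_le_sum u (show i ≤ s by omega)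
  refine le_trans ?_ this
  unfold cost
  rw [hA s (by omega) (by omega), abs_sub_comm (u s).a1, abs_sub_comm (u s).b1, ← abs_mid (a := (u i).b2) (m := (u i).a2) (b := (u s).b2)
    (mem_uIcc_of (by linarith [n1.1]) (by linarith [n2.1])), abs_sub_comm (u s).b2]
  simp only [sub_self, abs_zero]
  linarith

/-- contact from below, then from above with B over the row of A -/
theorem AB {n u} (o : Opt3 E n u) {i j k l : ℕ} (w : Win n u i j) (w' : Win n u k l) (hik : i < k)
    (hA : ∀ m, i ≤ m → m ≤ l → (u m).a2 = (u i).a2) (n1 : near E (u i).b2 (u i).a2)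
    (n2 : near E (u k).a2 (u k).b2)
    (hI : ∀ m, k ≤ m → m ≤ l → HSeg E.F (u i).a2 (u m).a1 (u m).b1) : False := by
  rcases w.side with h | h
  · exact AB_right o w w' hik hA n1 n2 hI h.1
  · exact AB_right ((symm_fx E).opt3 o) w.fx w'.fx hik hA n1 n2 (fun m a b => HSeg_fx.2 (by simpa using hI m a b))
      (by simp; linarith [h.1])

/-- contact from above with B over the row of A, then from below -/
theorem BA {n u} (o : Opt3 E n u) {i j k l : ℕ} (w : Win n u i j) (w' : Win n u k l) (hik : i < k)
    (hA : ∀ m, i ≤ m → m ≤ l → (u m).a2 = (u i).a2) (n1 : near E (u i).a2 (u i).b2)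
    (n2 : near E (u k).b2 (u k).a2)
    (hI : ∀ m, i ≤ m → m ≤ j → HSeg E.F (u i).a2 (u m).a1 (u m).b1) : False := by
  have hjk := w.sep w' hik
  have q1 := w.lt
  have q2 := w'.lt
  have q3 := w'.ltn
  have e1 : n - (n - l) = l := by omega
  have e2 : n - (n - j) = j := by omega
  refine AB o.rev w'.rev w.rev (by omega) ?_ ?_ ?_ ?_
  · intro m a b
    simp only [e1]
    rw [hA l (by omega) le_rfl]; exact hA _ (by omega) (by omega)
  · simp only [e1]; rw [w'.ha l q2.le le_rfl, w'.hb l q2.le le_rfl]; exact n2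
  · simp only [e2]; rw [w.ha j q1.le le_rfl, w.hb j q1.le le_rfl]; exact n1
  · intro m a b
    simp only [e1]
    rw [hA l (by omega) le_rfl]
    exact hI _ (by omega) (by omega)

end TR

namespace TR

variable {E : Env}

theorem noTBU_row {x x' y t m : ℝ} (hne : x ≠ x') (hs : HSeg E.F y x x') (ht : t ∈ uIcc x x')
    (hm : m ≤ y) (hv : VSeg E.F t m y) : ¬ TBU E t m := by
  rintro ⟨e, h1, h2, h3, h4⟩
  rcases lt_or_ge e y with h | h
  · exact h3 y h (hv.sub (mem_uIcc_of h1 h.le) right_mem_uIcc)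
  · obtain ⟨z, h5, h6⟩ := E.discU e
    have := E.rise x x' y z (by linarith) hne hs (fun b hb hh => by
      rcases le_or_gt b e with hc | hc
      · exact h4 b hb ⟨by linarith [hh.1], hc⟩
      · exact h6 b hb ⟨hc, hh.2⟩) t ht
    exact h3 z h5 (this.sub (mem_uIcc_of h h5.le) right_mem_uIcc)

theorem plateau {n : ℕ} {f : ℕ → ℝ} {g : ℝ} (h0 : f 0 ≠ g) (hn : f n ≠ g) {i0 : ℕ} (hi : i0 ≤ n) (hg : f i0 = g) :
    ∃ l r, l < i0 ∧ i0 ≤ r ∧ r < n ∧ (∀ i, l < i → i ≤ r → f i = g) ∧ f l ≠ g ∧ f (r + 1) ≠ g := by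
  classical
  have e1 : ∃ r, i0 ≤ r ∧ f (r + 1) ≠ g := by
    refine ⟨n - 1, ?_, ?_⟩
    · have : i0 ≠ n := by rintro rfl; exact hn hg
      omega
    · have : n ≠ 0 := by rintro rfl; exact hn (by rwa [show i0 = 0 by omega] at hg)
      rwa [show n - 1 + 1 = n by omega]
  have e2 : ∃ k, k ≤ i0 ∧ f (i0 - k) ≠ g := ⟨i0, le_rfl, by simpa using h0⟩
  have s1 := Nat.find_spec e1
  have s2 := Nat.find_spec e2
  have m1 := fun m (h : m < Nat.find e1) => Nat.find_min e1 h
  have m2 := fun m (h : m < Nat.find e2) => Nat.find_min e2 h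
  generalize Nat.find e1 = r at *
  generalize Nat.find e2 = k at *
  have hk : k ≠ 0 := by rintro rfl; exact s2.2 (by simpa using hg)
  refine ⟨i0 - k, r, by omega, s1.1, ?_, ?_, s2.2, s1.2⟩
  · by_contra hc
    have hne : i0 ≠ n := by rintro rfl; exact hn hg
    have := m1 (n - 1) (by omega)
    push Not at this
    have := this (by omega)
    rw [show n - 1 + 1 = n by omega] at this
    exact hn this
  · intro i h1 h2
    rcases lt_trichotomy i i0 with h | h | h
    · have := m2 (i0 - i) (by omega)
      push Not at this
      have := this (by omega)
      rwa [show i0 - (i0 - i) = i by omega] at this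
    · rw [h]; exact hg
    · have := m1 (i - 1) (by omega)
      push Not at this
      have := this (by omega)
      rwa [show i - 1 + 1 = i by omega] at this

theorem Win.con {n u i j} (w : Win n u i j) {m} (h1 : i ≤ m) (h2 : m ≤ j) : Con u n m := by
  have := w.lt
  have := w.ltn
  rcases Nat.eq_or_lt_of_le h2 with h | h
  · exact Or.inr ⟨m - 1, by omega, by omega, w.k _ (by omega) (by omega)⟩
  · exact Or.inl ⟨by omega, w.k m h1 h⟩

theorem Win.eq_end {n u i j j'} (w : Win n u i j) (w' : Win n u i j') : j = j' := by
  rcases lt_trichotomy j j' with h | h | h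
  · exact absurd (w'.k j w.lt.le h) w.kr
  · exact h
  · exact absurd (w.k j' w'.lt.le h) w'.kr

theorem unique_above {n u} (o : Opt3 E n u) {lo hi j1 j2 m : ℕ} {g : ℝ}
    (hA : ∀ i, lo ≤ i → i ≤ hi → (u i).a2 = g) (w : Win n u j1 j2) (h1 : lo ≤ j1) (h2 : j2 ≤ hi)
    (hn : near E g (u j1).b2) (hmn : m ≤ n) (m1 : lo ≤ m) (m2 : m ≤ hi) (hc : Con u n m)
    (hm : near E g (u m).b2) : j1 ≤ m ∧ m ≤ j2 := by
  have hg := hA m m1 m2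
  have hg1 := hA j1 h1 (by have := w.lt; omega)
  obtain ⟨i, r, a, b, w'⟩ := CW o hmn (by rw [hg]; exact hm) hc
  have hi : (u i).a2 = g := by rw [← hg, w'.ha m a b]
  have hn' : near E (u i).a2 (u i).b2 := by rw [hi, ← w'.hb m a b]; exact hm
  have q1 := w.lt
  have q2 := w'.lt
  rcases lt_trichotomy i j1 with h | h | h
  · refine (AA o w' w h (fun l l1 l2 => ?_) hn' (by rw [hg1]; exact hn)).elim
    rw [hi]
    have := w'.sep w h
    by_cases hl : l ≤ r
    · rw [w'.ha l l1 hl, hi]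
    · exact hA l (by omega) (by omega)
  · subst h
    have := w.eq_end w'
    omega
  · refine (AA o w w' h (fun l l1 l2 => ?_) (by rw [hg1]; exact hn) hn').elim
    rw [hg1]
    by_cases hl : i ≤ l
    · rw [w'.ha l hl l2, hi]
    · exact hA l (by omega) (by omega)

theorem Con_fy {u : ℕ → Cfg} {n i} (h : Con u n i) : Con (fun i => (u i).fy) n i := h
theorem Con_sw {u : ℕ → Cfg} {n i} (h : Con u n i) : Con (fun i => (u i).sw) n i := by
  rcases h with ⟨h, k⟩ | ⟨j, h1, h2, k⟩
  · exact Or.inl ⟨h, KK_sw.2 k⟩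
  · exact Or.inr ⟨j, h1, h2, KK_sw.2 k⟩

theorem unique_below {n u} (o : Opt3 E n u) {lo hi j1 j2 m : ℕ} {g : ℝ}
    (hA : ∀ i, lo ≤ i → i ≤ hi → (u i).a2 = g) (w : Win n u j1 j2) (h1 : lo ≤ j1) (h2 : j2 ≤ hi)
    (hn : near E (u j1).b2 g) (hmn : m ≤ n) (m1 : lo ≤ m) (m2 : m ≤ hi) (hc : Con u n m)
    (hm : near E (u m).b2 g) : j1 ≤ m ∧ m ≤ j2 :=
  unique_above (g := -g) ((symm_fy E).opt3 o) (fun i a b => by simpa using hA i a b) w.fy h1 h2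
    (near_fy.2 hn) hmn m1 m2 (Con_fy hc) (near_fy.2 hm)

theorem CW_below {n u} (h : Opt3 E n u) {j : ℕ} (hj : j ≤ n) (hn : near E (u j).b2 (u j).a2)
    (hc : Con u n j) : ∃ i r, i ≤ j ∧ j ≤ r ∧ Win n u i r := by
  obtain ⟨i, r, a, b, w⟩ := CW ((symm_sw E).opt3 h) hj hn (Con_sw hc)
  exact ⟨i, r, a, b, w.sw⟩

theorem no_below {n u} (o : Opt3 E n u) {lo hi j1 j2 m : ℕ} {g : ℝ}
    (hA : ∀ i, lo ≤ i → i ≤ hi → (u i).a2 = g) (w : Win n u j1 j2) (h1 : lo ≤ j1) (h2 : j2 ≤ hi)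
    (hn : near E g (u j1).b2) (hI : ∀ m, j1 ≤ m → m ≤ j2 → HSeg E.F g (u m).a1 (u m).b1)
    (hmn : m ≤ n) (m1 : lo ≤ m) (m2 : m ≤ hi) (hc : Con u n m)
    (hm : near E (u m).b2 g) : False := by
  have hg := hA m m1 m2
  have hg1 := hA j1 h1 (by have := w.lt; omega)
  obtain ⟨i, r, a, b, w'⟩ := CW_below o hmn (by rw [hg]; exact hm) hc
  have hi : (u i).a2 = g := by rw [← hg, w'.ha m a b]
  have hn' : near E (u i).b2 (u i).a2 := by rw [hi, ← w'.hb m a b]; exact hm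
  have q1 := w.lt
  have q2 := w'.lt
  rcases lt_trichotomy i j1 with h | h | h
  · refine (AB o w' w h (fun l l1 l2 => ?_) hn' (by rw [hg1]; exact hn) (by rw [hi]; exact hI)).elim
    rw [hi]
    have := w'.sep w h
    by_cases hl : l ≤ r
    · rw [w'.ha l l1 hl, hi]
    · exact hA l (by omega) (by omega)
  · subst h
    rw [hg1] at hn'
    linarith [hn'.1, hn.1]
  · refine (BA o w w' h (fun l l1 l2 => ?_) (by rw [hg1]; exact hn) hn' (by rw [hg1]; exact hI)).elim
    rw [hg1]
    by_cases hl : i ≤ l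
    · rw [w'.ha l hl l2, hi]
    · exact hA l (by omega) (by omega)

theorem nb.add1 {g g'} (a : nb E g g') : nb E (g + 1) (g' + 1) := by
  refine ⟨E.Yp _ a.1, E.Yp _ a.2.1, fun h => a.2.2.1 (by linarith), fun w hw => ⟨fun h => ?_, fun h => ?_⟩⟩
  · exact (a.2.2.2 (w - 1) (E.Ym _ hw)).1 ⟨by linarith, by linarith⟩
  · exact (a.2.2.2 (w - 1) (E.Ym _ hw)).2 ⟨by linarith, by linarith⟩

/-- Raising the A-plateau together with a piece of a B-plateau is impossible (plan prepared by stuttering). -/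
theorem move_pre {n u} (h : Opt3 E n u) {l r p q : ℕ} {g g' : ℝ} (hlr : l < r) (hrn : r < n)
    (hf : ∀ i, l < i → i ≤ r → (u i).a2 = g) (a : nb E g g') (hlt : g < g')
    (hB : g ∉ E.B) (hB1 : g - 1 ∉ E.B) (hB2 : g + 1 ∉ E.B)
    (hl : g < (u l).a2) (hr : g < (u (r + 1)).a2)
    (hlp : l ≤ p) (hpq : p < q) (hqr : q ≤ r) (hfb : ∀ i, p ≤ i → i ≤ q + 1 → (u i).b2 = g + 1)
    (hp : (u p).b1 = (u (p + 1)).b1) (hq : (u q).b1 = (u (q + 1)).b1)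
    (hva : VSeg E.F (u (p + 1)).a1 g g') (hvb : VSeg E.F (u (p + 1)).b1 (g + 1) (g' + 1))
    (hcon : ∀ i, l < i → i ≤ r → ¬ (p < i ∧ i ≤ q) → Con u n i → (u i).a2 + 1 ≤ (u i).b2 → ¬ near E g (u i).b2)
    (hconp : ¬ Con u n p) (hconq : ¬ Con u n (q + 1))
    (hc1 : Con u n (p + 1))
    (hUD : ∀ i, p < i → i ≤ q → Up E (u i).a1 g (u i).b1 (g + 1) ∧ ¬ Dn E (u i).a1 g (u i).b1 (g + 1)) : False := by
  have hw := h.walk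
  set α := ish (fun i => (u i).a2) l r g' with hα
  set β := ish (fun i => (u i).b2) p q (g' + 1) with hβ
  have la : (u l).a1 = (u (l + 1)).a1 :=
    ((hw.ra l (by omega)).vseg (by rw [hf (l + 1) (by omega) (by omega)]; exact hl.ne')).1
  have lr : (u r).a1 = (u (r + 1)).a1 :=
    ((hw.ra r (by omega)).vseg (by rw [hf r (by omega) (by omega)]; exact hr.ne)).1
  have ra : RSh E n (fun i => (u i).a1) (fun i => (u i).a2) α :=
    RSh.ish hw.ra hrn hf a hB (i0 := p + 1) (by omega) (by omega) hva la lr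
  have rb : RSh E n (fun i => (u i).b1) (fun i => (u i).b2) β :=
    RSh.ish hw.rb (by omega) (fun i h1 h2 => hfb i (by omega) (by omega)) a.add1 hB2
      (i0 := p + 1) (by omega) (by omega) hvb hp hq
  have αin : ∀ i, l < i → i ≤ r → α i = g' := fun i h1 h2 => by rw [hα, ish_in ⟨h1, h2⟩]
  have αout : ∀ i, ¬ (l < i ∧ i ≤ r) → α i = (u i).a2 := fun i h1 => by rw [hα, ish_out h1]
  have βin : ∀ i, p < i → i ≤ q → β i = g' + 1 := fun i h1 h2 => by rw [hβ, ish_in ⟨h1, h2⟩]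
  have βout : ∀ i, ¬ (p < i ∧ i ≤ q) → β i = (u i).b2 := fun i h1 => by rw [hβ, ish_out h1]
  -- tight contacts above only inside
  have tight : ∀ i ≤ n, l < i → i ≤ r → ¬ (p < i ∧ i ≤ q) → Con u n i → (u i).a2 + 1 ≤ (u i).b2 →
      g' + 1 ≤ (u i).b2 := by
    intro i hi h1 h2 h3 hc h4
    rw [hf i h1 h2] at h4
    rcases h4.eq_or_lt with h5 | h5
    · refine absurd ⟨h5.le, fun b hb => ?_⟩ (hcon i h1 h2 h3 hc (by rw [hf i h1 h2]; exact h5.le))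
      rw [← h5]
      constructor
      · intro hh
        have : b = g := by linarith [hh.1, hh.2]
        exact hB (this ▸ hb)
      · intro hh
        have : b = g + 1 := by linarith [hh.1, hh.2]
        exact hB2 (this ▸ hb)
    · have := a.le_of_lt hlt (E.Ym _ (hw.1 i hi).yb) (by linarith)
      linarith
  have ab : ∀ i ≤ n, Con u n i → (u i).a2 + 1 ≤ (u i).b2 → α i + 1 ≤ β i := by
    intro i hi hc h1
    by_cases h3 : p < i ∧ i ≤ q
    · rw [αin i (by omega) (by omega), βin i h3.1 h3.2]
    · rw [βout i h3]
      by_cases h2 : l < i ∧ i ≤ r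
      · rw [αin i h2.1 h2.2]; exact tight i hi h2.1 h2.2 h3 hc h1
      · rw [αout i h2]; exact h1
  have ba : ∀ i, (u i).b2 + 1 ≤ (u i).a2 → β i + 1 ≤ α i := by
    intro i h1
    by_cases h3 : p < i ∧ i ≤ q
    · rw [hf i (by omega) (by omega), hfb i (by omega) (by omega)] at h1; linarith
    · rw [βout i h3]
      by_cases h2 : l < i ∧ i ≤ r
      · rw [αin i h2.1 h2.2]; rw [hf i h2.1 h2.2] at h1; linarith
      · rw [αout i h2]; exact h1
  have sd : ShiftData E n u α β := by
    refine ra.toShift rb fun i hi hk => ?_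
    have c1 : Con u n i := Or.inl ⟨hi, hk⟩
    have c2 : Con u n (i + 1) := Or.inr ⟨i, rfl, hi, hk⟩
    rcases hw.ssy hi hk with ⟨h1, h2⟩ | ⟨h1, h2⟩
    · exact Or.inl ⟨ab i hi.le c1 h1, ab _ hi c2 h2⟩
    · exact Or.inr ⟨ba i h1, ba _ h2⟩
  have hord : ∀ i ≤ n, Con u n i → ((u i).a2 + 1 ≤ (u i).b2) ∨ ((u i).b2 + 1 ≤ (u i).a2) := by
    intro i hi hc
    rcases hc with ⟨h1, hk⟩ | ⟨j, rfl, h1, hk⟩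
    · exact (hw.ssy h1 hk).imp (fun h => h.1) (fun h => h.1)
    · exact (hw.ssy (by omega) hk).imp (fun h => h.2) (fun h => h.2)
  have hin : ∀ i, p < i → i ≤ q → val E (mkc u α β i) < val E (u i) := by
    intro i h1 h2
    have gr := hw.1 i (by omega)
    have e1 := hf i (by omega) (by omega)
    have e2 := hfb i (by omega) (by omega)
    have := val_shift1 gr.fa gr.fb (ra.g i (by omega)) (rb.g i (by omega)) (by rw [e1, e2])
      (by rw [αin i (by omega) (by omega), βin i h1 h2])
      (fun _ => by rw [e1]; exact ⟨hB, hB2⟩) (fun _ => by rw [e2]; simp; exact ⟨hB2, hB⟩)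
    have hn : near E g (g + 1) := by
      refine ⟨le_rfl, fun b hb => ⟨fun hh => ?_, fun hh => ?_⟩⟩
      · have : b = g := by linarith [hh.1, hh.2]
        exact hB (this ▸ hb)
      · have : b = g + 1 := by linarith [hh.1, hh.2]
        exact hB2 (this ▸ hb)
    have hud := hUD i h1 h2
    rw [e1, e2, αin i (by omega) (by omega), βin i h1 h2] at this
    have k1 : wL E (u i).a1 g (u i).b1 (g + 1) = 1 := by
      unfold wL; rw [if_pos hn, ind_false hud.2]; norm_num
    have k2 : wU E (u i).a1 g (u i).b1 (g + 1) = 2 := by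
      unfold wU; rw [if_pos hn, ind_true hud.1]; norm_num
    rw [k1, k2] at this
    simp only [mkc, αin i (show l < i by omega) (show i ≤ r by omega), βin i h1 h2]
    linarith
  refine sd.no h ?_ ?_ ⟨p + 1, by omega, hc1, hin _ (by omega) (by omega)⟩
  · rw [hα, hβ, dcost_ish n _ l r g g' hlr hrn hf, dcost_ish n _ p q (g + 1) (g' + 1) hpq (by omega)
      (fun i h1 h2 => hfb i (by omega) (by omega))]
    simp only [hfb p le_rfl (by omega), hfb (q + 1) (by omega) le_rfl]
    rw [a.absu hlt (hw.1 l (by omega)).ya hl, a.absu hlt (hw.1 (r + 1) (by omega)).ya hr]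
    simp only [sub_self, abs_zero, sub_zero]
    rw [abs_of_neg (by linarith)]; linarith
  · intro i hi hc
    by_cases h3 : p < i ∧ i ≤ q
    · exact (hin i h3.1 h3.2).le
    · by_cases h2 : l < i ∧ i ≤ r
      · have gr := hw.1 i hi
        have e1 := hf i h2.1 h2.2
        have e2 := αin i h2.1 h2.2
        have e3 := βout i h3
        rcases hord i hi hc with ho | ho
        · have := val_shift1 gr.fa gr.fb (ra.g i hi) (rb.g i hi) ho (ab i hi hc ho)
            (fun _ => by rw [e1]; exact ⟨hB, hB2⟩) (fun hh => absurd e3 hh)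
          rw [wL_zero (by rw [e1]; exact hcon i h2.1 h2.2 h3 hc ho), e3] at this
          simp only [mkc, e3]
          linarith
        · have := val_shift2 gr.fa gr.fb (ra.g i hi) (rb.g i hi) ho (ba i ho)
            (fun _ => by rw [e1]; exact ⟨hB, hB1⟩) (fun hh => absurd e3 hh)
          rw [e3] at this
          have w := wU_nonneg (E := E) (u i).b1 (u i).b2 (u i).a1 (u i).a2
          rw [e1, e2] at this
          simp only [mkc, e2, e3]
          rw [e1] at w
          nlinarith
      · rw [mkc_eq (αout i h2) (βout i h3)]

end TR

namespace TR

variable {E : Env}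

theorem near_tight {g : ℝ} (h1 : g ∉ E.B) (h2 : g + 1 ∉ E.B) : near E g (g + 1) := by
  refine ⟨le_rfl, fun b hb => ⟨fun hh => ?_, fun hh => ?_⟩⟩
  · have : b = g := by linarith [hh.1, hh.2]
    exact h1 (this ▸ hb)
  · have : b = g + 1 := by linarith [hh.1, hh.2]
    exact h2 (this ▸ hb)

theorem Win.xspl {n u i j} (w : Win n u i j) : XSp (u i) :=
  w.side.elim (fun h => Or.inl h.1) (fun h => Or.inr h.1)
theorem Win.xspr {n u i j} (w : Win n u i j) : XSp (u j) :=
  w.side.elim (fun h => Or.inr h.2) (fun h => Or.inl h.2)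

theorem move_b {n u} (h : Opt3 E n u) {l r j1 j2 : ℕ} {g g' : ℝ} (hrn : r < n)
    (hf : ∀ i, l < i → i ≤ r → (u i).a2 = g) (a : nb E g g') (hlt : g < g')
    (hB : g ∉ E.B) (hB1 : g - 1 ∉ E.B) (hB2 : g + 1 ∉ E.B)
    (hl : g < (u l).a2) (hr : g < (u (r + 1)).a2) (w : Win n u j1 j2) (hlj : l < j1) (hjr : j2 ≤ r)
    (hb : (u j1).b2 = g + 1)
    (hva : VSeg E.F (u j1).a1 g g') (hvb : VSeg E.F (u j1).b1 (g + 1) (g' + 1))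
    (hUD : ∀ i, j1 ≤ i → i ≤ j2 → Up E (u i).a1 g (u i).b1 (g + 1) ∧ ¬ Dn E (u i).a1 g (u i).b1 (g + 1)) :
    False := by
  have q := w.lt
  have hnr : near E g (g + 1) := near_tight hB hB2
  have o1 := h.stut (r := j1) (by omega) w.xspl
  have e1 : stut j1 u (j2 + 1) = u j2 := by rw [stut_gt (by omega)]; rfl
  have o2 := o1.stut (r := j2 + 1) (by omega) (by rw [e1]; exact w.xspr)
  set v := stut (j2 + 1) (stut j1 u) with hv
  have va : ∀ i, i ≤ j1 → v i = u i := fun i hi => by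
    rw [hv, stut_le (by omega), stut_le hi]
  have vb : ∀ i, j1 < i → i ≤ j2 + 1 → v i = u (i - 1) := fun i hi hi' => by
    rw [hv, stut_le (by omega), stut_gt hi]
  have vc : ∀ i, j2 + 1 < i → v i = u (i - 2) := fun i hi => by
    rw [hv, stut_gt (by omega), stut_gt (by omega)]; rfl
  have ka : ∀ i, i < j1 → (KK v i ↔ KK u i) := fun i hi => by
    rw [hv, KK_stut_lt (by omega), KK_stut_lt hi]
  have ka' : ¬ KK v j1 := by
    rw [hv, KK_stut_lt (by omega)]; exact KK_stut_eq _ w.xspl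
  have kc' : ¬ KK v (j2 + 1) := KK_stut_eq _ (by rw [e1]; exact w.xspr)
  have kc : ∀ i, j2 + 1 < i → (KK v i ↔ KK u (i - 2)) := fun i hi => by
    rw [hv, KK_stut_gt hi, KK_stut_gt (by omega)]; rfl
  have hbw : ∀ i, j1 ≤ i → i ≤ j2 → (u i).b2 = g + 1 := fun i h1 h2 => by rw [w.hb i h1 h2, hb]
  refine move_pre o2 (l := l) (r := r + 2) (p := j1) (q := j2 + 1) (g := g) (g' := g') (by omega) (by omega)
    ?_ a hlt hB hB1 hB2 ?_ ?_ hlj.le (by omega) (by omega) ?_ ?_ ?_ ?_ ?_ ?_ ?_ ?_ ?_ ?_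
  · intro i h1 h2
    rcases le_or_gt i j1 with h3 | h3
    · rw [va i h3]; exact hf i h1 (by omega)
    · rcases le_or_gt i (j2 + 1) with h4 | h4
      · rw [vb i h3 h4]; exact hf _ (by omega) (by omega)
      · rw [vc i h4]; exact hf _ (by omega) (by omega)
  · rw [va l hlj.le]; exact hl
  · rw [vc _ (by omega)]; exact hr
  · intro i h1 h2
    rcases le_or_gt i j1 with h3 | h3
    · rw [va i h3]; exact hbw i h1 (by omega)
    · rcases le_or_gt i (j2 + 1) with h4 | h4
      · rw [vb i h3 h4]; exact hbw _ (by omega) (by omega)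
      · rw [vc i h4]; exact hbw _ (by omega) (by omega)
  · rw [va _ le_rfl, vb _ (by omega) (by omega)]; rfl
  · rw [vb _ (by omega) le_rfl, vc _ (by omega)]; rfl
  · rw [vb _ (by omega) (by omega)]; exact hva
  · rw [vb _ (by omega) (by omega)]; exact hvb
  · intro i h1 h2 h3 hc _ hn
    rcases le_or_gt i j1 with h4 | h4
    · rw [va i h4] at hn
      have hc' : Con u n i ∧ i < j1 := by
        rcases hc with ⟨_, hk⟩ | ⟨j, rfl, _, hk⟩
        · rcases h4.eq_or_lt with h5 | h5
          · exact absurd (h5 ▸ hk) ka'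
          · exact ⟨Or.inl ⟨by omega, (ka i h5).1 hk⟩, h5⟩
        · have hk' := (ka j (by omega)).1 hk
          refine ⟨Or.inr ⟨j, rfl, by omega, hk'⟩, ?_⟩
          by_contra h6
          exact w.kl (by rwa [show j1 - 1 = j by omega])
      have := (unique_above h (lo := l + 1) (hi := r) (g := g) (fun i a b => hf i (by omega) b) w (by omega) hjr
        (by rw [hb]; exact hnr) (by omega) (by omega) (by omega) hc'.1 hn).1
      omega
    · have h5 : j2 + 1 < i := by omega
      rw [vc i h5] at hn
      have hc' : Con u n (i - 2) ∧ j2 + 2 < i := by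
        rcases hc with ⟨_, hk⟩ | ⟨j, rfl, _, hk⟩
        · have hk' := (kc i h5).1 hk
          refine ⟨Or.inl ⟨by omega, hk'⟩, ?_⟩
          by_contra h6
          exact w.kr (by rwa [show j2 = i - 2 by omega])
        · rcases Nat.eq_or_lt_of_le (show j2 + 1 ≤ j by omega) with h6 | h6
          · exact absurd (h6 ▸ hk) kc'
          · exact ⟨Or.inr ⟨j - 2, by omega, by omega, (kc j h6).1 hk⟩, by omega⟩
      have := (unique_above h (lo := l + 1) (hi := r) (g := g) (fun i a b => hf i (by omega) b) w (by omega) hjr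
        (by rw [hb]; exact hnr) (by omega) (by omega) (by omega) hc'.1 hn).2
      omega
  · rintro (⟨_, hk⟩ | ⟨j, hj, _, hk⟩)
    · exact ka' hk
    · exact w.kl (by rw [show j1 - 1 = j by omega]; exact (ka j (by omega)).1 hk)
  · rintro (⟨_, hk⟩ | ⟨j, hj, _, hk⟩)
    · exact w.kr ((kc _ (by omega)).1 hk)
    · exact kc' (by rwa [show j2 + 1 = j by omega])
  · refine Or.inl ⟨by omega, ?_⟩
    have := w.k j1 le_rfl q
    unfold KK at this ⊢
    rwa [vb _ (by omega) (by omega), vb _ (by omega) (by omega)]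
  · intro i h1 h2
    rw [vb i h1 h2]; exact hUD _ (by omega) (by omega)

/-- B passes from below to above of the plateau of A, on the right at both times. -/
theorem pass_right {n u} (o : Opt3 E n u) {i j k l s t : ℕ} (w : Win n u i j) (w' : Win n u k l) (hik : i < k)
    (hA : ∀ m, i ≤ m → m ≤ l → (u m).a2 = (u i).a2) (n1 : near E (u i).b2 (u i).a2)
    (n2 : near E (u k).a2 (u k).b2) (h1 : k ≤ t) (h2 : t ≤ l) (h3 : i ≤ s) (h4 : s ≤ j)
    (hst : s < j ∨ k < t) (hr : (u s).a1 + 1 ≤ (u s).b1) (h5 : (u t).a1 + 1 ≤ (u t).b1)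
    (hx : HSeg E.F (u i).a2 (u t).a1 (u t).b1) : False := by
  have hjk := w.sep w' hik
  have q1 := w.lt
  have q2 := w'.lt
  have q3 := w'.ltn
  obtain ⟨_, s', _, _, h6, h7, _, hj⟩ := w.ends
  have ht : (u t).b2 = (u k).b2 := w'.hb t h1 h2
  have hs : (u s).b2 = (u i).b2 := w.hb s h3 h4
  rw [hA k hik.le q2.le, ← ht] at n2
  rw [← hs] at n1
  have hw := o.walk
  have e1 : u s = ⟨(u s).a1, (u i).a2, (u s).b1, (u s).b2⟩ := by rw [← hA s (by omega) (by omega)]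
  have e2 : u t = ⟨(u t).a1, (u i).a2, (u t).b1, (u t).b2⟩ := by rw [← hA t (by omega) (by omega)]
  have g1 := hw.1 s (by omega)
  have g2 := hw.1 t (by omega)
  have giy : (u i).a2 ∈ E.Y := (hw.1 i (by omega)).ya
  rw [e1] at g1
  rw [e2] at g2
  have hne : (u t).a1 ≠ (u t).b1 := by linarith
  have hz : ∀ z, HSeg E.F (u i).a2 (u t).a1 z → ∃ x x', x ≠ x' ∧ HSeg E.F (u i).a2 x x' ∧ z ∈ uIcc x x' := by
    intro z h
    by_cases hc : (u t).a1 = z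
    · exact ⟨_, _, hne, hx, hc ▸ left_mem_uIcc⟩
    · exact ⟨_, _, hc, h, right_mem_uIcc⟩
  have hrow := fun a b (h1 : i ≤ a) (h2 : a ≤ l) (h3 : i ≤ b) (h4 : b ≤ l) =>
    rowA' hw (i := i) (j := l) (s := a) (t := b) (by omega) hA h1 h2 h3 h4
  have f := via (E := E) g2 g1 (y0 := (u i).a2) h5 hr (hrow t s (by omega) (by omega) (by omega) (by omega)) hx
    giy (fun z h hF => by
      obtain ⟨x, x', a, b, c⟩ := hz z h
      exact (near_up n2 a b c hF).symm)
    (fun z h hF => by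
      obtain ⟨x, x', a, b, c⟩ := hz z h
      exact near_dn n1 a b c hF) (fun z z' h h' => h.symm.trans h')
    (p' := (u s').a1) (x' := (u s').b1) (hw.1 s' (by omega)).xa
    (hrow t s' (by omega) (by omega) (by omega) (by omega))
    (rowB' hw (i := i) (j := j) (by omega) (fun m a b => by rw [w.hb m a b, hs]) (by omega) (by omega) (by omega) (by omega)) (by linarith)
  have f' := f.rev
  rw [← e2, ← e1] at f'
  have hc : |(u t).a1 - (u s).a1| + |(u t).b1 - (u s).b1| +
      (|(u t).b2 - (u i).a2| + |(u s).b2 - (u i).a2|) ≤ ∑ l ∈ Finset.Ico s t, cost (u l) (u (l + 1)) := by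
    have := cost_le_sum u (show s ≤ t by omega)
    refine le_trans ?_ this
    unfold cost
    rw [hA s (by omega) (by omega), hA t (by omega) (by omega), abs_sub_comm (u t).a1, abs_sub_comm (u t).b1,
      ← abs_mid (a := (u s).b2) (m := (u i).a2) (b := (u t).b2)
      (mem_uIcc_of (by linarith [n1.1]) (by linarith [n2.1])), abs_sub_comm (u t).b2]
    simp only [sub_self, abs_zero]
    linarith
  rcases hst with h | h
  · exact o.exF (l := s) le_rfl (show s < t by omega) (by omega) (w.k s h3 h) f' hc
  · exact o.exF (l := k) (by omega) h (by omega) (w'.k k le_rfl w'.lt) f' hc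

theorem pass_right' {n u} (o : Opt3 E n u) {i j k l s t : ℕ} (w : Win n u i j) (w' : Win n u k l) (hik : i < k)
    (hA : ∀ m, i ≤ m → m ≤ l → (u m).a2 = (u i).a2) (n1 : near E (u i).b2 (u i).a2)
    (n2 : near E (u k).a2 (u k).b2) (h1 : k ≤ t) (h2 : t ≤ l) (h3 : i ≤ s) (h4 : s ≤ j)
    (hst : s < j ∨ k < t) (hr : (u s).a1 + 1 ≤ (u s).b1) (h5 : (u t).a1 + 1 ≤ (u t).b1)
    (hx : HSeg E.F (u i).a2 (u s).a1 (u s).b1) : False := by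
  have q1 := w.lt
  have q2 := w'.lt
  have q3 := w'.ltn
  have hjk := w.sep w' hik
  have hll := hA l (by omega) le_rfl
  have hm : ∀ m, m ≤ n → n - (n - m) = m := fun m hm => by omega
  refine pass_right (E := E.fy) (((symm_fy E).opt3 o.rev)) (s := n - t) (t := n - s) w'.rev.fy w.rev.fy
    (by omega) ?_ ?_ ?_ (by omega) (by omega) (by omega) (by omega) (by omega) ?_ ?_ ?_
  · intro m a b
    simp only [Cfg.fy_a2, hm l q3.le, hll, hA (n - m) (by omega) (by omega)]
  · simp only [Cfg.fy_a2, Cfg.fy_b2, hm l q3.le, near_fy]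
    rw [hll, w'.hb l q2.le le_rfl, ← hA k hik.le q2.le]; exact n2
  · simp only [Cfg.fy_a2, Cfg.fy_b2, hm j (show j ≤ n by omega), near_fy]
    rw [w.ha j q1.le le_rfl, w.hb j q1.le le_rfl]; exact n1
  · simp only [Cfg.fy_a1, Cfg.fy_b1, hm t (show t ≤ n by omega)]; exact h5
  · simp only [Cfg.fy_a1, Cfg.fy_b1, hm s (show s ≤ n by omega)]; exact hr
  · simp only [Cfg.fy_a1, Cfg.fy_b1, Cfg.fy_a2, hm s (show s ≤ n by omega), hm l q3.le]
    rw [hll]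
    exact HSeg_fy.2 (by simpa using hx)

theorem pass_left {n u} (o : Opt3 E n u) {i j k l s t : ℕ} (w : Win n u i j) (w' : Win n u k l) (hik : i < k)
    (hA : ∀ m, i ≤ m → m ≤ l → (u m).a2 = (u i).a2) (n1 : near E (u i).b2 (u i).a2)
    (n2 : near E (u k).a2 (u k).b2) (h1 : k ≤ t) (h2 : t ≤ l) (h3 : i ≤ s) (h4 : s ≤ j)
    (hst : s < j ∨ k < t) (hr : (u s).b1 + 1 ≤ (u s).a1) (h5 : (u t).b1 + 1 ≤ (u t).a1)
    (hx : HSeg E.F (u i).a2 (u s).a1 (u s).b1) : False :=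
  pass_right' (E := E.fx) ((symm_fx E).opt3 o) (s := s) (t := t) w.fx w'.fx hik hA n1 n2 h1 h2 h3 h4 hst
    (by simp only [Cfg.fx_a1, Cfg.fx_b1]; linarith)
    (by simp only [Cfg.fx_a1, Cfg.fx_b1]; linarith)
    (HSeg_fx.2 (by simpa using hx))

end TR

namespace TR

variable {E : Env}

theorem swap_no {n u} (o : Opt3 E n u) {i j k l : ℕ} {h : ℝ} (hi : i < j) (hj : j ≤ k) (hk : k ≤ l) (hl : l ≤ n)
    (hA : ∀ m, i ≤ m → m ≤ l → (u m).a2 = h)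
    (hb1 : ∀ m, i ≤ m → m ≤ j → (u m).b2 = h - 1) (hb2 : ∀ m, k ≤ m → m ≤ l → (u m).b2 = h + 1)
    (s1 : (u i).a1 + 1 ≤ (u i).b1) (s2 : (u j).b1 + 1 ≤ (u j).a1)
    (s3 : (u k).b1 + 1 ≤ (u k).a1) (s4 : (u l).a1 + 1 ≤ (u l).b1)
    (n1 : ¬ HSeg E.F h (u i).a1 (u i).b1) (n2 : ¬ HSeg E.F h (u l).a1 (u l).b1)
    (hx : HSeg E.F h (u j).a1 (u j).b1) (hK : KK u i) : False := by
  have hw := o.walk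
  have hrow := fun a b (h1 : i ≤ a) (h2 : a ≤ l) (h3 : i ≤ b) (h4 : b ≤ l) =>
    rowA' hw (i := i) (j := l) (s := a) (t := b) (by omega) hA h1 h2 h3 h4
  have r1 := rowB' hw (i := i) (j := j) (s := j) (t := i) (by omega) hb1 (by omega) (by omega) (by omega) (by omega)
  have r2 := rowB' hw (i := k) (j := l) (s := k) (t := l) (by omega) hb2 (by omega) (by omega) (by omega) (by omega)
  have lt1 : ∀ p, HSeg E.F h (u i).a1 p → p < (u i).b1 := fun p hp => by
    by_contra hc
    exact n1 (hp.sub left_mem_uIcc (mem_uIcc_of (by linarith) (by linarith)))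
  have lt2 : ∀ p, HSeg E.F h (u l).a1 p → p < (u l).b1 := fun p hp => by
    by_contra hc
    exact n2 (hp.sub left_mem_uIcc (mem_uIcc_of (by linarith) (by linarith)))
  have a1 := lt1 _ (hrow i j (by omega) (by omega) (by omega) (by omega))
  have a2 := lt1 _ (hrow i k (by omega) (by omega) (by omega) (by omega))
  have a3 := lt2 _ (hrow l j (by omega) (by omega) (by omega) (by omega))
  have a4 := lt2 _ (hrow l k (by omega) (by omega) (by omega) (by omega))
  set z := max (u j).a1 (u k).b1 with hz
  have z1 : (u j).a1 ≤ z := le_max_left _ _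
  have z2 : (u k).b1 ≤ z := le_max_right _ _
  have hzJ : HSeg E.F h (u j).a1 z := by
    rcases max_choice (u j).a1 (u k).b1 with hc | hc
    · rw [hz, hc]; exact HSeg.refl hx.left
    · rw [hz, hc]
      exact (hrow j k (by omega) (by omega) (by omega) (by omega)).sub left_mem_uIcc
        (mem_uIcc_of (by rw [← hc, ← hz]; exact z1) (by linarith))
  have z3 : z < (u i).b1 := max_lt a1 (by linarith)
  have z4 : z < (u l).b1 := max_lt a3 (by linarith)
  have zX : z ∈ E.X := by
    rcases max_choice (u j).a1 (u k).b1 with hc | hc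
    · rw [hz, hc]; exact (hw.1 j (by omega)).xa
    · rw [hz, hc]; exact (hw.1 k (by omega)).xb
  have hx1 : HSeg E.F (h - 1) (u i).b1 z := (r1.sub (right_mem_uIcc) (mem_uIcc_of (by linarith) z3.le))
  have hx2 : HSeg E.F (h + 1) z (u l).b1 := (r2.sub (mem_uIcc_of z2 z4.le) (right_mem_uIcc))
  have hv : VSeg E.F z (h - 1) (h + 1) :=
    (E.gap z (h - 1) h hx1.right hzJ.right (by rw [abs_le]; constructor <;> linarith)).trans
    (E.gap z h (h + 1) hzJ.right hx2.left (by rw [abs_le]; constructor <;> linarith))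
  have e1 : u i = ⟨(u i).a1, h, (u i).b1, h - 1⟩ := Cfg.ext rfl (hA i (by omega) (by omega)) rfl (hb1 i (by omega) (by omega))
  have e2 : u l = ⟨(u l).a1, h, (u l).b1, h + 1⟩ := Cfg.ext rfl (hA l (by omega) (by omega)) rfl (hb2 l (by omega) (by omega))
  have gi := hw.1 i (by omega)
  have gl := hw.1 l (by omega)
  have gj := hw.1 j (by omega)
  rw [e1] at gi
  rw [e2] at gl
  have ma : HSeg E.F h (u i).a1 (u j).b1 := (hrow i j (by omega) (by omega) (by omega) (by omega)).trans hx
  have mb : HSeg E.F h (u j).b1 (u l).a1 := hx.symm.trans (hrow j l (by omega) (by omega) (by omega) (by omega))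
  have c1 : Grid E ⟨(u j).b1, h, z, h - 1⟩ := ⟨ma.right, hx1.right, gj.xb, zX, gi.ya, gi.yb⟩
  have c2 : Grid E ⟨(u j).b1, h, z, h + 1⟩ := ⟨ma.right, hx2.left, gj.xb, zX, gi.ya, gl.yb⟩
  have f1 := FW.step gi c1 (Or.inl ⟨rfl, ma⟩) (Or.inl ⟨rfl, hx1⟩) (Or.inl ⟨s1, by dsimp only; linarith⟩)
  have f2 := FW.step c1 c2 (RM.refl ma.right) (Or.inr ⟨rfl, hv⟩) (Or.inl ⟨by dsimp only; linarith, by dsimp only; linarith⟩)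
  have f3 := FW.step c2 gl (Or.inl ⟨rfl, mb⟩) (Or.inl ⟨rfl, hx2⟩) (Or.inl ⟨by dsimp only; linarith, s4⟩)
  have f := (f1.trans f2).trans f3
  rw [← e1, ← e2] at f
  refine o.exF (l := i) le_rfl (show i < l by omega) (by omega) hK f ?_
  have t1 := cost_le_sum u hi.le
  have t2 := cost_le_sum u hj
  have t3 := cost_le_sum u hk
  rw [← Finset.sum_Ico_consecutive _ (show i ≤ j by omega) (show j ≤ l by omega),
    ← Finset.sum_Ico_consecutive _ hj hk]
  refine le_trans ?_ (add_le_add t1 (add_le_add t2 t3))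
  unfold cost
  simp only [hA i (by omega) (by omega), hA j (by omega) (by omega), hA k (by omega) (by omega), hA l (by omega) (by omega),
    hb1 i (by omega) (by omega), hb1 j (by omega) (by omega), hb2 k (by omega) (by omega), hb2 l (by omega) (by omega)]
  simp only [sub_self, abs_zero]
  rw [abs_of_pos (show 0 < (u i).b1 - z by linarith), abs_of_neg (show z - (u l).b1 < 0 by linarith),
    abs_of_pos (show 0 < (u i).b1 - (u j).b1 by linarith), abs_of_neg (show (u k).b1 - (u l).b1 < 0 by linarith)]
  have d1 := abs_sub_le (u i).a1 (u j).a1 (u j).b1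
  have d2 := abs_sub_le (u j).b1 (u j).a1 (u l).a1
  have d3 := abs_sub_le (u j).a1 (u k).a1 (u l).a1
  rw [abs_of_pos (show 0 < (u j).a1 - (u j).b1 by linarith)] at d1
  rw [abs_of_neg (show (u j).b1 - (u j).a1 < 0 by linarith)] at d2
  have d4 := neg_le_abs ((u j).b1 - (u k).b1)
  have d5 := le_abs_self ((u j).b1 - (u k).b1)
  linarith

theorem L2C_right {n u} (o : Opt3 E n u) {i j k l : ℕ} {h : ℝ} (w : Win n u i j) (w' : Win n u k l) (hik : i < k)
    (hA : ∀ m, i ≤ m → m ≤ l → (u m).a2 = h) (hb1 : (u i).b2 = h - 1) (hb2 : (u k).b2 = h + 1)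
    (B1 : h - 2 ∉ E.B) (B2 : h - 1 ∉ E.B) (B3 : h ∉ E.B) (B4 : h + 1 ∉ E.B)
    (s1 : (u i).a1 + 1 ≤ (u i).b1) : False := by
  have hw := o.walk
  have hjk := w.sep w' hik
  have q1 := w.lt
  have q2 := w'.lt
  have q3 := w'.ltn
  have hAi := hA i (by omega) (by omega)
  have hAk := hA k (by omega) (by omega)
  have s2 : (u j).b1 + 1 ≤ (u j).a1 := by
    rcases w.side with h | h
    · exact h.2
    · linarith [h.1]
  have n1 : near E (u i).b2 (u i).a2 := by
    rw [hb1, hAi]; simpa using near_tight (E := E) (g := h - 1) B2 (by simpa using B3)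
  have n2 : near E (u k).a2 (u k).b2 := by
    rw [hb2, hAk]; exact near_tight B3 B4
  have hA' : ∀ m, i ≤ m → m ≤ l → (u m).a2 = (u i).a2 := fun m a b => by rw [hA m a b, hAi]
  have hb1' : ∀ m, i ≤ m → m ≤ j → (u m).b2 = h - 1 := fun m a b => by rw [w.hb m a b, hb1]
  have hb2' : ∀ m, k ≤ m → m ≤ l → (u m).b2 = h + 1 := fun m a b => by rw [w'.hb m a b, hb2]
  have hni : ¬ HSeg E.F h (u i).a1 (u i).b1 := fun hx => by
    rw [← hAi] at hx
    rcases w'.side with hs | hs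
    · exact pass_right' o w w' hik hA' n1 n2 (s := i) (t := k) le_rfl q2.le le_rfl q1.le (Or.inl q1) s1 hs.1 hx
    · exact pass_right' o w w' hik hA' n1 n2 (s := i) (t := l) q2.le le_rfl le_rfl q1.le (Or.inl q1) s1 hs.2 hx
  have hnj : ¬ HSeg E.F h (u j).a1 (u j).b1 := fun hx => by
    rcases w'.side with hs | hs
    · rw [← hAi] at hx
      exact pass_left o w w' hik hA' n1 n2 (s := j) (t := l) q2.le le_rfl q1.le le_rfl (Or.inr q2) s2 hs.2 hx
    · refine swap_no o q1 hjk.le q2.le q3.le hA hb1' hb2' s1 s2 hs.1 hs.2 hni (fun hx' => ?_) hx (w.k i le_rfl q1)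
      rw [← hAi] at hx'
      exact pass_right o w w' hik hA' n1 n2 (s := i) (t := l) q2.le le_rfl le_rfl q1.le (Or.inl q1) s1 hs.2 hx'
  have hrow := fun a b (h1 : i ≤ a) (h2 : a ≤ l) (h3 : i ≤ b) (h4 : b ≤ l) =>
    rowA' hw (i := i) (j := l) (s := a) (t := b) (by omega) hA h1 h2 h3 h4
  have hrowB := fun a b (h1 : i ≤ a) (h2 : a ≤ j) (h3 : i ≤ b) (h4 : b ≤ j) =>
    rowB' hw (i := i) (j := j) (s := a) (t := b) (by omega) hb1' h1 h2 h3 h4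
  -- the row of A is enclosed
  have enc : ∀ p, HSeg E.F h (u i).a1 p → (u j).b1 < p ∧ p < (u i).b1 := by
    intro p hp
    constructor
    · by_contra hc
      have := (hrow j i (by omega) (by omega) (by omega) (by omega)).trans hp
      exact hnj (this.sub left_mem_uIcc (mem_uIcc_of' (by linarith) (by linarith)))
    · by_contra hc
      exact hni (hp.sub left_mem_uIcc (mem_uIcc_of (by linarith) (by linarith)))
  have hsub : ∀ m, i ≤ m → m ≤ j → ∀ p, HSeg E.F h (u m).a1 p → HSeg E.F (h - 1) (u m).b1 p := by
    intro m m1 m2 p hp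
    have e := enc p ((hrow i m (by omega) (by omega) (by omega) (by omega)).trans hp)
    exact (hrowB m j m1 m2 (by omega) le_rfl).trans
      ((hrowB j i (by omega) le_rfl le_rfl (by omega)).sub left_mem_uIcc (mem_uIcc_of e.1.le e.2.le))
  have hneB : (u j).b1 ≠ (u i).b1 := by
    have := enc _ (HSeg.refl (hrow i i le_rfl (by omega) le_rfl (by omega)).left)
    linarith
  -- swapped plan
  have ov := (symm_sw E).opt3 o
  have wv := w.sw
  obtain ⟨l0, r0, p1, p2, p3, p4, p5, p6⟩ := plateau (f := fun m => (u m).b2) (n := n) (g := h - 1) (i0 := i)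
    (fun h0 => B2 (h0 ▸ o.b0)) (fun h0 => B2 (h0 ▸ o.bn)) (by omega) hb1
  have hr0 : j ≤ r0 := by
    by_contra hc
    exact p6 (hb1' (r0 + 1) (by omega) (by omega))
  have nX : near E (h - 1) h := by simpa using near_tight (E := E) (g := h - 1) B2 (by simpa using B3)
  have nob : ∀ m, l0 < m → m ≤ r0 → Con u n m → ¬ near E (u m).a2 (h - 1) := by
    intro m m1 m2 hc hn
    exact no_below ov (lo := l0 + 1) (hi := r0) (g := h - 1) (fun i a b => p4 i (by omega) b) wv (by omega) hr0
      (by simpa [hAi] using nX)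
      (fun m m1 m2 => hsub m m1 m2 _ (HSeg.refl (hrow m m m1 (by omega) m1 (by omega)).left))
      (by omega) (by omega) m2 (Con_sw hc) hn
  have yX : h - 1 ∈ E.Y := by rw [← hb1]; exact (hw.1 i (by omega)).yb
  by_cases hup : h - 1 < (u l0).b2 ∧ h - 1 < (u (r0 + 1)).b2
  · obtain ⟨g', g1, g2⟩ := exists_nb_up (E := E) yX
    have g3 : g' ≤ h := by
      have := g2.le_of_lt g1 (E.Yp _ yX) (by linarith)
      linarith
    have hE : (∃ m, i ≤ m ∧ m ≤ l ∧ (u m).a1 ≠ (u i).a1) ∨ ∀ m, i ≤ m → m ≤ l → (u m).a1 = (u i).a1 := by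
      by_contra hc
      push Not at hc
      obtain ⟨hc, m, m1, m2, m3⟩ := hc
      exact m3 (hc m m1 m2)
    have hrB := hrowB i j (by omega) (by omega) (by omega) (by omega)
    have htr : (∀ m, i ≤ m → m ≤ l → (u m).a1 = (u i).a1) →
        (u k).b1 ≠ (u l).b1 ∧ HSeg E.F (h + 1) (u k).b1 (u l).b1 ∧ (u i).a1 ∈ uIcc (u k).b1 (u l).b1 ∧
        VSeg E.F (u i).a1 h (h + 1) := by
      intro hc
      have r2 := rowB' hw (i := k) (j := l) (s := k) (t := l) (by omega) hb2' (by omega) (by omega) (by omega) (by omega)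
      have hm : (u i).a1 ∈ uIcc (u k).b1 (u l).b1 ∧ (u k).b1 ≠ (u l).b1 := by
        have c1 := hc k (by omega) (by omega)
        have c2 := hc l (by omega) (by omega)
        rcases w'.side with hs | hs
        · exact ⟨mem_uIcc_of' (by linarith) (by linarith), by linarith⟩
        · exact ⟨mem_uIcc_of (by linarith) (by linarith), by linarith⟩
      refine ⟨hm.2, r2, hm.1, E.gap _ _ _ (hrow i i le_rfl (by omega) le_rfl (by omega)).left (r2 _ hm.1) ?_⟩
      rw [abs_le]; constructor <;> linarith
    have noT : ∀ m, i ≤ m → m ≤ j → ¬ TBU E (u m).a1 h := by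
      intro m m1 m2
      rcases hE with ⟨m', m1', m2', hne⟩ | hc
      · by_cases he : (u m).a1 = (u i).a1
        · rw [he]
          exact noTBU_row hne.symm (hrow i m' (by omega) (by omega) m1' m2') left_mem_uIcc le_rfl
            (VSeg.refl (hrow i m' (by omega) (by omega) m1' m2').left)
        · exact noTBU_row he (hrow m i m1 (by omega) (by omega) (by omega)) left_mem_uIcc le_rfl
            (VSeg.refl (hrow m i m1 (by omega) (by omega) (by omega)).left)
      · obtain ⟨h1, h2, h3, h4⟩ := htr hc
        rw [hc m m1 (by omega)]
        exact noTBU_row h1 h2 h3 (by linarith) h4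
    refine move_b ov (l := l0) (r := r0) (g := h - 1) (g' := g') p3 p4 g2 g1 B2 (by rwa [show h - 1 - 1 = h - 2 by ring])
      (by simpa using B3) hup.1 hup.2 wv p1 hr0 (by simpa using hAi) ?_ ?_ ?_
    · exact g2.vert B2 hneB.symm hrB _ left_mem_uIcc
    · have e : nb E h (g' + 1) := by simpa using g2.add1
      show VSeg E.F (u i).a1 (h - 1 + 1) (g' + 1)
      rw [sub_add_cancel]
      rcases hE with ⟨m', m1', m2', hne⟩ | hc
      · exact e.vert B3 hne.symm (hrow i m' (by omega) (by omega) m1' m2') _ left_mem_uIcc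
      · obtain ⟨h1, h2, h3, h4⟩ := htr hc
        exact h4.sub left_mem_uIcc (mem_uIcc_of (by linarith) (by linarith))
    · intro m m1 m2
      show Up E (u m).b1 (h - 1) (u m).a1 (h - 1 + 1) ∧ ¬ Dn E (u m).b1 (h - 1) (u m).a1 (h - 1 + 1)
      rw [sub_add_cancel]
      refine ⟨Or.inr ⟨hsub m m1 m2, noT m m1 m2⟩, ?_⟩
      rintro (ht | ⟨hs, _⟩)
      · exact noT m m1 m2 ht
      · have := hs _ (hrowB m i m1 m2 (by omega) (by omega))
        exact hni ((hrow i m (by omega) (by omega) m1 (by omega)).trans this)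
  · obtain ⟨g', g1, g2⟩ := exists_nb_dn (E := E) yX
    have lv : (u l0).b1 = (u (l0 + 1)).b1 :=
      ((hw.rb l0 (by omega)).vseg (by have := p4 (l0 + 1) (by omega) (by omega); rw [this]; exact p5)).1
    have rv : (u r0).b1 = (u (r0 + 1)).b1 :=
      ((hw.rb r0 (by omega)).vseg (by have := p4 r0 (by omega) (by omega); rw [this]; exact p6.symm)).1
    have hrB := hrowB i j (by omega) (by omega) (by omega) (by omega)
    refine lower_no ov (l := l0) (r := r0) (g := h - 1) (g' := g') (by omega) p3 p4 g2 g1 B2 lv rv (i0 := i) p1 p2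
      (g2.vert B2 hneB.symm hrB _ left_mem_uIcc) ?_ ?_ ?_
    · simp only [Cfg.sw_a2]
      have k1 : |(u l0).b2 - g'| - |(u l0).b2 - (h - 1)| ≤ h - 1 - g' := by
        have := abs_sub_le (u l0).b2 (h - 1) g'
        rw [abs_of_pos (show 0 < h - 1 - g' by linarith)] at this; linarith
      have k2 : |(u (r0 + 1)).b2 - g'| - |(u (r0 + 1)).b2 - (h - 1)| ≤ h - 1 - g' := by
        have := abs_sub_le (u (r0 + 1)).b2 (h - 1) g'
        rw [abs_of_pos (show 0 < h - 1 - g' by linarith)] at this; linarith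
      have k3 : ∀ y ∈ E.Y, y < h - 1 → |y - g'| - |y - (h - 1)| = - (h - 1 - g') := by
        intro y hy hlt
        have := g2.ge_of_gt g1 hy hlt
        rw [abs_of_nonpos (by linarith), abs_of_neg (by linarith)]; ring
      rw [not_and_or, not_lt, not_lt] at hup
      rcases hup with hh | hh
      · rw [k3 _ (hw.1 l0 (by omega)).yb (lt_of_le_of_ne hh p5)]; linarith
      · rw [k3 _ (hw.1 (r0 + 1) (by omega)).yb (lt_of_le_of_ne hh p6)]; linarith
    · intro m m1 m2 hc
      have hc' : Con u n m := by simpa using Con_sw hc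
      simp only [Cfg.sw_a2, Cfg.sw_b2]
      have hm := p4 m m1 m2
      have hord : ((u m).a2 + 1 ≤ (u m).b2) ∨ ((u m).b2 + 1 ≤ (u m).a2) := by
        rcases hc' with ⟨h1, hk⟩ | ⟨j, rfl, h1, hk⟩
        · exact (hw.ssy h1 hk).imp (fun h => h.1) (fun h => h.1)
        · exact (hw.ssy (by omega) hk).imp (fun h => h.2) (fun h => h.2)
      rcases hord with ho | ho
      · right
        refine ⟨?_, by rwa [show h - 1 - 1 = h - 2 by ring], nob m m1 m2 hc'⟩
        rw [hm] at ho
        rcases ho.eq_or_lt with hh | hh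
        · exfalso
          apply nob m m1 m2 hc'
          have := near_tight (E := E) (g := (u m).a2) (by rw [show (u m).a2 = h - 2 by linarith]; exact B1)
            (by rw [hh]; exact B2)
          rwa [hh] at this
        · exact g2.ge_of_gt g1 (E.Yp _ (hw.1 m (by omega)).ya) hh
      · left
        exact ⟨ho, by simpa using B3⟩
    · exact ⟨i, p1, p2, wv.con le_rfl q1.le, by simpa [hAi] using nX⟩

theorem L2C {n u} (o : Opt3 E n u) {i j k l : ℕ} {h : ℝ} (w : Win n u i j) (w' : Win n u k l) (hik : i < k)
    (hA : ∀ m, i ≤ m → m ≤ l → (u m).a2 = h) (hb1 : (u i).b2 = h - 1) (hb2 : (u k).b2 = h + 1)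
    (B1 : h - 2 ∉ E.B) (B2 : h - 1 ∉ E.B) (B3 : h ∉ E.B) (B4 : h + 1 ∉ E.B) : False := by
  rcases w.side with hs | hs
  · exact L2C_right o w w' hik hA hb1 hb2 B1 B2 B3 B4 hs.1
  · exact L2C_right ((symm_fx E).opt3 o) w.fx w'.fx hik hA hb1 hb2 B1 B2 B3 B4
      (by simp only [Cfg.fx_a1, Cfg.fx_b1]; linarith [hs.1])

/-- no robot has tight contacts both below and above on one plateau; windows in any order -/
theorem two_sided_lo {n u} (o : Opt3 E n u) {i j k l lo hi : ℕ} {h : ℝ} (w : Win n u i j) (w' : Win n u k l)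
    (hA : ∀ m, lo ≤ m → m ≤ hi → (u m).a2 = h) (i1 : lo ≤ i) (i2 : j ≤ hi) (i3 : lo ≤ k) (i4 : l ≤ hi)
    (hb1 : (u i).b2 = h - 1) (hb2 : (u k).b2 = h + 1)
    (B1 : h - 2 ∉ E.B) (B2 : h - 1 ∉ E.B) (B3 : h ∉ E.B) (B4 : h + 1 ∉ E.B) : False := by
  have q1 := w.lt
  have q2 := w'.lt
  have q3 := w'.ltn
  have q4 := w.ltn
  rcases lt_trichotomy i k with hh | hh | hh
  · exact L2C o w w' hh (fun m a b => hA m (by omega) (by omega)) hb1 hb2 B1 B2 B3 B4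
  · subst hh; linarith
  · have := w'.sep w hh
    have hm : ∀ m, m ≤ n → n - (n - m) = m := fun m hm => by omega
    refine L2C (h := h) o.rev w.rev w'.rev (by omega) (fun m a b => hA _ (by omega) (by omega)) ?_ ?_ B1 B2 B3 B4
    · show (u (n - (n - j))).b2 = _
      rw [hm _ (by omega), w.hb j q1.le le_rfl, hb1]
    · show (u (n - (n - l))).b2 = _
      rw [hm _ (by omega), w'.hb l q2.le le_rfl, hb2]

theorem two_sided_hi {n u} (o : Opt3 E n u) {i j k l lo hi : ℕ} {h : ℝ} (w : Win n u i j) (w' : Win n u k l)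
    (hA : ∀ m, lo ≤ m → m ≤ hi → (u m).a2 = h) (i1 : lo ≤ i) (i2 : j ≤ hi) (i3 : lo ≤ k) (i4 : l ≤ hi)
    (hb1 : (u i).b2 = h - 1) (hb2 : (u k).b2 = h + 1)
    (B1 : h + 2 ∉ E.B) (B2 : h - 1 ∉ E.B) (B3 : h ∉ E.B) (B4 : h + 1 ∉ E.B) : False := by
  refine two_sided_lo (h := -h) ((symm_fy E).opt3 o) w'.fy w.fy (lo := lo) (hi := hi)
    (fun m a b => by simpa using hA m a b) i3 i4 i1 i2 (by simp [hb2]; ring) (by simp [hb1]; ring) ?_ ?_ ?_ ?_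
  · show -(-h - 2) ∉ E.B
    rwa [show -(-h - 2) = h + 2 by ring]
  · show -(-h - 1) ∉ E.B
    rwa [show -(-h - 1) = h + 1 by ring]
  · show -(-h) ∉ E.B
    rwa [neg_neg]
  · show -(-h + 1) ∉ E.B
    rwa [show -(-h + 1) = h - 1 by ring]

end TR

namespace TR

variable {E : Env}

theorem Walk.ky_of {n u} (w : Walk E n u) {α β : ℕ → ℝ}
    (hc : ∀ i ≤ n, Con u n i → ((u i).a2 + 1 ≤ (u i).b2 → α i + 1 ≤ β i) ∧
      ((u i).b2 + 1 ≤ (u i).a2 → β i + 1 ≤ α i)) :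
    ∀ i < n, KK u i → SSy (mkc u α β i) (mkc u α β (i + 1)) := by
  intro i hi hk
  have c1 := hc i hi.le (Or.inl ⟨hi, hk⟩)
  have c2 := hc (i + 1) hi (Or.inr ⟨i, rfl, hi, hk⟩)
  rcases w.ssy hi hk with ⟨h1, h2⟩ | ⟨h1, h2⟩
  · exact Or.inl ⟨c1.1 h1, c2.1 h2⟩
  · exact Or.inr ⟨c1.2 h1, c2.2 h2⟩

theorem Win.inside {n u j1 j2} (w : Win n u j1 j2) {l r i : ℕ} {g : ℝ}
    (hl : (u l).a2 ≠ g) (hr : (u (r + 1)).a2 ≠ g) (h1 : l < i) (h2 : i ≤ r) (h3 : j1 ≤ i) (h4 : i ≤ j2)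
    (hg : (u i).a2 = g) : l < j1 ∧ j2 ≤ r := by
  have e := w.ha i h3 h4
  constructor
  · by_contra hh
    exact hl ((w.ha l (by omega) (by omega)).trans (e.symm.trans hg))
  · by_contra hh
    exact hr ((w.ha (r + 1) (by omega) (by omega)).trans (e.symm.trans hg))

theorem plateau_x {n u} (w : Walk E n u) {l r : ℕ} {g : ℝ} (hlr : l < r) (hrn : r < n)
    (hf : ∀ i, l < i → i ≤ r → (u i).a2 = g) (hl : (u l).a2 ≠ g) (hr : (u (r + 1)).a2 ≠ g) :
    ((u l).a1 = (u (l + 1)).a1 ∧ VSeg E.F (u (l + 1)).a1 g (u l).a2) ∧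
    ((u r).a1 = (u (r + 1)).a1 ∧ VSeg E.F (u r).a1 g (u (r + 1)).a2) := by
  constructor
  · have e := hf (l + 1) (by omega) (by omega)
    have := (w.ra l (by omega)).vseg (by rw [e]; exact hl)
    refine ⟨this.1, ?_⟩
    have h2 := this.2.symm
    rwa [e, this.1] at h2
  · have e := hf r (by omega) (by omega)
    have := (w.ra r (by omega)).vseg (by rw [e]; exact hr.symm)
    refine ⟨this.1, ?_⟩
    have h2 := this.2
    rwa [e] at h2

theorem tip_dn {n u} (o : Opt3 E n u) {l r : ℕ} {g g' : ℝ} (hlr : l < r) (hrn : r < n)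
    (hf : ∀ i, l < i → i ≤ r → (u i).a2 = g) (hl : (u l).a2 ≠ g) (hr : (u (r + 1)).a2 ≠ g)
    (hB : g ∉ E.B) (hB1 : g - 1 ∉ E.B) (hB2 : g + 1 ∉ E.B) (a : nb E g g') (hlt : g' < g) :
    VSeg E.F (u (l + 1)).a1 g g' := by
  by_contra hno
  have w := o.walk
  obtain ⟨⟨lx, lv⟩, rx, rv⟩ := plateau_x w hlr hrn hf hl hr
  have hx : ∀ i, l < i → i ≤ r → (u i).a1 = (u (l + 1)).a1 := by
    intro i h1 h2
    by_contra hne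
    have := w.rowA (i := l + 1) (j := i) (g := g) (by omega) (by omega) (fun m m1 m2 => hf m (by omega) (by omega))
    exact hno (a.vert hB (Ne.symm hne) this _ left_mem_uIcc)
  have stuck : ∀ t, t < g → ¬ VSeg E.F (u (l + 1)).a1 g t := by
    intro t ht hv
    exact hno (E.colD _ g a.1 g' a.2.1 hlt (fun z hz => (a.2.2.2 z hz).2) t ht hv)
  have hl' : g < (u l).a2 := lt_of_le_of_ne (not_lt.1 fun hh => stuck _ hh lv) hl.symm
  have hr' : g < (u (r + 1)).a2 := by
    refine lt_of_le_of_ne (not_lt.1 fun hh => stuck _ hh ?_) hr.symm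
    rwa [hx r (by omega) le_rfl] at rv
  obtain ⟨k, k1, k2⟩ := exists_nb_up (E := E) a.1
  have hva : VSeg E.F (u (l + 1)).a1 g k :=
    E.colU _ g a.1 k k2.2.1 k1 (fun z hz => (k2.2.2.2 z hz).1) _ hl' lv
  by_cases ht : ∃ i, l < i ∧ i ≤ r ∧ Con u n i ∧ (u i).b2 = g + 1
  · obtain ⟨i, i1, i2, hc, hb⟩ := ht
    have hn : near E (u i).a2 (u i).b2 := by rw [hf i i1 i2, hb]; exact near_tight hB hB2
    obtain ⟨j1, j2, s1, s2, win⟩ := CW o (by omega) hn hc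
    obtain ⟨t1, t2⟩ := win.inside hl hr i1 i2 s1 s2 (hf i i1 i2)
    have hlt' := win.lt
    have hbj : ∀ m, j1 ≤ m → m ≤ j2 → (u m).b2 = g + 1 := fun m m1 m2 =>
      (win.hb m m1 m2).trans ((win.hb i s1 s2).symm.trans hb)
    have hxj : (u j1).a1 = (u j2).a1 := (hx j1 (by omega) (by omega)).trans (hx j2 (by omega) (by omega)).symm
    have hne : (u j1).b1 ≠ (u j2).b1 := by
      intro he
      rcases win.side with h | h <;> linarith [h.1, h.2]
    have hrow : ∀ m m', j1 ≤ m → m ≤ m' → m' ≤ j2 → HSeg E.F (g + 1) (u m).b1 (u m').b1 :=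
      fun m m' m1 m2 m3 => w.rowB m2 (by have := win.ltn; omega) (fun s q1 q2 => hbj s (by omega) (by omega))
    refine move_b o hrn hf k2 k1 hB hB1 hB2 hl' hr' win t1 t2 (hbj j1 le_rfl hlt'.le) ?_ ?_ ?_
    · rw [hx j1 (by omega) (by omega)]; exact hva
    · exact k2.add1.vert hB2 hne (hrow j1 j2 le_rfl hlt'.le le_rfl) _ left_mem_uIcc
    · intro m m1 m2
      rw [hx m (by omega) (by omega)]
      have ht : TBD E (u (l + 1)).a1 g := ⟨g, le_rfl, VSeg.refl hva.left, stuck, fun b hb h => hB (by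
        rwa [← le_antisymm h.1 h.2] at hb)⟩
      refine ⟨Or.inl ht, ?_⟩
      rintro (hu | ⟨_, hh⟩)
      · have fm := (w.1 m (by have := win.ltn; omega)).fb
        rw [hbj m m1 m2] at fm
        by_cases hh : (u m).b1 = (u j1).b1
        · exact noTBU_row (by rw [hh]; exact hne) (hrow m j2 m1 m2 le_rfl) left_mem_uIcc le_rfl (VSeg.refl fm) hu
        · exact noTBU_row hh (hrow j1 m le_rfl m1 m2).symm left_mem_uIcc le_rfl (VSeg.refl fm) hu
      · exact hh ht
  · have ra : RSh E n (fun i => (u i).a1) (fun i => (u i).a2) (ish (fun i => (u i).a2) l r k) :=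
      RSh.ish w.ra hrn hf k2 hB (i0 := l + 1) (by omega) (by omega) hva lx rx
    have sd : ShiftData E n u (ish (fun i => (u i).a2) l r k) (fun i => (u i).b2) := by
      refine ra.toShift (RSh.id w.rb) (w.ky_of fun i hi hc => ?_)
      by_cases hin : l < i ∧ i ≤ r
      · rw [ish_in hin, hf i hin.1 hin.2]
        refine ⟨fun h => ?_, fun h => by linarith⟩
        refine k2.add1.le_of_lt (by linarith) (w.1 i hi).yb (lt_of_le_of_ne h ?_)
        intro he
        exact ht ⟨i, hin.1, hin.2, hc, he.symm⟩
      · rw [ish_out hin]; exact ⟨id, id⟩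
    have := sd.dc o
    rw [dcost_zero, add_zero, dcost_ish n _ l r g k hlr hrn hf, k2.absu k1 (w.1 l (by omega)).ya hl',
      k2.absu k1 (w.1 (r + 1) (by omega)).ya hr'] at this
    linarith

theorem nb_fy {h h'} (a : nb E h h') : nb E.fy (-h) (-h') := by
  refine ⟨by simpa [Env.fy] using a.1, by simpa [Env.fy] using a.2.1, by simpa using a.2.2.1, ?_⟩
  intro w hw
  have := a.2.2.2 (-w) hw
  constructor
  · rintro ⟨h1, h2⟩; exact this.2 ⟨by linarith, by linarith⟩
  · rintro ⟨h1, h2⟩; exact this.1 ⟨by linarith, by linarith⟩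

theorem tip {n u} (o : Opt3 E n u) {l r : ℕ} {g g' : ℝ} (hlr : l < r) (hrn : r < n)
    (hf : ∀ i, l < i → i ≤ r → (u i).a2 = g) (hl : (u l).a2 ≠ g) (hr : (u (r + 1)).a2 ≠ g)
    (hB : g ∉ E.B) (hB1 : g - 1 ∉ E.B) (hB2 : g + 1 ∉ E.B) (a : nb E g g') :
    VSeg E.F (u (l + 1)).a1 g g' := by
  rcases lt_or_gt_of_ne a.2.2.1 with hlt | hlt
  · have := tip_dn ((symm_fy E).opt3 o) (l := l) (r := r) (g := -g) (g' := -g') hlr hrn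
      (fun i h1 h2 => by simpa using hf i h1 h2) (by simpa using hl) (by simpa using hr)
      (by show - -g ∉ E.B; rwa [neg_neg]) (by show -(-g - 1) ∉ E.B; rwa [show -(-g - 1) = g + 1 by ring])
      (by show -(-g + 1) ∉ E.B; rwa [show -(-g + 1) = g - 1 by ring]) (nb_fy a) (by linarith)
    have h2 := VSeg_fy.1 this
    simpa using h2
  · exact tip_dn o hlr hrn hf hl hr hB hB1 hB2 a hlt

theorem shift_zero {n u} (o : Opt E n u) {α β α' β' s : ℕ → ℝ} {δ δ' : ℝ}
    (S : ShiftData E n u α β) (S' : ShiftData E n u α' β') (hδ : 0 < δ) (hδ' : 0 < δ')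
    (hc : δ' * (dcost n (fun i => (u i).a2) α + dcost n (fun i => (u i).b2) β) +
      δ * (dcost n (fun i => (u i).a2) α' + dcost n (fun i => (u i).b2) β') ≤ 0)
    (hv : ∀ i ≤ n, Con u n i → val E (mkc u α β i) ≤ val E (u i) + s i * δ)
    (hv' : ∀ i ≤ n, Con u n i → val E (mkc u α' β' i) ≤ val E (u i) - s i * δ')
    (ha : ∀ i, α' i ≤ (u i).a2) (hb : ∀ i, β' i ≤ (u i).b2)
    {i0 : ℕ} (hi0 : i0 < n) (hlt : α' i0 < (u i0).a2) : False := by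
  have d1 := S.dc o.toOpt3
  have d2 := S'.dc o.toOpt3
  have e1 := mul_nonneg hδ'.le d1
  have e2 := mul_nonneg hδ.le d2
  have z1 : dcost n (fun i => (u i).a2) α + dcost n (fun i => (u i).b2) β ≤ 0 := by
    by_contra hh; have := mul_pos hδ' (not_le.1 hh); linarith
  have z2 : dcost n (fun i => (u i).a2) α' + dcost n (fun i => (u i).b2) β' ≤ 0 := by
    by_contra hh; have := mul_pos hδ (not_le.1 hh); linarith
  have con1 : ∀ i, i < n → KK u i → Con u n i := fun i hi hk => Or.inl ⟨hi, hk⟩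
  have con2 : ∀ i, i < n → KK u i → Con u n (i + 1) := fun i hi hk => Or.inr ⟨i, rfl, hi, hk⟩
  classical
  set T : ℝ := ∑ i ∈ Finset.range n, if KK u i then s i + s (i + 1) else 0 with hT
  have p1 : ∑ l ∈ Finset.range n, pp E (mkc u α β l) (mkc u α β (l + 1)) ≤
      ∑ l ∈ Finset.range n, pp E (u l) (u (l + 1)) + T * δ := by
    rw [hT, Finset.sum_mul, ← Finset.sum_add_distrib]
    apply Finset.sum_le_sum
    intro i hi
    rw [Finset.mem_range] at hi
    have := pp_mk (E := E) u α β i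
    by_cases hk : KK u i
    · rw [if_pos hk] at this ⊢
      linarith [hv i hi.le (con1 i hi hk), hv (i + 1) hi (con2 i hi hk)]
    · rw [if_neg hk] at this ⊢; linarith
  have p2 : ∑ l ∈ Finset.range n, pp E (mkc u α' β' l) (mkc u α' β' (l + 1)) ≤
      ∑ l ∈ Finset.range n, pp E (u l) (u (l + 1)) - T * δ' := by
    rw [hT, Finset.sum_mul, ← Finset.sum_sub_distrib]
    apply Finset.sum_le_sum
    intro i hi
    rw [Finset.mem_range] at hi
    have := pp_mk (E := E) u α' β' i
    by_cases hk : KK u i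
    · rw [if_pos hk] at this ⊢
      linarith [hv' i hi.le (con1 i hi hk), hv' (i + 1) hi (con2 i hi hk)]
    · rw [if_neg hk] at this ⊢; linarith
  have q1 := S.pc o.toOpt3 z1
  have T0 : 0 ≤ T := by
    by_contra hh; have := mul_pos_of_neg_of_neg (not_le.1 hh) (neg_neg_of_pos hδ); linarith
  have T1 := mul_nonneg T0 hδ'.le
  have := o.minq _ _ _ _ (S'.wkn o.toOpt3) (by rw [sum_cost_mk]; linarith) le_rfl (by linarith)
  refine absurd this (not_le.2 ?_)
  apply Finset.sum_lt_sum
  · intro i _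
    simp only [qq, mkc]
    linarith [ha i, hb i, ha (i + 1), hb (i + 1)]
  · refine ⟨i0, Finset.mem_range.2 hi0, ?_⟩
    simp only [qq, mkc]
    linarith [ha i0, hb i0, ha (i0 + 1), hb (i0 + 1)]

end TR

namespace TR

variable {E : Env}

theorem Con.ord {n u} (w : Walk E n u) {i} (hc : Con u n i) :
    (u i).a2 + 1 ≤ (u i).b2 ∨ (u i).b2 + 1 ≤ (u i).a2 := by
  rcases hc with ⟨h1, hk⟩ | ⟨j, rfl, h1, hk⟩
  · exact (w.ssy h1 hk).imp (fun h => h.1) (fun h => h.1)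
  · exact (w.ssy (by omega) hk).imp (fun h => h.2) (fun h => h.2)

/-- a pair of opposite shifts of one robot by `δ` up and `δ'` down on the index set of `c` -/
structure TwoSh (E : Env) (n : ℕ) (x y c : ℕ → ℝ) (δ δ' : ℝ) : Prop where
  up : RSh E n x y (fun i => y i + c i * δ)
  dn : RSh E n x y (fun i => y i - c i * δ')
  dc : δ' * dcost n y (fun i => y i + c i * δ) + δ * dcost n y (fun i => y i - c i * δ') = 0
  c01 : ∀ i, 0 ≤ c i
  nB : ∀ i ≤ n, c i ≠ 0 → y i ∉ E.B ∧ y i + 1 ∉ E.B ∧ y i - 1 ∉ E.B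

theorem two_core {n u} (o : Opt E n u) {cA cB : ℕ → ℝ} {δ δ' : ℝ} (hδ : 0 < δ) (hδ' : 0 < δ')
    (TA : TwoSh E n (fun i => (u i).a1) (fun i => (u i).a2) cA δ δ')
    (TB : TwoSh E n (fun i => (u i).b1) (fun i => (u i).b2) cB δ δ')
    (h1 : ∀ i ≤ n, Con u n i → ((u i).a2 + 1 ≤ (u i).b2 → (u i).a2 + cA i * δ + 1 ≤ (u i).b2 + cB i * δ ∧
      (u i).a2 - cA i * δ' + 1 ≤ (u i).b2 - cB i * δ'))
    (h2 : ∀ i ≤ n, Con u n i → ((u i).b2 + 1 ≤ (u i).a2 → (u i).b2 + cB i * δ + 1 ≤ (u i).a2 + cA i * δ ∧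
      (u i).b2 - cB i * δ' + 1 ≤ (u i).a2 - cA i * δ'))
    {i0 : ℕ} (hi0 : i0 < n) (hc0 : 0 < cA i0) : False := by
  have w := o.walk
  classical
  have S := TA.up.toShift TB.up (w.ky_of fun i hi hc => ⟨fun h => (h1 i hi hc h).1, fun h => (h2 i hi hc h).1⟩)
  have S' := TA.dn.toShift TB.dn (w.ky_of fun i hi hc => ⟨fun h => (h1 i hi hc h).2, fun h => (h2 i hi hc h).2⟩)
  refine shift_zero o (s := fun i => if (u i).a2 + 1 ≤ (u i).b2 then
      wL E (u i).a1 (u i).a2 (u i).b1 (u i).b2 * cA i - wU E (u i).a1 (u i).a2 (u i).b1 (u i).b2 * cB i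
    else wL E (u i).b1 (u i).b2 (u i).a1 (u i).a2 * cB i - wU E (u i).b1 (u i).b2 (u i).a1 (u i).a2 * cA i)
    S S' hδ hδ' ?_ ?_ ?_ ?_ ?_ hi0 ?_
  · have e1 := TA.dc
    have e2 := TB.dc
    rw [mul_add, mul_add]; linarith
  · intro i hi hc
    have gr := w.1 i hi
    have na := TA.nB i hi
    have nb := TB.nB i hi
    split_ifs with hh
    · have := val_shift1 gr.fa gr.fb (TA.up.g i hi) (TB.up.g i hi) hh (h1 i hi hc hh).1
        (fun h => by have := na (by rintro he; simp [he] at h); tauto)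
        (fun h => by have := nb (by rintro he; simp [he] at h); tauto)
      refine this.trans (le_of_eq ?_); ring
    · have hh' := (hc.ord w).resolve_left hh
      have := val_shift2 gr.fa gr.fb (TA.up.g i hi) (TB.up.g i hi) hh' (h2 i hi hc hh').1
        (fun h => by have := na (by rintro he; simp [he] at h); tauto)
        (fun h => by have := nb (by rintro he; simp [he] at h); tauto)
      refine this.trans (le_of_eq ?_); ring
  · intro i hi hc
    have gr := w.1 i hi
    have na := TA.nB i hi
    have nb := TB.nB i hi
    split_ifs with hh
    · have := val_shift1 gr.fa gr.fb (TA.dn.g i hi) (TB.dn.g i hi) hh (h1 i hi hc hh).2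
        (fun h => by have := na (by rintro he; simp [he] at h); tauto)
        (fun h => by have := nb (by rintro he; simp [he] at h); tauto)
      refine this.trans (le_of_eq ?_); ring
    · have hh' := (hc.ord w).resolve_left hh
      have := val_shift2 gr.fa gr.fb (TA.dn.g i hi) (TB.dn.g i hi) hh' (h2 i hi hc hh').2
        (fun h => by have := na (by rintro he; simp [he] at h); tauto)
        (fun h => by have := nb (by rintro he; simp [he] at h); tauto)
      refine this.trans (le_of_eq ?_); ring
  · intro i
    have := mul_nonneg (TA.c01 i) hδ'.le
    linarith
  · intro i
    have := mul_nonneg (TB.c01 i) hδ'.le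
    linarith
  · have := mul_pos hc0 hδ'
    linarith

theorem TwoSh.zero {n x y δ δ'} (hRM : ∀ i < n, RM E.F (x i) (y i) (x (i + 1)) (y (i + 1))) :
    TwoSh E n x y (fun _ => 0) δ δ' where
  up := by simpa using RSh.id hRM
  dn := by simpa using RSh.id hRM
  dc := by simp [dcost_zero]
  c01 := fun _ => le_rfl
  nB := fun i _ h => absurd rfl h

open Classical in
def cI (l r : ℕ) : ℕ → ℝ := fun i => if l < i ∧ i ≤ r then 1 else 0
theorem cI_in {l r i} (h : l < i ∧ i ≤ r) : cI l r i = 1 := by simp [cI, h]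
theorem cI_out {l r i} (h : ¬ (l < i ∧ i ≤ r)) : cI l r i = 0 := by simp only [cI, if_neg h]
theorem ish_cI {y : ℕ → ℝ} {l r : ℕ} {g d : ℝ} (hf : ∀ i, l < i → i ≤ r → y i = g) :
    ish y l r (g + d) = fun i => y i + cI l r i * d := by
  funext i
  by_cases h : l < i ∧ i ≤ r
  · rw [ish_in h, cI_in h, hf i h.1 h.2, one_mul]
  · rw [ish_out h, cI_out h]; ring

theorem TwoSh.mk' {n u} (o : Opt3 E n u) {l r : ℕ} {g g1 g2 : ℝ} (hlr : l < r) (hrn : r < n)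
    (hf : ∀ i, l < i → i ≤ r → (u i).a2 = g) (hl : (u l).a2 ≠ g) (hr : (u (r + 1)).a2 ≠ g)
    (hB : g ∉ E.B) (hB1 : g - 1 ∉ E.B) (hB2 : g + 1 ∉ E.B) (a1 : nb E g g1) (l1 : g < g1)
    (a2 : nb E g g2) (l2 : g2 < g) :
    TwoSh E n (fun i => (u i).a1) (fun i => (u i).a2) (cI l r) (g1 - g) (g - g2) := by
  have w := o.walk
  obtain ⟨⟨lx, lv⟩, rx, rv⟩ := plateau_x w hlr hrn hf hl hr
  have e1 : ish (fun i => (u i).a2) l r g1 = fun i => (u i).a2 + cI l r i * (g1 - g) := by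
    rw [← ish_cI hf]; congr 1; ring
  have e2 : ish (fun i => (u i).a2) l r g2 = fun i => (u i).a2 - cI l r i * (g - g2) := by
    have := ish_cI (d := g2 - g) (y := fun i => (u i).a2) hf
    rw [add_sub_cancel] at this
    rw [this]; funext i; ring
  refine ⟨?_, ?_, ?_, ?_, ?_⟩
  · rw [← e1]
    exact RSh.ish w.ra hrn hf a1 hB (i0 := l + 1) (by omega) (by omega)
      (tip o hlr hrn hf hl hr hB hB1 hB2 a1) lx rx
  · rw [← e2]
    exact RSh.ish w.ra hrn hf a2 hB (i0 := l + 1) (by omega) (by omega)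
      (tip o hlr hrn hf hl hr hB hB1 hB2 a2) lx rx
  · rw [← e1, ← e2, dcost_ish n _ l r g g1 hlr hrn hf, dcost_ish n _ l r g g2 hlr hrn hf]
    have key : ∀ y ∈ E.Y, y ≠ g → ∃ c, |y - g1| - |y - g| = c * (g1 - g) ∧ |y - g2| - |y - g| = - c * (g - g2) := by
      intro y hy hne
      rcases lt_or_gt_of_ne hne with hh | hh
      · have := a2.ge_of_gt l2 hy hh
        refine ⟨1, ?_, ?_⟩
        · rw [abs_of_nonpos (by linarith), abs_of_nonpos (by linarith)]; ring
        · rw [abs_of_nonpos (by linarith), abs_of_nonpos (by linarith)]; ring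
      · have := a1.le_of_lt l1 hy hh
        refine ⟨-1, ?_, ?_⟩
        · rw [abs_of_nonneg (by linarith), abs_of_nonneg (by linarith)]; ring
        · rw [abs_of_nonneg (by linarith), abs_of_nonneg (by linarith)]; ring
    obtain ⟨c, c1, c2⟩ := key _ (w.1 l (by omega)).ya hl
    obtain ⟨d, d1, d2⟩ := key _ (w.1 (r + 1) (by omega)).ya hr
    rw [c1, c2, d1, d2]; ring
  · intro i; unfold cI; split_ifs <;> norm_num
  · intro i _ h
    have hin : l < i ∧ i ≤ r := by by_contra hh; exact h (cI_out hh)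
    simp only [hf i hin.1 hin.2]
    exact ⟨hB, hB2, hB1⟩

theorem d_single {n u} (o : Opt E n u) {l r : ℕ} {g : ℝ} (hlr : l < r) (hrn : r < n)
    (hf : ∀ i, l < i → i ≤ r → (u i).a2 = g) (hl : (u l).a2 ≠ g) (hr : (u (r + 1)).a2 ≠ g)
    (hB : g ∉ E.B) (hB1 : g - 1 ∉ E.B) (hB2 : g + 1 ∉ E.B)
    (ht : ∀ i, l < i → i ≤ r → Con u n i → (u i).b2 ≠ g + 1 ∧ (u i).b2 ≠ g - 1) : False := by
  have w := o.walk
  have yg : g ∈ E.Y := by rw [← hf r hlr le_rfl]; exact (w.1 r (by omega)).ya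
  obtain ⟨g1, l1, a1⟩ := exists_nb_up (E := E) yg
  obtain ⟨g2, l2, a2⟩ := exists_nb_dn (E := E) yg
  refine two_core o (cB := fun _ => 0) (sub_pos.2 l1) (sub_pos.2 l2)
    (TwoSh.mk' o.toOpt3 hlr hrn hf hl hr hB hB1 hB2 a1 l1 a2 l2)
    (TwoSh.zero w.rb) ?_ ?_ (i0 := r) (by omega) (by rw [cI_in ⟨hlr, le_rfl⟩]; norm_num)
  · intro i hi hc h
    by_cases hin : l < i ∧ i ≤ r
    · rw [cI_in hin, hf i hin.1 hin.2]
      rw [hf i hin.1 hin.2] at h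
      have := a1.add1.le_of_lt (by linarith) (w.1 i hi).yb (lt_of_le_of_ne h (ht i hin.1 hin.2 hc).1.symm)
      constructor <;> linarith
    · rw [cI_out hin]; constructor <;> linarith
  · intro i hi hc h
    by_cases hin : l < i ∧ i ≤ r
    · rw [cI_in hin, hf i hin.1 hin.2]
      rw [hf i hin.1 hin.2] at h
      have hlt : (u i).b2 + 1 < g := lt_of_le_of_ne h (fun he => (ht i hin.1 hin.2 hc).2 (by linarith))
      have := a2.ge_of_gt l2 (E.Yp _ (w.1 i hi).yb) hlt
      constructor <;> linarith
    · rw [cI_out hin]; constructor <;> linarith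

theorem d_pair {n u} (o : Opt E n u) {l r l' r' j1 j2 : ℕ} {g : ℝ} (hlr : l < r) (hrn : r < n)
    (hf : ∀ i, l < i → i ≤ r → (u i).a2 = g) (hl : (u l).a2 ≠ g) (hr : (u (r + 1)).a2 ≠ g)
    (hlr' : l' < r') (hrn' : r' < n)
    (hf' : ∀ i, l' < i → i ≤ r' → (u i).b2 = g + 1) (hl' : (u l').b2 ≠ g + 1) (hr' : (u (r' + 1)).b2 ≠ g + 1)
    (hB : g ∉ E.B) (hB1 : g - 1 ∉ E.B) (hB2 : g + 1 ∉ E.B) (hB3 : g + 2 ∉ E.B)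
    (win : Win n u j1 j2) (w1 : l < j1) (w2 : j2 ≤ r) (w3 : l' < j1) (w4 : j2 ≤ r') : False := by
  have w := o.walk
  have wlt := win.lt
  have yg : g ∈ E.Y := by rw [← hf r hlr le_rfl]; exact (w.1 r (by omega)).ya
  obtain ⟨g1, l1, a1⟩ := exists_nb_up (E := E) yg
  obtain ⟨g2, l2, a2⟩ := exists_nb_dn (E := E) yg
  have osw := (symm_sw E).opt3 o.toOpt3
  have hb1 : (u j1).b2 = g + 1 := hf' _ w3 (by omega)
  have ha1 : (u j1).a2 = g := hf _ w1 (by omega)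
  -- uniqueness of tight contacts
  have fA : ∀ i, l + 1 ≤ i → i ≤ r → (u i).a2 = g := fun i h1 h2 => hf i h1 h2
  have fB : ∀ i, l' + 1 ≤ i → i ≤ r' → ((fun i => (u i).sw) i).a2 = g + 1 := fun i h1 h2 => hf' i h1 h2
  have uA : ∀ m, l < m → m ≤ r → Con u n m → (u m).b2 = g + 1 → j1 ≤ m ∧ m ≤ j2 := fun m m1 m2 hc hm =>
    unique_above o.toOpt3 fA win w1 w2 (by rw [hb1]; exact near_tight hB hB2) (by omega) m1 m2 hc
      (by rw [hm]; exact near_tight hB hB2)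
  have uB : ∀ m, l' < m → m ≤ r' → Con u n m → (u m).a2 = g → j1 ≤ m ∧ m ≤ j2 := fun m m1 m2 hc hm =>
    unique_below osw fB win.sw w3 w4 (by simp only [Cfg.sw_b2]; rw [ha1]; exact near_tight hB hB2) (by omega) m1 m2 (Con_sw hc)
      (by simp only [Cfg.sw_b2]; rw [hm]; exact near_tight hB hB2)
  have nA : ∀ m, l < m → m ≤ r → Con u n m → (u m).b2 ≠ g - 1 := by
    intro m m1 m2 hc hm
    have hn : near E (u m).b2 (u m).a2 := by
      rw [hf m m1 m2, hm]
      have := near_tight (E := E) (g := g - 1) hB1 (by rwa [sub_add_cancel])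
      rwa [sub_add_cancel] at this
    obtain ⟨i, j, s1, s2, win'⟩ := CW_below o.toOpt3 (by omega) hn hc
    obtain ⟨t1, t2⟩ := win'.inside hl hr m1 m2 s1 s2 (hf m m1 m2)
    exact two_sided_hi o.toOpt3 win' win fA t1 t2 w1 w2 ((win'.hb m s1 s2).symm.trans hm) hb1 hB3 hB1 hB hB2
  have nB : ∀ m, l' < m → m ≤ r' → Con u n m → (u m).a2 ≠ g + 2 := by
    intro m m1 m2 hc hm
    have hn : near E (u m).b2 (u m).a2 := by
      rw [hf' m m1 m2, hm]
      have := near_tight (E := E) (g := g + 1) hB2 (by rwa [show g + 1 + 1 = g + 2 by ring])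
      rwa [show g + 1 + 1 = g + 2 by ring] at this
    obtain ⟨i, j, s1, s2, win'⟩ := CW_below o.toOpt3 (by omega) hn hc
    obtain ⟨t1, t2⟩ := win'.sw.inside (l := l') (r := r') (g := g + 1) hl' hr' m1 m2 s1 s2 (hf' m m1 m2)
    exact two_sided_lo osw win.sw win'.sw fB w3 w4 t1 t2 (by simp only [Cfg.sw_b2]; rw [ha1]; ring)
      (by simp only [Cfg.sw_b2]; rw [show g + 1 + 1 = g + 2 by ring]; exact (win'.ha m s1 s2).symm.trans hm)
      (by rwa [show g + 1 - 2 = g - 1 by ring]) (by rwa [show g + 1 - 1 = g by ring]) hB2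
      (by rwa [show g + 1 + 1 = g + 2 by ring])
  have TB := TwoSh.mk' osw (l := l') (r := r') (g := g + 1) (g1 := g1 + 1) (g2 := g2 + 1) hlr' hrn' hf' hl' hr' hB2
    (by rwa [show g + 1 - 1 = g by ring]) (by rwa [show g + 1 + 1 = g + 2 by ring]) a1.add1 (by linarith) a2.add1
    (by linarith)
  rw [show g1 + 1 - (g + 1) = g1 - g by ring, show g + 1 - (g2 + 1) = g - g2 by ring] at TB
  refine two_core o (sub_pos.2 l1) (sub_pos.2 l2)
    (TwoSh.mk' o.toOpt3 hlr hrn hf hl hr hB hB1 hB2 a1 l1 a2 l2) TB ?_ ?_ (i0 := r) (by omega)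
    (by rw [cI_in ⟨hlr, le_rfl⟩]; norm_num)
  · intro i hi hc h
    have yb := (w.1 i hi).yb
    have ya := (w.1 i hi).ya
    by_cases hin : l < i ∧ i ≤ r
    · have e := hf i hin.1 hin.2
      rw [cI_in hin, e]
      rw [e] at h
      by_cases hin' : l' < i ∧ i ≤ r'
      · rw [cI_in hin', hf' i hin'.1 hin'.2]; constructor <;> linarith
      · rw [cI_out hin']
        have hne : (u i).b2 ≠ g + 1 := by
          intro he
          have := uA i hin.1 hin.2 hc he
          omega
        have := a1.add1.le_of_lt (by linarith) yb (lt_of_le_of_ne h hne.symm)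
        constructor <;> linarith
    · rw [cI_out hin]
      by_cases hin' : l' < i ∧ i ≤ r'
      · have e := hf' i hin'.1 hin'.2
        rw [cI_in hin', e]
        rw [e] at h
        have hne : (u i).a2 ≠ g := by
          intro he
          have := uB i hin'.1 hin'.2 hc he
          omega
        have := a2.ge_of_gt l2 ya (lt_of_le_of_ne (by linarith) hne)
        constructor <;> linarith
      · rw [cI_out hin']; constructor <;> linarith
  · intro i hi hc h
    have yb := (w.1 i hi).yb
    have ya := (w.1 i hi).ya
    by_cases hin : l < i ∧ i ≤ r
    · have e := hf i hin.1 hin.2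
      rw [cI_in hin, e]
      rw [e] at h
      by_cases hin' : l' < i ∧ i ≤ r'
      · rw [hf' i hin'.1 hin'.2] at h; linarith
      · rw [cI_out hin']
        have hlt : (u i).b2 + 1 < g := lt_of_le_of_ne h (fun he => nA i hin.1 hin.2 hc (by linarith))
        have := a2.ge_of_gt l2 (E.Yp _ yb) hlt
        constructor <;> linarith
    · rw [cI_out hin]
      by_cases hin' : l' < i ∧ i ≤ r'
      · have e := hf' i hin'.1 hin'.2
        rw [cI_in hin', e]
        rw [e] at h
        have hne : (u i).a2 ≠ g + 1 + 1 := by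
          intro he
          exact nB i hin'.1 hin'.2 hc (by linarith)
        have := a1.add1.add1.le_of_lt (by linarith) ya (lt_of_le_of_ne h hne.symm)
        constructor <;> linarith
      · rw [cI_out hin']; constructor <;> linarith

end TR

namespace TR

variable {E : Env}

theorem Wk.sw {e e' c k p q} (h : Wk E e e' c k p q) : Wk E e.sw e'.sw c k p q := by
  have s := symm_sw E
  induction h with
  | nil e he => exact Wk.nil _ (s.grid _ he)
  | cons e f g c k p q hg hs hw ih =>
    have := Wk.cons _ _ _ _ _ _ _ (s.grid _ hg) (s.step _ _ hs) ih
    rw [s.cost, s.kk, s.pp] at this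
    have e : qq E e.sw f.sw = qq E e f := by simp [qq]; ring
    rwa [e] at this

theorem Opt.sw {n u} (o : Opt E n u) : Opt E n (fun i => (u i).sw) := by
  have s := symm_sw E
  refine ⟨s.opt3 o.toOpt3, ?_⟩
  intro c k p q hw h1 h2 h3
  have e : ∀ i, qq E (u i).sw (u (i + 1)).sw = qq E (u i) (u (i + 1)) := by
    intro i; simp [qq]; ring
  simp only [s.cost, s.kk, s.pp, e] at *
  have := hw.sw
  rw [s.inv, s.inv] at this
  exact o.minq _ _ _ _ this h1 h2 h3

def Good (E : Env) (v : ℝ) : Prop :=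
  v ∈ E.B ∨ v - 1 ∈ E.B ∨ v + 1 ∈ E.B ∨ v - 2 ∈ E.B ∨ v + 2 ∈ E.B

theorem Opt.goodA {n u} (o : Opt E n u) {i : ℕ} (hi : i ≤ n) : Good E (u i).a2 := by
  by_contra hbad
  set v := (u i).a2 with hv
  simp only [Good, not_or] at hbad
  obtain ⟨b0, b1, b2, b3, b4⟩ := hbad
  have w := o.walk
  have ne : ∀ {z : ℝ} (g : ℝ), z ∈ E.B → g ∉ E.B → z ≠ g := fun g h1 h2 h => h2 (h ▸ h1)
  obtain ⟨l, r, p1, p2, p3, hf, hl, hr⟩ := plateau (f := fun i => (u i).a2) (g := v)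
    (ne v o.a0 b0) (ne v o.an b0) hi rfl
  by_cases t1 : ∃ m, l < m ∧ m ≤ r ∧ Con u n m ∧ (u m).b2 = v + 1
  · obtain ⟨m, m1, m2, hc, hm⟩ := t1
    have hn : near E (u m).a2 (u m).b2 := by rw [hf m m1 m2, hm]; exact near_tight b0 b2
    obtain ⟨j1, j2, s1, s2, win⟩ := CW o.toOpt3 (by omega) hn hc
    obtain ⟨t1, t2⟩ := win.inside hl hr m1 m2 s1 s2 (hf m m1 m2)
    obtain ⟨l', r', q1, q2, q3, hf', hl', hr'⟩ := plateau (f := fun i => (u i).b2) (g := v + 1)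
      (ne _ o.b0 b2) (ne _ o.bn b2) (i0 := m) (by omega) hm
    obtain ⟨t3, t4⟩ := win.sw.inside (l := l') (r := r') (g := v + 1) hl' hr' q1 q2 s1 s2 hm
    exact d_pair o (by omega) p3 hf hl hr (by omega) q3 hf' hl' hr' b0 b1 b2 b4 win t1 t2 t3 t4
  by_cases t2 : ∃ m, l < m ∧ m ≤ r ∧ Con u n m ∧ (u m).b2 = v - 1
  · obtain ⟨m, m1, m2, hc, hm⟩ := t2
    have hn : near E (u m).b2 (u m).a2 := by
      rw [hf m m1 m2, hm]
      have := near_tight (E := E) (g := v - 1) b1 (by rwa [sub_add_cancel])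
      rwa [sub_add_cancel] at this
    obtain ⟨j1, j2, s1, s2, win⟩ := CW_below o.toOpt3 (by omega) hn hc
    obtain ⟨t1, t2⟩ := win.inside hl hr m1 m2 s1 s2 (hf m m1 m2)
    obtain ⟨l', r', q1, q2, q3, hf', hl', hr'⟩ := plateau (f := fun i => (u i).b2) (g := v - 1)
      (ne _ o.b0 b1) (ne _ o.bn b1) (i0 := m) (by omega) hm
    obtain ⟨t3, t4⟩ := win.sw.inside (l := l') (r := r') (g := v - 1) hl' hr' q1 q2 s1 s2 hm
    refine d_pair o.sw (g := v - 1) (l := l') (r := r') (l' := l) (r' := r) (by omega) q3 hf' hl' hr' (by omega) p3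
      (by simpa using hf) (by simpa using hl) (by simpa using hr) b1 (by rwa [show v - 1 - 1 = v - 2 by ring])
      (by rwa [sub_add_cancel]) (by rwa [show v - 1 + 2 = v + 1 by ring]) win.sw t3 t4 t1 t2
  · exact d_single o (by omega) p3 hf hl hr b0 b1 b2 (fun m m1 m2 hc =>
      ⟨fun h => t1 ⟨m, m1, m2, hc, h⟩, fun h => t2 ⟨m, m1, m2, hc, h⟩⟩)

theorem Opt.good {n u} (o : Opt E n u) {i : ℕ} (hi : i ≤ n) : Good E (u i).a2 ∧ Good E (u i).b2 :=
  ⟨o.goodA hi, o.sw.goodA hi⟩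

theorem pwo_min {α : Type*} [Preorder α] {T : Set α} (h : T.IsPWO) (hne : T.Nonempty) {f : α → ℝ}
    (hf : Monotone f) : ∃ x ∈ T, ∀ y ∈ T, f x ≤ f y := by
  obtain ⟨i, hi⟩ := Set.IsPWO.exists_minimalFor f T (h.image_of_monotone hf) hne
  refine ⟨i, hi.1, fun y hy => ?_⟩
  rcases le_total (f i) (f y) with hh | hh
  · exact hh
  · exact hi.2 hy hh

theorem exists_opt (hfin : {e | Grid E e}.Finite) {e e' : Cfg} {c k p q} (h : Wk E e e' c k p q)
    (ha : e.a2 ∈ E.B) (hb : e.b2 ∈ E.B) (ha' : e'.a2 ∈ E.B) (hb' : e'.b2 ∈ E.B) :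
    ∃ n u, Opt E n u ∧ u 0 = e ∧ u n = e' ∧ ∑ l ∈ Finset.range n, cost (u l) (u (l + 1)) ≤ c := by
  set S : Set (ℝ × ℝ × ℝ × ℝ) := (fun z : Cfg × Cfg => (cost z.1 z.2, (kk z.1 z.2 : ℝ), pp E z.1 z.2, qq E z.1 z.2)) ''
    ({e | Grid E e} ×ˢ {e | Grid E e}) with hS
  have hpwo : ((AddSubmonoid.closure S : AddSubmonoid _) : Set (ℝ × ℝ × ℝ × ℝ)).IsPWO := by
    refine Set.IsPWO.addSubmonoid_closure ?_ ((hfin.prod hfin).image _).isPWO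
    rintro _ ⟨⟨x, y⟩, ⟨h1, h2⟩, rfl⟩
    exact ⟨cost_nonneg _ _, Nat.cast_nonneg _, pp_nonneg h1 h2, qq_nonneg h1 h2⟩
  set T : Set (ℝ × ℝ × ℝ × ℝ) := {z | ∃ k : ℕ, z.2.1 = k ∧ Wk E e e' z.1 k z.2.2.1 z.2.2.2} with hT
  have sub : ∀ {e e' c k p q}, Wk E e e' c k p q → ((c, (k : ℝ), p, q) : ℝ × ℝ × ℝ × ℝ) ∈ AddSubmonoid.closure S := by
    intro e e' c k p q h
    induction h with
    | nil e he =>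
      rw [Nat.cast_zero]
      exact (AddSubmonoid.closure S).zero_mem
    | cons e f g c k p q hg hs hw ih =>
      have := AddSubmonoid.add_mem _ (AddSubmonoid.subset_closure (s := S) ⟨(e, f), ⟨hg, hw.gridL⟩, rfl⟩) ih
      simpa using this
  have T0 : T.IsPWO := hpwo.mono (by
    rintro ⟨c, k', p, q⟩ ⟨k, rfl, hw⟩
    exact sub hw)
  obtain ⟨z1, m1, n1⟩ := pwo_min T0 ⟨(c, (k : ℝ), p, q), ⟨k, rfl, h⟩⟩ (f := fun z => z.1) (fun _ _ h => h.1)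
  obtain ⟨z2, m2, n2⟩ := pwo_min (T0.mono (inter_subset_left (t := {z : ℝ × ℝ × ℝ × ℝ | z.1 ≤ z1.1}))) ⟨z1, mem_inter m1 (le_refl z1.1)⟩
    (f := fun z => z.2.1) (fun _ _ h => h.2.1)
  obtain ⟨z3, m3, n3⟩ := pwo_min (T0.mono (inter_subset_left (t := {z : ℝ × ℝ × ℝ × ℝ | z.1 ≤ z1.1 ∧ z.2.1 ≤ z2.2.1})))
    ⟨z2, mem_inter m2.1 ⟨m2.2, le_refl z2.2.1⟩⟩ (f := fun z => z.2.2.1) (fun _ _ h => h.2.2.1)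
  obtain ⟨z4, m4, n4⟩ := pwo_min (T0.mono (inter_subset_left (t := {z : ℝ × ℝ × ℝ × ℝ | z.1 ≤ z1.1 ∧ z.2.1 ≤ z2.2.1 ∧ z.2.2.1 ≤ z3.2.2.1})))
    ⟨z3, mem_inter m3.1 ⟨m3.2.1, m3.2.2, le_refl z3.2.2.1⟩⟩ (f := fun z => z.2.2.2) (fun _ _ h => h.2.2.2)
  obtain ⟨⟨K, hK, hw⟩, g1, g2, g3⟩ := m4
  obtain ⟨n, u, hu, u0, un, ec, ek, ep, eq⟩ := hw.toWalk
  have l1 := n1 (c, (k : ℝ), p, q) ⟨k, rfl, h⟩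
  refine ⟨n, u, ⟨⟨hu, by rwa [u0], by rwa [u0], by rwa [un], by rwa [un], ?_⟩, ?_⟩, u0, un, ?_⟩
  · intro c' k' p' q' hw'
    rw [u0, un] at hw'
    rw [← ec, ← ek, ← ep]
    have i1 : ((c', (k' : ℝ), p', q') : ℝ × ℝ × ℝ × ℝ) ∈ T := ⟨k', rfl, hw'⟩
    refine ⟨g1.trans (n1 _ i1), fun hc => ?_⟩
    have i2 := n2 _ ⟨i1, le_trans hc g1⟩
    have g2' : (K : ℝ) ≤ k' := by rw [← hK]; exact le_trans g2 i2
    refine ⟨by exact_mod_cast g2', fun hk => ?_⟩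
    have hk' : (k' : ℝ) ≤ z2.2.1 := le_trans (by rw [hK]; exact_mod_cast hk) g2
    exact le_trans g3 (n3 _ ⟨i1, le_trans hc g1, hk'⟩)
  · intro c' k' p' q' hw' hc hk hp
    rw [u0, un] at hw'
    rw [← eq]
    rw [← ec] at hc
    rw [← ek] at hk
    rw [← ep] at hp
    have i1 : ((c', (k' : ℝ), p', q') : ℝ × ℝ × ℝ × ℝ) ∈ T := ⟨k', rfl, hw'⟩
    have hk' : (k' : ℝ) ≤ z2.2.1 := le_trans (by rw [hK]; exact_mod_cast hk) g2
    exact n4 _ ⟨i1, le_trans hc g1, hk', le_trans hp g3⟩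
  · rw [← ec]; exact le_trans g1 l1

theorem yphase (hfin : {e | Grid E e}.Finite) {e e' : Cfg} {c k p q} (h : Wk E e e' c k p q)
    (ha : e.a2 ∈ E.B) (hb : e.b2 ∈ E.B) (ha' : e'.a2 ∈ E.B) (hb' : e'.b2 ∈ E.B) :
    ∃ n u, Walk E n u ∧ u 0 = e ∧ u n = e' ∧ ∑ l ∈ Finset.range n, cost (u l) (u (l + 1)) ≤ c ∧
      ∀ i ≤ n, Good E (u i).a2 ∧ Good E (u i).b2 := by
  obtain ⟨n, u, o, h0, hn, hc⟩ := exists_opt hfin h ha hb ha' hb'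
  exact ⟨n, u, o.walk, h0, hn, hc, fun i hi => o.good hi⟩

end TR

namespace TR

/-- Concrete properties of the free space, seen in vertical direction. -/
structure HG (F : ℝ → ℝ → Prop) (X0 Y0 B : Set ℝ) : Prop where
  fX : X0.Finite
  fY : Y0.Finite
  fB : B.Finite
  closed : IsClosed {p : ℝ × ℝ | F p.1 p.2}
  bdd : ∃ R, ∀ x y, F x y → |y| ≤ R
  gap : ∀ x y y', F x y → F x y' → |y - y'| ≤ 1 → VSeg F x y y'
  yU : ∀ x y z, F x y → y < z → (∀ w ∈ Y0, ¬ (y ≤ w ∧ w < z)) → F x z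
  yD : ∀ x y z, F x y → z < y → (∀ w ∈ Y0, ¬ (z < w ∧ w ≤ y)) → F x z
  xR : ∀ x y z, F x y → x < z → (∀ w ∈ X0, ¬ (x ≤ w ∧ w < z)) → F z y
  xL : ∀ x y z, F x y → z < x → (∀ w ∈ X0, ¬ (z < w ∧ w ≤ x)) → F z y
  edge : ∀ p q e e', p < q → e ≠ e' → (∀ t ∈ Icc p q, F t e) →
    (∀ t ∈ Icc p q, ∀ s, (e < s ∧ s < e') ∨ (e' < s ∧ s < e) → ¬ F t s) → e ∈ B

theorem fin_next {S : Set ℝ} (h : S.Finite) (y : ℝ) : ∃ z, y < z ∧ ∀ w ∈ S, ¬ (y < w ∧ w < z) := by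
  by_cases hn : (S ∩ Ioi y).Nonempty
  · obtain ⟨m, hm, hm'⟩ := exists_min_image _ id (h.subset inter_subset_left) hn
    exact ⟨m, hm.2, fun w hw hh => absurd (hm' w ⟨hw, hh.1⟩) (not_le.2 hh.2)⟩
  · exact ⟨y + 1, by linarith, fun w hw hh => hn ⟨w, hw, hh.1⟩⟩

theorem fin_prev {S : Set ℝ} (h : S.Finite) (y : ℝ) : ∃ z, z < y ∧ ∀ w ∈ S, ¬ (z < w ∧ w < y) := by
  by_cases hn : (S ∩ Iio y).Nonempty
  · obtain ⟨m, hm, hm'⟩ := exists_max_image _ id (h.subset inter_subset_left) hn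
    exact ⟨m, hm.2, fun w hw hh => absurd (hm' w ⟨hw, hh.2⟩) (not_le.2 hh.1)⟩
  · exact ⟨y - 1, by linarith, fun w hw hh => hn ⟨w, hw, hh.2⟩⟩

theorem HG.flip {F X0 Y0 B} (h : HG F X0 Y0 B) :
    HG (fun x y => F x (-y)) X0 {y | -y ∈ Y0} {y | -y ∈ B} where
  fX := h.fX
  fY := h.fY.preimage (f := fun y : ℝ => -y) (neg_injective.injOn)
  fB := h.fB.preimage (f := fun y : ℝ => -y) (neg_injective.injOn)
  closed := h.closed.preimage (f := fun p : ℝ × ℝ => (p.1, -p.2)) (by fun_prop)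
  bdd := by
    obtain ⟨R, hR⟩ := h.bdd
    exact ⟨R, fun x y hh => by simpa using hR _ _ hh⟩
  gap := by
    intro x y y' h1 h2 h3 t ht
    refine h.gap x _ _ h1 h2 ?_ (-t) ?_
    · rw [← abs_neg]; convert h3 using 2; ring
    · simp only [mem_uIcc] at *; grind
  yU := by
    intro x y z h1 h2 h3
    refine h.yD x _ _ h1 (by linarith) (fun w hw hh => h3 (-w) (by simpa using hw) ⟨by linarith, by linarith⟩)
  yD := by
    intro x y z h1 h2 h3
    refine h.yU x _ _ h1 (by linarith) (fun w hw hh => h3 (-w) (by simpa using hw) ⟨by linarith, by linarith⟩)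
  xR := fun x y z h1 h2 h3 => h.xR x _ z h1 h2 h3
  xL := fun x y z h1 h2 h3 => h.xL x _ z h1 h2 h3
  edge := by
    intro p q e e' h1 h2 h3 h4
    refine h.edge p q (-e) (-e') h1 (by simpa using h2) h3 (fun t ht s hs hF => ?_)
    exact h4 t ht (-s) (by rcases hs with hs | hs; right; constructor <;> linarith; left; constructor <;> linarith)
      (by simpa using hF)

theorem HG.rise0 {F X0 Y0 B} (h : HG F X0 Y0 B) {x x' y z : ℝ} (hyz : y ≤ z) (hx : x < x')
    (hs : ∀ t ∈ Icc x x', F t y) (hb : ∀ b ∈ B, ¬ (y ≤ b ∧ b < z)) :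
    ∀ t ∈ Icc x x', ∀ s ∈ Icc y z, F t s := by
  set S : Set ℝ := {e | e ∈ Icc y z ∧ ∀ s ∈ Icc y e, ∀ t ∈ Icc x x', F t s} with hS
  have yS : y ∈ S := ⟨⟨le_rfl, hyz⟩, fun s hs' t ht => by
    rw [le_antisymm hs'.2 hs'.1]; exact hs t ht⟩
  have bS : BddAbove S := ⟨z, fun e he => he.1.2⟩
  set e := sSup S with he
  have ye : y ≤ e := le_csSup bS yS
  have ez : e ≤ z := csSup_le ⟨y, yS⟩ (fun w hw => hw.1.2)
  have below : ∀ s, y ≤ s → s < e → ∀ t ∈ Icc x x', F t s := by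
    intro s h1 h2 t ht
    obtain ⟨w, hw, hw'⟩ := exists_lt_of_lt_csSup ⟨y, yS⟩ h2
    exact hw.2 s ⟨h1, hw'.le⟩ t ht
  have ate : ∀ t ∈ Icc x x', F t e := by
    intro t ht
    rcases ye.eq_or_lt with h0 | h0
    · rw [← h0]; exact hs t ht
    · have hc : IsClosed {s : ℝ | F t s} := h.closed.preimage (f := fun s : ℝ => (t, s)) (by fun_prop)
      have : Icc y e ⊆ {s : ℝ | F t s} := by
        rw [← closure_Ico h0.ne]
        exact closure_minimal (fun s hs' => below s hs'.1 hs'.2 t ht) hc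
      exact this ⟨ye, le_rfl⟩
  have all : ∀ s ∈ Icc y e, ∀ t ∈ Icc x x', F t s := by
    intro s hs' t ht
    rcases hs'.2.eq_or_lt with h0 | h0
    · rw [h0]; exact ate t ht
    · exact below s hs'.1 h0 t ht
  rcases ez.eq_or_lt with h0 | h0
  · intro t ht s hs'; rw [← h0] at hs'; exact all s hs' t ht
  exfalso
  obtain ⟨g0, hg0, hg0'⟩ := fin_next h.fY e
  set g := min g0 z with hg
  have eg : e < g := lt_min hg0 h0
  have nog : ∀ w ∈ Y0, ¬ (e < w ∧ w < g) := fun w hw hh => hg0' w hw ⟨hh.1, hh.2.trans_le (min_le_left _ _)⟩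
  have tr : ∀ t s s', e < s → s < g → e < s' → s' < g → F t s → F t s' := by
    intro t s s' h1 h2 h3 h4 h5
    rcases lt_trichotomy s s' with hh | hh | hh
    · exact h.yU t s s' h5 hh (fun w hw hw' => nog w hw ⟨by linarith, by linarith⟩)
    · rwa [← hh]
    · exact h.yD t s s' h5 hh (fun w hw hw' => nog w hw ⟨by linarith, by linarith⟩)
  obtain ⟨m, hm1, hm2⟩ := exists_between eg
  by_cases hall : ∀ t ∈ Icc x x', F t m
  · have : m ∈ S := by
      refine ⟨⟨by linarith, by have := min_le_right g0 z; linarith⟩, fun s hs' t ht => ?_⟩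
      by_cases hse : s ≤ e
      · exact all s ⟨hs'.1, hse⟩ t ht
      · exact tr t m s hm1 hm2 (not_le.1 hse) (by linarith [hs'.2]) (hall t ht)
    exact absurd (le_csSup bS this) (not_le.2 hm1)
  · push Not at hall
    obtain ⟨t0, ht0, hn0⟩ := hall
    obtain ⟨p, q, hpq, hsub, hno⟩ : ∃ p q, p < q ∧ Icc p q ⊆ Icc x x' ∧ ∀ t ∈ Icc p q, ¬ F t m := by
      rcases ht0.2.eq_or_lt with h1 | h1
      · obtain ⟨r, hr, hr'⟩ := fin_prev h.fX t0
        set r' := max r x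
        have hr1 : r' < t0 := max_lt hr (by linarith)
        obtain ⟨p, hp1, hp2⟩ := exists_between hr1
        refine ⟨p, t0, hp2, fun t ht => ⟨by have := le_max_right r x; linarith [ht.1], by linarith [ht.2]⟩, fun t ht hF => ?_⟩
        rcases ht.2.eq_or_lt with h2 | h2
        · rw [h2] at hF; exact hn0 hF
        · exact hn0 (h.xR t m t0 hF h2 (fun w hw hh => hr' w hw ⟨by have := le_max_left r x; linarith [ht.1], hh.2⟩))
      · obtain ⟨r, hr, hr'⟩ := fin_next h.fX t0
        set r' := min r x'
        have hr1 : t0 < r' := lt_min hr h1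
        obtain ⟨p, hp1, hp2⟩ := exists_between hr1
        refine ⟨t0, p, hp1, fun t ht => ⟨by linarith [ht.1, ht0.1], by have := min_le_right r x'; linarith [ht.2]⟩, fun t ht hF => ?_⟩
        rcases ht.1.eq_or_lt with h2 | h2
        · rw [← h2] at hF; exact hn0 hF
        · exact hn0 (h.xL t m t0 hF h2 (fun w hw hh => hr' w hw ⟨hh.1, by have := min_le_left r x'; linarith [ht.2]⟩))
    have := h.edge p q e g hpq eg.ne (fun t ht => ate t (hsub ht)) (fun t ht s hs' hF => by
      rcases hs' with hs' | hs'
      · exact hno t ht (tr t s m hs'.1 hs'.2 hm1 hm2 hF)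
      · linarith [hs'.1, hs'.2])
    exact hb e this ⟨ye, h0⟩

theorem HG.rise {F X0 Y0 B} (h : HG F X0 Y0 B) (x x' y z : ℝ) (hyz : y ≤ z) (hx : x ≠ x')
    (hs : HSeg F y x x') (hb : ∀ b ∈ B, ¬ (y ≤ b ∧ b < z)) : ∀ t ∈ uIcc x x', VSeg F t y z := by
  intro t ht s hs'
  rw [uIcc_of_le hyz] at hs'
  exact h.rise0 (x := min x x') (x' := max x x') hyz (min_lt_max.2 hx) hs hb t ht s hs'

theorem HG.fall {F X0 Y0 B} (h : HG F X0 Y0 B) (x x' y z : ℝ) (hyz : z ≤ y) (hx : x ≠ x')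
    (hs : HSeg F y x x') (hb : ∀ b ∈ B, ¬ (z < b ∧ b ≤ y)) : ∀ t ∈ uIcc x x', VSeg F t y z := by
  intro t ht s hs'
  have := h.flip.rise x x' (-y) (-z) (by linarith) hx (fun t ht => by simpa using hs t ht)
    (fun b hb' hh => hb (-b) hb' ⟨by linarith, by linarith⟩) t ht (-s) (by
      simp only [mem_uIcc] at *; grind)
  simpa using this

/-- the lattice generated by a set -/
def Lat (S : Set ℝ) : Set ℝ := {y | ∃ n : ℤ, y + n ∈ S}

theorem Lat.fin {S : Set ℝ} (h : S.Finite) (a b : ℝ) : (Lat S ∩ Icc a b).Finite := by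
  have : Lat S ∩ Icc a b ⊆ ⋃ w ∈ S, (fun n : ℤ => w - n) '' (Icc ⌊w - b⌋ ⌈w - a⌉) := by
    rintro y ⟨⟨n, hn⟩, h1, h2⟩
    simp only [mem_iUnion]
    refine ⟨y + n, hn, n, ⟨?_, ?_⟩, by simp⟩
    · have := Int.floor_le (y + n - b)
      have : ((⌊y + n - b⌋ : ℤ) : ℝ) ≤ n := by linarith
      exact_mod_cast this
    · have := Int.le_ceil (y + n - a)
      have : (n : ℝ) ≤ (⌈y + n - a⌉ : ℤ) := by linarith
      exact_mod_cast this
  exact (h.biUnion (fun w _ => (finite_Icc _ _).image _)).subset this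

theorem Lat.sub {S : Set ℝ} : S ⊆ Lat S := fun y hy => ⟨0, by simpa using hy⟩

def HG.env {F X0 Y0 B} (h : HG F X0 Y0 B) (X Z : Set ℝ) (hZ : Z.Finite) : Env where
  F := F
  X := X
  Y := Lat (Y0 ∪ B ∪ Z)
  B := B
  C := 4 * h.bdd.choose + 1
  R := h.bdd.choose
  bdd := h.bdd.choose_spec
  hC := le_rfl
  gap := h.gap
  BY := fun b hb => Lat.sub (Or.inl (Or.inr hb))
  Yp := by
    rintro y ⟨n, hn⟩
    exact ⟨n - 1, by push_cast; convert hn using 1; ring⟩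
  Ym := by
    rintro y ⟨n, hn⟩
    exact ⟨n + 1, by push_cast; convert hn using 1; ring⟩
  succ := by
    rintro y ⟨n, hn⟩
    have hf := (Lat.fin ((h.fY.union h.fB).union hZ) y (y + 1)).subset (inter_subset_inter_right _ Ioc_subset_Icc_self)
    obtain ⟨m, hm, hm'⟩ := exists_min_image _ id hf ⟨y + 1, ⟨n - 1, by push_cast; convert hn using 1; ring⟩, by linarith, le_rfl⟩
    refine ⟨m, hm.1, hm.2.1, fun w hw hh => absurd (hm' w ⟨hw, hh.1, by linarith [hm.2.2]⟩) (not_le.2 hh.2)⟩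
  pred := by
    rintro y ⟨n, hn⟩
    have hf := (Lat.fin ((h.fY.union h.fB).union hZ) (y - 1) y).subset (inter_subset_inter_right _ Ico_subset_Icc_self)
    obtain ⟨m, hm, hm'⟩ := exists_max_image _ id hf ⟨y - 1, ⟨n + 1, by push_cast; convert hn using 1; ring⟩, le_rfl, by linarith⟩
    refine ⟨m, hm.1, hm.2.2, fun w hw hh => absurd (hm' w ⟨hw, by linarith [hm.2.1], hh.2⟩) (not_le.2 hh.1)⟩
  colU := by
    intro x y hy z hz hyz hc t ht hs s hs'
    rw [uIcc_of_le hyz.le] at hs'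
    by_cases hst : s ≤ t
    · exact hs s (by rw [uIcc_of_le ht.le]; exact ⟨hs'.1, hst⟩)
    · exact h.yU x t s hs.right (not_le.1 hst) (fun w hw hh => hc w (Lat.sub (Or.inl (Or.inl hw)))
        ⟨by linarith, by linarith [hs'.2]⟩)
  colD := by
    intro x y hy z hz hyz hc t ht hs s hs'
    rw [uIcc_of_ge hyz.le] at hs'
    by_cases hst : t ≤ s
    · exact hs s (by rw [uIcc_of_ge ht.le]; exact ⟨hst, hs'.2⟩)
    · exact h.yD x t s hs.right (not_le.1 hst) (fun w hw hh => hc w (Lat.sub (Or.inl (Or.inl hw)))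
        ⟨by linarith [hs'.1], by linarith⟩)
  rise := h.rise
  fall := h.fall
  discU := fin_next h.fB
  discD := fin_prev h.fB

def GoodS (B : Set ℝ) (v : ℝ) : Prop := v ∈ B ∨ v - 1 ∈ B ∨ v + 1 ∈ B ∨ v - 2 ∈ B ∨ v + 2 ∈ B

/-- a plain walk -/
def PW (F : ℝ → ℝ → Prop) (n : ℕ) (u : ℕ → Cfg) : Prop :=
  (∀ i ≤ n, F (u i).a1 (u i).a2 ∧ F (u i).b1 (u i).b2) ∧ ∀ i < n, Step F (u i) (u (i + 1))

theorem HG.yphase {F X0 Y0 B} (h : HG F X0 Y0 B) {n u} (hw : PW F n u)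
    (ha : (u 0).a2 ∈ B) (hb : (u 0).b2 ∈ B) (ha' : (u n).a2 ∈ B) (hb' : (u n).b2 ∈ B)
    {T : Set ℝ} (hT : ∀ i ≤ n, (u i).a1 ∈ T ∧ (u i).b1 ∈ T) :
    ∃ n' u', PW F n' u' ∧ u' 0 = u 0 ∧ u' n' = u n ∧
      ∑ l ∈ Finset.range n', cost (u' l) (u' (l + 1)) ≤ ∑ l ∈ Finset.range n, cost (u l) (u (l + 1)) ∧
      ∀ i ≤ n', (GoodS B (u' i).a2 ∧ GoodS B (u' i).b2) ∧ (u' i).a1 ∈ T ∧ (u' i).b1 ∈ T := by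
  set X : Set ℝ := ((fun i => (u i).a1) '' Iic n) ∪ ((fun i => (u i).b1) '' Iic n) with hX
  have fX : X.Finite := ((finite_Iic n).image _).union ((finite_Iic n).image _)
  set Z : Set ℝ := ((fun i => (u i).a2) '' Iic n) ∪ ((fun i => (u i).b2) '' Iic n) with hZ
  have fZ : Z.Finite := ((finite_Iic n).image _).union ((finite_Iic n).image _)
  set E := h.env X Z fZ with hE
  have hfin : {e | Grid E e}.Finite := by
    set Yf := E.Y ∩ Icc (-E.R) E.R
    have fYf : Yf.Finite := Lat.fin ((h.fY.union h.fB).union fZ) _ _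
    refine ((fX.prod (fYf.prod (fX.prod fYf))).image (fun z => (⟨z.1, z.2.1, z.2.2.1, z.2.2.2⟩ : Cfg))).subset ?_
    intro e he
    refine ⟨(e.a1, e.a2, e.b1, e.b2), ⟨he.xa, ⟨he.ya, ?_⟩, he.xb, he.yb, ?_⟩, rfl⟩
    · exact abs_le.1 (E.bdd _ _ he.fa)
    · exact abs_le.1 (E.bdd _ _ he.fb)
  have hwalk : Walk E n u := by
    refine ⟨fun i hi => ⟨(hw.1 i hi).1, (hw.1 i hi).2, Or.inl ⟨i, hi, rfl⟩, Or.inr ⟨i, hi, rfl⟩, ?_, ?_⟩, hw.2⟩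
    · exact Lat.sub (Or.inr (Or.inl ⟨i, hi, rfl⟩))
    · exact Lat.sub (Or.inr (Or.inr ⟨i, hi, rfl⟩))
  obtain ⟨n', u', w', e0, en, hc, hg⟩ := TR.yphase hfin (hwalk.wk n le_rfl 0 (Nat.zero_le n)) ha hb ha' hb'
  rw [← Finset.range_eq_Ico] at hc
  have XT : X ⊆ T := by
    rintro x (⟨i, hi, rfl⟩ | ⟨i, hi, rfl⟩)
    · exact (hT i hi).1
    · exact (hT i hi).2
  exact ⟨n', u', ⟨fun i hi => ⟨(w'.1 i hi).fa, (w'.1 i hi).fb⟩, w'.2⟩, e0, en, hc,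
    fun i hi => ⟨hg i hi, XT (w'.1 i hi).xa, XT (w'.1 i hi).xb⟩⟩

def Cfg.tr (e : Cfg) : Cfg := ⟨e.a2, e.a1, e.b2, e.b1⟩

theorem RM.tr {F x y x' y'} (h : RM F x y x' y') : RM (fun x y => F y x) y x y' x' := by
  rcases h with ⟨rfl, h⟩ | ⟨rfl, h⟩
  · exact Or.inr ⟨rfl, h⟩
  · exact Or.inl ⟨rfl, h⟩

theorem Step.tr {F e e'} (h : Step F e e') : Step (fun x y => F y x) e.tr e'.tr :=
  ⟨h.1.tr, h.2.1.tr, h.2.2.symm⟩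

theorem cost_tr (e e' : Cfg) : cost e.tr e'.tr = cost e e' := by
  simp only [cost, Cfg.tr]; ring

theorem PW.tr {F n u} (h : PW F n u) : PW (fun x y => F y x) n (fun i => (u i).tr) :=
  ⟨h.1, fun i hi => (h.2 i hi).tr⟩

theorem phases {F X0 Y0 B X1 Y1 B'} (h : HG F X0 Y0 B) (h' : HG (fun x y => F y x) Y1 X1 B') {n u}
    (hw : PW F n u)
    (h0 : (u 0).a2 ∈ B ∧ (u 0).b2 ∈ B ∧ (u 0).a1 ∈ B' ∧ (u 0).b1 ∈ B')
    (hn : (u n).a2 ∈ B ∧ (u n).b2 ∈ B ∧ (u n).a1 ∈ B' ∧ (u n).b1 ∈ B') :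
    ∃ n' u', PW F n' u' ∧ u' 0 = u 0 ∧ u' n' = u n ∧
      ∑ l ∈ Finset.range n', cost (u' l) (u' (l + 1)) ≤ ∑ l ∈ Finset.range n, cost (u l) (u (l + 1)) ∧
      ∀ i ≤ n', GoodS B (u' i).a2 ∧ GoodS B (u' i).b2 ∧ GoodS B' (u' i).a1 ∧ GoodS B' (u' i).b1 := by
  obtain ⟨n1, u1, w1, a1, b1, c1, d1⟩ := h.yphase hw h0.1 h0.2.1 hn.1 hn.2.1 (T := univ) (fun _ _ => ⟨trivial, trivial⟩)
  obtain ⟨n2, u2, w2, a2, b2, c2, d2⟩ := h'.yphase w1.tr (T := {v | GoodS B v})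
    (by simpa [a1, Cfg.tr] using h0.2.2.1) (by simpa [a1, Cfg.tr] using h0.2.2.2)
    (by simpa [b1, Cfg.tr] using hn.2.2.1) (by simpa [b1, Cfg.tr] using hn.2.2.2)
    (fun i hi => (d1 i hi).1)
  refine ⟨n2, fun i => (u2 i).tr, w2.tr, ?_, ?_, ?_, ?_⟩
  · simp only [a2, a1]; rfl
  · simp only [b2, b1]; rfl
  · simp only [cost_tr] at c2 ⊢; exact c2.trans c1
  · intro i hi
    exact ⟨(d2 i hi).2.1, (d2 i hi).2.2, (d2 i hi).1.1, (d2 i hi).1.2⟩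

end TR

namespace TR

def Fc (S : Set (ℝ × ℝ)) (x y : ℝ) : Prop := (x, y) ∈ S

theorem linf_le {q : ℝ × ℝ} {r : ℝ} : linf q ≤ r ↔ |q.1| ≤ r ∧ |q.2| ≤ r := max_le_iff

theorem free_iff {W : Set (ℝ × ℝ)} {x y : ℝ} : Fc (freeSpace W) x y ↔
    ∀ u v, |u - x| ≤ 1 / 2 → |v - y| ≤ 1 / 2 → (u, v) ∈ W := by
  constructor
  · intro h u v hu hv
    have := h (u - x, v - y) (linf_le.2 ⟨hu, hv⟩)
    simpa using this
  · intro h q hq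
    have := linf_le.1 hq
    exact h (x + q.1) (y + q.2) (by simpa using this.1) (by simpa using this.2)

theorem free_closed {W : Set (ℝ × ℝ)} (hW : IsClosed W) : IsClosed (freeSpace W) := by
  have : freeSpace W = ⋂ q : ℝ × ℝ, ⋂ _ : linf q ≤ 1 / 2, (fun p => p + q) ⁻¹' W := by
    ext p; simp [freeSpace]
  rw [this]
  exact isClosed_iInter fun q => isClosed_iInter fun _ => hW.preimage (by fun_prop)

/-- union of finitely many closed boxes -/
def RectU (W : Set (ℝ × ℝ)) (Q : Set (ℝ × ℝ × ℝ × ℝ)) : Prop :=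
  Q.Finite ∧ ∀ u v, (u, v) ∈ W ↔ ∃ r ∈ Q, (r.1 ≤ u ∧ u ≤ r.2.1) ∧ (r.2.2.1 ≤ v ∧ v ≤ r.2.2.2)

theorem rectU_of {W : Set (ℝ × ℝ)} (𝓡 : Finset (Set (ℝ × ℝ))) (h : ∀ S ∈ 𝓡, IsClosedAxisRect S)
    (hW : W = ⋃ S ∈ 𝓡, S) : ∃ Q, RectU W Q := by
  choose! a b c d h1 h2 h3 using h
  refine ⟨(fun S => (a S, b S, c S, d S)) '' (𝓡 : Set (Set (ℝ × ℝ))), 𝓡.finite_toSet.image _, fun u v => ?_⟩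
  rw [hW]
  simp only [mem_iUnion, exists_prop, exists_mem_image, Finset.mem_coe]
  refine exists_congr fun S => and_congr_right fun hS => ?_
  constructor
  · intro h; rw [h3 S hS] at h; exact h
  · intro h; rw [h3 S hS]; exact h

theorem RectU.tr {W : Set (ℝ × ℝ)} {Q} (h : RectU W Q) :
    RectU (Prod.swap ⁻¹' W) ((fun r => (r.2.2.1, r.2.2.2, r.1, r.2.1)) '' Q) := by
  refine ⟨h.1.image _, fun u v => ?_⟩
  rw [mem_preimage, Prod.swap_prod_mk, h.2]
  simp only [exists_mem_image]
  refine exists_congr fun r => and_congr_right fun _ => and_comm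

def Yof (Q : Set (ℝ × ℝ × ℝ × ℝ)) : Set ℝ := (fun r => r.2.2.2 - 1 / 2) '' Q ∪ (fun r => r.2.2.1 + 1 / 2) '' Q
def Xof (Q : Set (ℝ × ℝ × ℝ × ℝ)) : Set ℝ := (fun r => r.2.1 - 1 / 2) '' Q ∪ (fun r => r.1 + 1 / 2) '' Q

section
variable {W : Set (ℝ × ℝ)} {Q : Set (ℝ × ℝ × ℝ × ℝ)}

theorem RectU.yU (h : RectU W Q) (x y z : ℝ) (hF : Fc (freeSpace W) x y) (hyz : y < z)
    (hn : ∀ w ∈ Yof Q, ¬ (y ≤ w ∧ w < z)) : Fc (freeSpace W) x z := by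
  rw [free_iff] at *
  intro u v hu hv
  rw [abs_le] at hv
  by_cases hvy : v ≤ y + 1 / 2
  · exact hF u v hu (abs_le.2 ⟨by linarith, by linarith⟩)
  · obtain ⟨r, hr, hr1, hr2⟩ := (h.2 _ _).1 (hF u (y + 1 / 2) hu (abs_le.2 ⟨by linarith, by linarith⟩))
    have := hn (r.2.2.2 - 1 / 2) (Or.inl ⟨r, hr, rfl⟩)
    refine (h.2 _ _).2 ⟨r, hr, hr1, by linarith [hr2.1], ?_⟩
    by_contra hc
    exact this ⟨by linarith [hr2.2], by linarith⟩

theorem RectU.yD (h : RectU W Q) (x y z : ℝ) (hF : Fc (freeSpace W) x y) (hyz : z < y)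
    (hn : ∀ w ∈ Yof Q, ¬ (z < w ∧ w ≤ y)) : Fc (freeSpace W) x z := by
  rw [free_iff] at *
  intro u v hu hv
  rw [abs_le] at hv
  by_cases hvy : y - 1 / 2 ≤ v
  · exact hF u v hu (abs_le.2 ⟨by linarith, by linarith⟩)
  · obtain ⟨r, hr, hr1, hr2⟩ := (h.2 _ _).1 (hF u (y - 1 / 2) hu (abs_le.2 ⟨by linarith, by linarith⟩))
    have := hn (r.2.2.1 + 1 / 2) (Or.inr ⟨r, hr, rfl⟩)
    refine (h.2 _ _).2 ⟨r, hr, hr1, ?_, by linarith [hr2.2]⟩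
    by_contra hc
    exact this ⟨by linarith, by linarith [hr2.1]⟩

theorem free_tr {x y : ℝ} : Fc (freeSpace (Prod.swap ⁻¹' W)) x y ↔ Fc (freeSpace W) y x := by
  rw [free_iff, free_iff]
  exact ⟨fun h u v hu hv => h v u hv hu, fun h u v hu hv => h v u hv hu⟩

theorem Yof_tr : Yof ((fun r => (r.2.2.1, r.2.2.2, r.1, r.2.1)) '' Q) = Xof Q := by
  simp only [Yof, Xof, image_image]
theorem Xof_tr : Xof ((fun r => (r.2.2.1, r.2.2.2, r.1, r.2.1)) '' Q) = Yof Q := by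
  simp only [Yof, Xof, image_image]

theorem RectU.xR (h : RectU W Q) (x y z : ℝ) (hF : Fc (freeSpace W) x y) (hyz : x < z)
    (hn : ∀ w ∈ Xof Q, ¬ (x ≤ w ∧ w < z)) : Fc (freeSpace W) z y := by
  rw [← free_tr] at *
  exact h.tr.yU y x z hF hyz (by rwa [Yof_tr])

theorem RectU.xL (h : RectU W Q) (x y z : ℝ) (hF : Fc (freeSpace W) x y) (hyz : z < x)
    (hn : ∀ w ∈ Xof Q, ¬ (z < w ∧ w ≤ x)) : Fc (freeSpace W) z y := by
  rw [← free_tr] at *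
  exact h.tr.yD y x z hF hyz (by rwa [Yof_tr])

theorem free_gap (x y y' : ℝ) (h : Fc (freeSpace W) x y) (h' : Fc (freeSpace W) x y') (hd : |y - y'| ≤ 1) :
    VSeg (Fc (freeSpace W)) x y y' := by
  wlog hle : y ≤ y' generalizing y y'
  · exact (this y' y h' h (by rwa [abs_sub_comm]) (not_le.1 hle).le).symm
  intro t ht
  rw [uIcc_of_le hle] at ht
  rw [abs_le] at hd
  rw [free_iff] at *
  intro u v hu hv
  rw [abs_le] at hv
  by_cases hvy : v ≤ y + 1 / 2
  · exact h u v hu (abs_le.2 ⟨by linarith [ht.1], by linarith⟩)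
  · exact h' u v hu (abs_le.2 ⟨by linarith, by linarith [ht.2]⟩)

theorem RectU.finY (h : RectU W Q) : (Yof Q).Finite := (h.1.image _).union (h.1.image _)
theorem RectU.finX (h : RectU W Q) : (Xof Q).Finite := (h.1.image _).union (h.1.image _)

theorem RectU.edge_sub (h : RectU W Q) (hc : IsClosed W) {y : ℝ} (he : IsHorizEdgeY (freeSpace W) y) :
    y ∈ Yof Q := by
  obtain ⟨a, b, hab, hs⟩ := he
  by_contra hy
  obtain ⟨x, hx, hxX⟩ : ∃ x ∈ Icc a b, x ∉ Xof Q := by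
    by_contra hcon
    push Not at hcon
    exact (Icc_infinite hab) (h.finX.subset hcon)
  have hfr := hs (show (x, y) ∈ Icc a b ×ˢ ({y} : Set ℝ) from ⟨hx, rfl⟩)
  have hF : Fc (freeSpace W) x y := by
    have := frontier_subset_closure hfr
    rwa [(free_closed hc).closure_eq] at this
  apply hfr.2
  rw [mem_interior_iff_mem_nhds]
  obtain ⟨x1, hx1, hx1'⟩ := fin_prev h.finX x
  obtain ⟨x2, hx2, hx2'⟩ := fin_next h.finX x
  obtain ⟨y1, hy1, hy1'⟩ := fin_prev h.finY y
  obtain ⟨y2, hy2, hy2'⟩ := fin_next h.finY y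
  filter_upwards [prod_mem_nhds (Ioo_mem_nhds hx1 hx2) (Ioo_mem_nhds hy1 hy2)]
  rintro ⟨p, q⟩ ⟨⟨p1, p2⟩, q1, q2⟩
  simp only at p1 p2 q1 q2
  have s1 : Fc (freeSpace W) x q := by
    rcases lt_trichotomy y q with hh | hh | hh
    · refine h.yU x y q hF hh (fun w hw hh' => ?_)
      rcases hh'.1.eq_or_lt with h0 | h0
      · exact hy (h0 ▸ hw)
      · exact hy2' w hw ⟨h0, by linarith⟩
    · rwa [← hh]
    · refine h.yD x y q hF hh (fun w hw hh' => ?_)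
      rcases hh'.2.eq_or_lt with h0 | h0
      · exact hy (h0 ▸ hw)
      · exact hy1' w hw ⟨by linarith, h0⟩
  rcases lt_trichotomy x p with hh | hh | hh
  · refine h.xR x q p s1 hh (fun w hw hh' => ?_)
    rcases hh'.1.eq_or_lt with h0 | h0
    · exact hxX (h0 ▸ hw)
    · exact hx2' w hw ⟨h0, by linarith⟩
  · rw [← hh]; exact s1
  · refine h.xL x q p s1 hh (fun w hw hh' => ?_)
    rcases hh'.2.eq_or_lt with h0 | h0
    · exact hxX (h0 ▸ hw)
    · exact hx1' w hw ⟨by linarith, h0⟩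

theorem free_edge (p q e e' : ℝ) (hpq : p < q) (hne : e ≠ e')
    (h1 : ∀ t ∈ Icc p q, Fc (freeSpace W) t e)
    (h2 : ∀ t ∈ Icc p q, ∀ s, (e < s ∧ s < e') ∨ (e' < s ∧ s < e) → ¬ Fc (freeSpace W) t s) :
    IsHorizEdgeY (freeSpace W) e := by
  refine ⟨p, q, hpq, ?_⟩
  rintro ⟨t, s⟩ ⟨ht, hs⟩
  simp only [mem_singleton_iff] at hs ht
  subst hs
  refine ⟨subset_closure (h1 t ht), fun hi => ?_⟩
  rw [mem_interior_iff_mem_nhds] at hi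
  have hc : Filter.Tendsto (fun r : ℝ => (t, r)) (nhds s) (nhds (t, s)) := by
    apply Continuous.tendsto'; fun_prop; rfl
  have := hc hi
  rw [Filter.mem_map] at this
  obtain ⟨l, hl, hl'⟩ := Metric.mem_nhds_iff.1 this
  rcases lt_or_gt_of_ne hne with hh | hh
  · have hm : s < min (s + l) e' := lt_min (by linarith) hh
    obtain ⟨r, r1, r2⟩ := exists_between hm
    refine h2 t ht r (Or.inl ⟨r1, r2.trans_le (min_le_right _ _)⟩) (hl' ?_)
    rw [Metric.mem_ball, Real.dist_eq, abs_lt]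
    have := r2.trans_le (min_le_left _ _)
    constructor <;> linarith
  · have hm : max (s - l) e' < s := max_lt (by linarith) hh
    obtain ⟨r, r1, r2⟩ := exists_between hm
    refine h2 t ht r (Or.inr ⟨(le_max_right _ _).trans_lt r1, r2⟩) (hl' ?_)
    rw [Metric.mem_ball, Real.dist_eq, abs_lt]
    have := (le_max_left _ _).trans_lt r1
    constructor <;> linarith

theorem free_sub : freeSpace W ⊆ W := by
  intro p hp
  have := hp 0 (by simp [linf])
  simpa using this

theorem RectU.hg (h : RectU W Q) (hc : IsCompact W) {Z : Set ℝ} (hZ : Z.Finite) :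
    HG (Fc (freeSpace W)) (Xof Q) (Yof Q) ({y | IsHorizEdgeY (freeSpace W) y} ∪ Z) where
  fX := h.finX
  fY := h.finY
  fB := (h.finY.subset (fun _ hy => h.edge_sub hc.isClosed hy)).union hZ
  closed := free_closed hc.isClosed
  bdd := by
    obtain ⟨R, hR⟩ := hc.isBounded.exists_norm_le
    refine ⟨R, fun x y hF => ?_⟩
    have := hR _ (free_sub hF)
    rw [Prod.norm_def] at this
    exact (le_max_right _ _).trans this
  gap := free_gap
  yU := h.yU
  yD := h.yD
  xR := h.xR
  xL := h.xL
  edge := fun p q e e' a b c d => Or.inl (free_edge p q e e' a b c d)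

theorem vert_iff {S : Set (ℝ × ℝ)} {x : ℝ} : IsVertEdgeX S x ↔ IsHorizEdgeY (Prod.swap ⁻¹' S) x := by
  have : frontier (Prod.swap ⁻¹' S) = Prod.swap ⁻¹' (frontier S) :=
    ((Homeomorph.prodComm ℝ ℝ).preimage_frontier S).symm
  simp only [IsVertEdgeX, IsHorizEdgeY, this]
  refine exists_congr fun a => exists_congr fun b => and_congr_right fun _ => ?_
  constructor
  · rintro h ⟨u, v⟩ ⟨h1, h2⟩
    exact h (show (v, u) ∈ _ from ⟨h2, h1⟩)
  · rintro h ⟨u, v⟩ ⟨h1, h2⟩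
    exact h (show (v, u) ∈ _ from ⟨h2, h1⟩)

theorem swap_free : freeSpace (Prod.swap ⁻¹' W) = Prod.swap ⁻¹' freeSpace W := by
  ext ⟨x, y⟩
  exact free_tr (W := W)

theorem RectU.hg' (h : RectU W Q) (hc : IsCompact W) {Z : Set ℝ} (hZ : Z.Finite) :
    HG (fun x y => Fc (freeSpace W) y x) (Yof Q) (Xof Q) ({x | IsVertEdgeX (freeSpace W) x} ∪ Z) := by
  have hc' : IsCompact (Prod.swap ⁻¹' W) := (Homeomorph.prodComm ℝ ℝ).isCompact_preimage.2 hc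
  have := h.tr.hg hc' hZ
  rw [Yof_tr, Xof_tr] at this
  simp only [vert_iff, ← swap_free]
  convert this using 3
  exact free_tr.symm
end

end TR

namespace TR

theorem chain {ι : Type*} [DecidableEq ι] (K : ι → Set ℝ) (hK : ∀ i, IsClosed (K i)) {b : ℝ} :
    ∀ (m : ℕ) (s : Finset ι) (a : ℝ), s.card = m → a ≤ b → Icc a b ⊆ ⋃ i ∈ s, K i →
    ∃ (n : ℕ) (t : ℕ → ℝ), Monotone t ∧ t 0 = a ∧ t n = b ∧ (∀ i, t i ∈ Icc a b) ∧
      ∀ i < n, ∃ j ∈ s, t i ∈ K j ∧ t (i + 1) ∈ K j := by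
  intro m
  induction m with
  | zero =>
    intro s a hs hab hc
    have := hc ⟨le_rfl, hab⟩
    rw [Finset.card_eq_zero.1 hs] at this
    simp at this
  | succ m ih =>
    intro s a hs hab hc
    obtain ⟨j, hj, haj⟩ : ∃ j ∈ s, a ∈ K j := by simpa using hc ⟨le_rfl, hab⟩
    have hcomp : IsCompact (Icc a b ∩ K j) := isCompact_Icc.inter_right (hK j)
    obtain ⟨t, ht, htm⟩ := hcomp.exists_isMaxOn ⟨a, ⟨le_rfl, hab⟩, haj⟩ continuousOn_id
    rcases ht.1.2.eq_or_lt with h0 | h0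
    · refine ⟨1, fun i => if i = 0 then a else b, monotone_nat_of_le_succ (fun i => ?_), by simp, by simp, ?_, ?_⟩
      · simp only [Nat.add_eq_zero_iff, one_ne_zero, and_false, if_false]
        split_ifs <;> simp [hab]
      · intro i; dsimp only; split_ifs <;> simp [hab]
      · intro i hi
        obtain rfl : i = 0 := by omega
        exact ⟨j, hj, by simpa using haj, by simpa [← h0] using ht.2⟩
    · have hc' : Icc t b ⊆ ⋃ i ∈ s.erase j, K i := by
        rw [← closure_Ioc h0.ne]
        apply closure_minimal
        · intro r hr
          obtain ⟨i, hi, hri⟩ : ∃ i ∈ s, r ∈ K i := by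
            simpa using hc (show r ∈ Icc a b from ⟨by linarith [ht.1.1, hr.1], hr.2⟩)
          simp only [mem_iUnion]
          refine ⟨i, Finset.mem_erase.2 ⟨?_, hi⟩, hri⟩
          rintro rfl
          have := htm (show r ∈ Icc a b ∩ K i from ⟨⟨by linarith [ht.1.1, hr.1], hr.2⟩, hri⟩)
          change r ≤ t at this
          linarith [hr.1]
        · exact (s.erase j).finite_toSet.isClosed_biUnion (fun i _ => hK i)
      obtain ⟨n, τ, τm, τ0, τn, τI, τK⟩ := ih (s.erase j) t (by rw [Finset.card_erase_of_mem hj, hs]; rfl) h0.le hc'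
      refine ⟨n + 1, fun i => Nat.casesOn i a τ, monotone_nat_of_le_succ ?_, rfl, τn, ?_, ?_⟩
      · intro i
        cases i with
        | zero => show a ≤ τ 0; rw [τ0]; exact ht.1.1
        | succ i => exact τm (Nat.le_succ i)
      · intro i
        cases i with
        | zero => exact ⟨le_rfl, hab⟩
        | succ i => exact ⟨ht.1.1.trans (τI i).1, (τI i).2⟩
      · intro i hi
        cases i with
        | zero => exact ⟨j, hj, haj, by show τ 0 ∈ K j; rw [τ0]; exact ht.2⟩
        | succ i =>
          obtain ⟨l, hl, h1, h2⟩ := τK i (by omega)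
          exact ⟨l, Finset.mem_of_mem_erase hl, h1, h2⟩

inductive PR (F : ℝ → ℝ → Prop) : Cfg → Cfg → ℝ → Prop
  | nil (e : Cfg) : F e.a1 e.a2 → F e.b1 e.b2 → PR F e e 0
  | cons (e e' e'' : Cfg) (c : ℝ) : Step F e e' → PR F e' e'' c → PR F e e'' (cost e e' + c)

theorem PR.trans {F e e' e'' c c'} (h : PR F e e' c) (h' : PR F e' e'' c') : PR F e e'' (c + c') := by
  induction h with
  | nil e _ _ => simpa using h'
  | cons e f g c hs hw ih => rw [add_assoc]; exact PR.cons _ _ _ _ hs (ih h')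

theorem PR.toPW {F e e' c} (h : PR F e e' c) : ∃ n u, PW F n u ∧ u 0 = e ∧ u n = e' ∧
    ∑ l ∈ Finset.range n, cost (u l) (u (l + 1)) = c := by
  induction h with
  | nil e h1 h2 => exact ⟨0, fun _ => e, ⟨fun _ _ => ⟨h1, h2⟩, fun i hi => by omega⟩, rfl, rfl, by simp⟩
  | cons e f g c hs hw ih =>
    obtain ⟨n, u, hu, u0, un, hc⟩ := ih
    refine ⟨n + 1, fun i => Nat.casesOn i e u, ⟨?_, ?_⟩, rfl, un, ?_⟩
    · intro i hi
      cases i with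
      | zero => exact ⟨hs.1.left, hs.2.1.left⟩
      | succ i => exact hu.1 i (by omega)
    · intro i hi
      cases i with
      | zero => show Step F e (u 0); rw [u0]; exact hs
      | succ i => exact hu.2 i (by omega)
    · rw [Finset.sum_range_succ', ← hc, add_comm]
      show cost e (u 0) + _ = _
      rw [u0]

/-- free box -/
def FBox (F : ℝ → ℝ → Prop) (r : ℝ × ℝ × ℝ × ℝ) : Prop :=
  ∀ x y, r.1 ≤ x → x ≤ r.2.1 → r.2.2.1 ≤ y → y ≤ r.2.2.2 → F x y

def InB (r : ℝ × ℝ × ℝ × ℝ) (x y : ℝ) : Prop := (r.1 ≤ x ∧ x ≤ r.2.1) ∧ (r.2.2.1 ≤ y ∧ y ≤ r.2.2.2)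

theorem range_aux {Y0 : Set ℝ} (fY : Y0.Finite) {G : ℝ → Prop} {R y : ℝ} (hb : ∀ y, G y → |y| ≤ R) (hF : G y)
    (yU : ∀ y z, G y → y < z → (∀ w ∈ Y0, ¬ (y ≤ w ∧ w < z)) → G z)
    (yD : ∀ y z, G y → z < y → (∀ w ∈ Y0, ¬ (z < w ∧ w ≤ y)) → G z) :
    ∃ r ∈ Y0, ∃ s ∈ Y0, r ≤ y ∧ y ≤ s ∧ (∀ w ∈ Y0, ¬ (r < w ∧ w ≤ y)) ∧ (∀ w ∈ Y0, ¬ (y ≤ w ∧ w < s)) := by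
  have n1 : (Y0 ∩ Iic y).Nonempty := by
    by_contra hn
    have h1 := hb y hF
    have := hb (-R - 1) (yD y (-R - 1) hF (by linarith [(abs_le.1 h1).1]) (fun w hw hh => hn ⟨w, hw, hh.2⟩))
    linarith [(abs_le.1 this).1]
  have n2 : (Y0 ∩ Ici y).Nonempty := by
    by_contra hn
    have h1 := hb y hF
    have := hb (R + 1) (yU y (R + 1) hF (by linarith [(abs_le.1 h1).2]) (fun w hw hh => hn ⟨w, hw, hh.1⟩))
    linarith [(abs_le.1 this).2]
  obtain ⟨r, hr, hr'⟩ := exists_max_image _ id (fY.subset inter_subset_left) n1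
  obtain ⟨s, hs, hs'⟩ := exists_min_image _ id (fY.subset inter_subset_left) n2
  exact ⟨r, hr.1, s, hs.1, hr.2, hs.2, fun w hw hh => absurd (hr' w ⟨hw, hh.2⟩) (not_le.2 hh.1),
    fun w hw hh => absurd (hs' w ⟨hw, hh.1⟩) (not_le.2 hh.2)⟩

theorem box_cover {F X0 Y0 B R} (h : HG F X0 Y0 B) (hR : ∀ x y, F x y → |x| ≤ R) {x y : ℝ} (hF : F x y) :
    ∃ r ∈ X0 ×ˢ (X0 ×ˢ (Y0 ×ˢ Y0)), FBox F r ∧ InB r x y := by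
  obtain ⟨R', hR'⟩ := h.bdd
  obtain ⟨p, hp, q, hq, p1, q1, p2, q2⟩ := range_aux h.fX (G := fun x => F x y) (fun x => hR x y) hF
    (fun a b => h.xR a y b) (fun a b => h.xL a y b)
  obtain ⟨r, hr, s, hs, r1, s1, r2, s2⟩ := range_aux h.fY (G := fun y => F x y) (fun y => hR' x y) hF
    (h.yU x) (h.yD x)
  refine ⟨(p, q, r, s), ⟨hp, hq, hr, hs⟩, ?_, ⟨p1, q1⟩, r1, s1⟩
  intro u v u1 u2 v1 v2
  simp only at u1 u2 v1 v2
  have h1 : F u y := by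
    rcases lt_trichotomy x u with hh | hh | hh
    · exact h.xR x y u hF hh (fun w hw hh' => q2 w hw ⟨hh'.1, hh'.2.trans_le u2⟩)
    · rwa [← hh]
    · exact h.xL x y u hF hh (fun w hw hh' => p2 w hw ⟨u1.trans_lt hh'.1, hh'.2⟩)
  rcases lt_trichotomy y v with hh | hh | hh
  · exact h.yU u y v h1 hh (fun w hw hh' => s2 w hw ⟨hh'.1, hh'.2.trans_le v2⟩)
  · rwa [← hh]
  · exact h.yD u y v h1 hh (fun w hw hh' => r2 w hw ⟨v1.trans_lt hh'.1, hh'.2⟩)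

def cf (z : (ℝ × ℝ) × (ℝ × ℝ)) : Cfg := ⟨z.1.1, z.1.2, z.2.1, z.2.2⟩

/-- closed separation types -/
def sepT (o : Fin 4) (e : Cfg) : Prop :=
  match o with
  | 0 => e.a1 + 1 ≤ e.b1
  | 1 => e.b1 + 1 ≤ e.a1
  | 2 => e.a2 + 1 ≤ e.b2
  | 3 => e.b2 + 1 ≤ e.a2

theorem one_le_linf {q : ℝ × ℝ} : 1 ≤ linf q ↔ (1 ≤ |q.1| ∨ 1 ≤ |q.2|) := le_max_iff

theorem sep_of {z : (ℝ × ℝ) × (ℝ × ℝ)} (h : 1 ≤ linf (z.1 - z.2)) : ∃ o, sepT o (cf z) := by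
  rcases one_le_linf.1 h with h | h
  · rcases le_abs.1 h with h | h
    · exact ⟨1, by simp only [sepT, cf, Prod.fst_sub] at *; linarith⟩
    · exact ⟨0, by simp only [sepT, cf, Prod.fst_sub] at *; linarith⟩
  · rcases le_abs.1 h with h | h
    · exact ⟨3, by simp only [sepT, cf, Prod.snd_sub] at *; linarith⟩
    · exact ⟨2, by simp only [sepT, cf, Prod.snd_sub] at *; linarith⟩

theorem of_sep {z : (ℝ × ℝ) × (ℝ × ℝ)} {o} (h : sepT o (cf z)) : 1 ≤ linf (z.1 - z.2) := by
  rw [one_le_linf, le_abs, le_abs]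
  simp only [Prod.fst_sub, Prod.snd_sub]
  fin_cases o <;> simp only [sepT, cf] at h
  · left; right; linarith
  · left; left; linarith
  · right; right; linarith
  · right; left; linarith

theorem box_PR {F r r' o} (hr : FBox F r) (hr' : FBox F r') {e e' : Cfg}
    (h1 : InB r e.a1 e.a2) (h2 : InB r' e.b1 e.b2) (h3 : sepT o e)
    (h1' : InB r e'.a1 e'.a2) (h2' : InB r' e'.b1 e'.b2) (h3' : sepT o e') : PR F e e' (cost e e') := by
  have key : cost e e' = cost e ⟨e.a1, e'.a2, e.b1, e'.b2⟩ + (cost ⟨e.a1, e'.a2, e.b1, e'.b2⟩ e' + 0) := by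
    simp [cost]; ring
  rw [key]
  refine PR.cons _ _ _ _ ⟨Or.inr ⟨rfl, ?_⟩, Or.inr ⟨rfl, ?_⟩, ?_⟩ (PR.cons _ _ _ _ ⟨Or.inl ⟨rfl, ?_⟩, Or.inl ⟨rfl, ?_⟩, ?_⟩
    (PR.nil _ ?_ ?_))
  · intro t ht
    rw [mem_uIcc] at ht
    obtain ⟨⟨_, _⟩, _, _⟩ := h1
    obtain ⟨⟨_, _⟩, _, _⟩ := h1'
    apply hr <;> grind
  · intro t ht
    rw [mem_uIcc] at ht
    obtain ⟨⟨_, _⟩, _, _⟩ := h2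
    obtain ⟨⟨_, _⟩, _, _⟩ := h2'
    apply hr' <;> grind
  · fin_cases o <;> simp only [sepT] at h3 h3' <;> simp only [SSx, SSy] <;> grind
  · intro t ht
    simp only [mem_uIcc] at ht
    obtain ⟨⟨_, _⟩, _, _⟩ := h1
    obtain ⟨⟨_, _⟩, _, _⟩ := h1'
    apply hr <;> grind
  · intro t ht
    simp only [mem_uIcc] at ht
    obtain ⟨⟨_, _⟩, _, _⟩ := h2
    obtain ⟨⟨_, _⟩, _, _⟩ := h2'
    apply hr' <;> grind
  · fin_cases o <;> simp only [sepT] at h3 h3' <;> simp only [SSx, SSy] <;> grind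
  · exact hr _ _ h1'.1.1 h1'.1.2 h1'.2.1 h1'.2.2
  · exact hr' _ _ h2'.1.1 h2'.1.2 h2'.2.1 h2'.2.2

theorem edist_l1 (p q : ℝ × ℝ) : edist ((WithLp.equiv 1 (ℝ × ℝ)).symm p) ((WithLp.equiv 1 (ℝ × ℝ)).symm q) =
    ENNReal.ofReal (l1 (p - q)) := by
  rw [edist_dist, WithLp.prod_dist_eq_of_L1]
  rfl

theorem cost_cf (z z' : (ℝ × ℝ) × (ℝ × ℝ)) : cost (cf z) (cf z') = l1 (z'.1 - z.1) + l1 (z'.2 - z.2) := by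
  simp only [cost, cf, l1, Prod.fst_sub, Prod.snd_sub]
  rw [abs_sub_comm z.1.1, abs_sub_comm z.1.2, abs_sub_comm z.2.1, abs_sub_comm z.2.2]; ring

theorem l1_nonneg (p : ℝ × ℝ) : 0 ≤ l1 p := add_nonneg (abs_nonneg _) (abs_nonneg _)

theorem cost_plan {pln : ℝ → (ℝ × ℝ) × (ℝ × ℝ)} {t : ℕ → ℝ} (ht : Monotone t) (hI : ∀ i, t i ∈ Icc (0 : ℝ) 1) (n : ℕ) :
    ENNReal.ofReal (∑ i ∈ Finset.range n, cost (cf (pln (t i))) (cf (pln (t (i + 1))))) ≤ planCost pln := by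
  have h1 := eVariationOn.sum_le (f := fun t => (WithLp.equiv 1 (ℝ × ℝ)).symm (pln t).1) (n := n) ht hI
  have h2 := eVariationOn.sum_le (f := fun t => (WithLp.equiv 1 (ℝ × ℝ)).symm (pln t).2) (n := n) ht hI
  simp only [edist_l1] at h1 h2
  rw [← ENNReal.ofReal_sum_of_nonneg (fun _ _ => l1_nonneg _)] at h1 h2
  simp only [cost_cf]
  rw [Finset.sum_add_distrib, ENNReal.ofReal_add (Finset.sum_nonneg fun _ _ => l1_nonneg _)
    (Finset.sum_nonneg fun _ _ => l1_nonneg _)]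
  exact add_le_add h1 h2

theorem plan_PR {S : Set (ℝ × ℝ)} {X0 Y0 B R} (h : HG (Fc S) X0 Y0 B) (hR : ∀ x y, Fc S x y → |x| ≤ R)
    {s t : (ℝ × ℝ) × (ℝ × ℝ)} {pln} (hp : IsPlan s t pln) (hf : Feasible S pln) :
    ∃ c, PR (Fc S) (cf s) (cf t) c ∧ ENNReal.ofReal c ≤ planCost pln := by
  classical
  have fb : {r ∈ X0 ×ˢ (X0 ×ˢ (Y0 ×ˢ Y0)) | FBox (Fc S) r}.Finite :=
    (h.fX.prod (h.fX.prod (h.fY.prod h.fY))).subset (fun r hr => hr.1)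
  set bs := fb.toFinset with hbs
  set D : (ℝ × ℝ × ℝ × ℝ) × (ℝ × ℝ × ℝ × ℝ) × Fin 4 → Set ((ℝ × ℝ) × (ℝ × ℝ)) := fun i =>
    {z | InB i.1 z.1.1 z.1.2 ∧ InB i.2.1 z.2.1 z.2.2 ∧ sepT i.2.2 (cf z)} with hD
  have hDc : ∀ i, IsClosed (D i) := by
    rintro ⟨r, r', o⟩
    have hb : ∀ (r : ℝ × ℝ × ℝ × ℝ) {f g : (ℝ × ℝ) × (ℝ × ℝ) → ℝ}, Continuous f → Continuous g →
        IsClosed {z | InB r (f z) (g z)} := by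
      intro r f g hf hg
      exact ((isClosed_le continuous_const hf).inter (isClosed_le hf continuous_const)).inter
        ((isClosed_le continuous_const hg).inter (isClosed_le hg continuous_const))
    refine (hb r (by fun_prop) (by fun_prop)).inter ((hb r' (by fun_prop) (by fun_prop)).inter ?_)
    fin_cases o
    · exact isClosed_le (f := fun z : (ℝ × ℝ) × (ℝ × ℝ) => z.1.1 + 1) (g := fun z => z.2.1) (by fun_prop) (by fun_prop)
    · exact isClosed_le (f := fun z : (ℝ × ℝ) × (ℝ × ℝ) => z.2.1 + 1) (g := fun z => z.1.1) (by fun_prop) (by fun_prop)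
    · exact isClosed_le (f := fun z : (ℝ × ℝ) × (ℝ × ℝ) => z.1.2 + 1) (g := fun z => z.2.2) (by fun_prop) (by fun_prop)
    · exact isClosed_le (f := fun z : (ℝ × ℝ) × (ℝ × ℝ) => z.2.2 + 1) (g := fun z => z.1.2) (by fun_prop) (by fun_prop)
  obtain ⟨n, τ, τm, τ0, τn, τI, τK⟩ := chain (b := 1) (fun i => Icc (0 : ℝ) 1 ∩ pln ⁻¹' D i)
    (fun i => hp.1.preimage_isClosed_of_isClosed isClosed_Icc (hDc i)) _ (bs ×ˢ (bs ×ˢ (Finset.univ : Finset (Fin 4)))) 0 rfl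
    zero_le_one (by
      intro a ha
      obtain ⟨f1, f2, f3⟩ := hf a ha
      obtain ⟨r, hr, hr1, hr2⟩ := box_cover h hR (x := (pln a).1.1) (y := (pln a).1.2) f1
      obtain ⟨r', hr', hr1', hr2'⟩ := box_cover h hR (x := (pln a).2.1) (y := (pln a).2.2) f2
      obtain ⟨o, ho⟩ := sep_of f3
      simp only [mem_iUnion]
      refine ⟨(r, r', o), ?_, ha, hr2, hr2', ho⟩
      simp only [Finset.mem_product, Finset.mem_univ, and_true, hbs, Set.Finite.mem_toFinset]
      exact ⟨⟨hr, hr1⟩, ⟨hr', hr1'⟩⟩)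
  refine ⟨∑ i ∈ Finset.range n, cost (cf (pln (τ i))) (cf (pln (τ (i + 1)))), ?_, cost_plan τm τI n⟩
  have key : ∀ m ≤ n, PR (Fc S) (cf (pln (τ 0))) (cf (pln (τ m)))
      (∑ i ∈ Finset.range m, cost (cf (pln (τ i))) (cf (pln (τ (i + 1))))) := by
    intro m
    induction m with
    | zero =>
      intro _
      obtain ⟨f1, f2, f3⟩ := hf _ (τI 0)
      simpa using PR.nil (cf (pln (τ 0))) f1 f2
    | succ m ih =>
      intro hm
      rw [Finset.sum_range_succ]
      refine (ih (by omega)).trans ?_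
      obtain ⟨⟨r, r', o⟩, hj, ⟨_, a1, a2, a3⟩, ⟨_, b1, b2, b3⟩⟩ := τK m (by omega)
      simp only [Finset.mem_product, Finset.mem_univ, and_true, hbs, Set.Finite.mem_toFinset] at hj
      exact box_PR hj.1.2 hj.2.2 a1 a2 a3 b1 b2 b3
  have := key n le_rfl
  rwa [τ0, τn, hp.2.1, hp.2.2] at this

end TR

namespace TR

abbrev Conf := (ℝ × ℝ) × (ℝ × ℝ)

theorem abs_nat2 {v w : ℝ} : (∃ i : ℕ, i ≤ 2 ∧ |v - w| = (i : ℝ)) ↔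
    (v = w ∨ v - 1 = w ∨ v + 1 = w ∨ v - 2 = w ∨ v + 2 = w) := by
  constructor
  · rintro ⟨i, hi, h⟩
    interval_cases i <;> simp only [Nat.cast_zero, Nat.cast_one, Nat.cast_ofNat] at h
    · left; linarith [abs_eq_zero.1 h]
    · rcases (abs_eq (by norm_num)).1 h with h | h
      · right; left; linarith
      · right; right; left; linarith
    · rcases (abs_eq (by norm_num)).1 h with h | h
      · right; right; right; left; linarith
      · right; right; right; right; linarith
  · rintro (h | h | h | h | h)
    · exact ⟨0, by norm_num, by subst h; simp⟩
    · exact ⟨1, by norm_num, by subst h; simp⟩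
    · exact ⟨1, by norm_num, by subst h; simp⟩
    · exact ⟨2, by norm_num, by subst h; simp⟩
    · exact ⟨2, by norm_num, by subst h; simp⟩

theorem goodS_iff {S : Set ℝ} {v : ℝ} : GoodS S v ↔ ∃ w ∈ S, ∃ i : ℕ, i ≤ 2 ∧ |v - w| = (i : ℝ) := by
  simp only [abs_nat2]
  constructor
  · rintro (h | h | h | h | h)
    · exact ⟨_, h, Or.inl rfl⟩
    · exact ⟨_, h, Or.inr (Or.inl rfl)⟩
    · exact ⟨_, h, Or.inr (Or.inr (Or.inl rfl))⟩
    · exact ⟨_, h, Or.inr (Or.inr (Or.inr (Or.inl rfl)))⟩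
    · exact ⟨_, h, Or.inr (Or.inr (Or.inr (Or.inr rfl)))⟩
  · rintro ⟨w, hw, h⟩
    rcases h with rfl | rfl | rfl | rfl | rfl
    · exact Or.inl hw
    · exact Or.inr (Or.inl hw)
    · exact Or.inr (Or.inr (Or.inl hw))
    · exact Or.inr (Or.inr (Or.inr (Or.inl hw)))
    · exact Or.inr (Or.inr (Or.inr (Or.inr hw)))

theorem goodS_fin {S : Set ℝ} (h : S.Finite) : {v | GoodS S v}.Finite := by
  have : {v | GoodS S v} ⊆ ⋃ w ∈ S, ({w, w + 1, w - 1, w + 2, w - 2} : Set ℝ) := by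
    intro v hv
    simp only [mem_iUnion]
    rcases hv with h | h | h | h | h
    · exact ⟨_, h, by simp⟩
    · exact ⟨_, h, by simp⟩
    · exact ⟨_, h, by simp⟩
    · exact ⟨_, h, by simp⟩
    · exact ⟨_, h, by simp⟩
  exact (h.biUnion (fun w _ => by simp)).subset this

theorem horiz_iff {F P : Set (ℝ × ℝ)} {y : ℝ} :
    IsHorizLineY F P 2 y ↔ GoodS ({y | IsHorizEdgeY F y} ∪ Prod.snd '' P) y := by
  rw [goodS_iff]
  constructor
  · rintro ⟨i, hi, ⟨w, hw, h⟩ | ⟨p, hp, h⟩⟩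
    · exact ⟨w, Or.inl hw, i, hi, h⟩
    · exact ⟨p.2, Or.inr ⟨p, hp, rfl⟩, i, hi, h⟩
  · rintro ⟨w, hw | ⟨p, hp, rfl⟩, i, hi, h⟩
    · exact ⟨i, hi, Or.inl ⟨w, hw, h⟩⟩
    · exact ⟨i, hi, Or.inr ⟨p, hp, h⟩⟩

theorem vertl_iff {F P : Set (ℝ × ℝ)} {x : ℝ} :
    IsVertLineX F P 2 x ↔ GoodS ({x | IsVertEdgeX F x} ∪ Prod.fst '' P) x := by
  rw [goodS_iff]
  constructor
  · rintro ⟨i, hi, ⟨w, hw, h⟩ | ⟨p, hp, h⟩⟩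
    · exact ⟨w, Or.inl hw, i, hi, h⟩
    · exact ⟨p.1, Or.inr ⟨p, hp, rfl⟩, i, hi, h⟩
  · rintro ⟨w, hw | ⟨p, hp, rfl⟩, i, hi, h⟩
    · exact ⟨i, hi, Or.inl ⟨w, hw, h⟩⟩
    · exact ⟨i, hi, Or.inr ⟨p, hp, h⟩⟩

section
variable {F P : Set (ℝ × ℝ)}

def wt (u v : Conf) : ℝ := l1 (v.1 - u.1) + l1 (v.2 - u.2)

theorem wt_nonneg (u v : Conf) : 0 ≤ wt u v := add_nonneg (l1_nonneg _) (l1_nonneg _)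

theorem wt_eq (u v : Conf) : wt u v = cost (cf u) (cf v) := (cost_cf u v).symm

theorem wt_comm (u v : Conf) : wt u v = wt v u := by rw [wt_eq, wt_eq, cost_comm]

theorem wt_swap (u v : Conf) : wt u.swap v.swap = wt u v := by simp [wt, add_comm]

inductive GP (F P : Set (ℝ × ℝ)) : Conf → Conf → ℝ → Prop
  | nil (u : Conf) : GP F P u u 0
  | cons (u v w : Conf) (c : ℝ) : ConfEdge F P u v → GP F P v w c → GP F P u w (wt u v + c)

theorem GP.trans {u v w c c'} (h : GP F P u v c) (h' : GP F P v w c') : GP F P u w (c + c') := by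
  induction h with
  | nil u => simpa using h'
  | cons e f g c hs hw ih => rw [add_assoc]; exact GP.cons _ _ _ _ hs (ih h')

theorem GP.single {u v} (h : ConfEdge F P u v) : GP F P u v (wt u v) := by
  simpa using GP.cons u v v 0 h (GP.nil v)

theorem gridEdge_symm {p q} (h : IsGridEdge F P p q) : IsGridEdge F P q p :=
  ⟨h.2.1, h.1, h.2.2.1.imp Eq.symm Eq.symm, by rw [segment_symm]; exact h.2.2.2.1,
    by rw [openSegment_symm]; exact h.2.2.2.2⟩

theorem confEdge_symm {u v} (h : ConfEdge F P u v) : ConfEdge F P v u :=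
  ⟨h.2.1, h.1, h.2.2.imp (fun h => ⟨h.1.symm, gridEdge_symm h.2⟩) (fun h => ⟨h.1.symm, gridEdge_symm h.2⟩)⟩

theorem linf_comm (p q : ℝ × ℝ) : linf (p - q) = linf (q - p) := by
  simp only [linf, Prod.fst_sub, Prod.snd_sub]
  rw [abs_sub_comm p.1, abs_sub_comm p.2]

theorem confVertex_swap {u : Conf} (h : ConfVertex F P u) : ConfVertex F P u.swap :=
  ⟨h.2.1, h.1, by rw [linf_comm]; exact h.2.2⟩

theorem confEdge_swap {u v : Conf} (h : ConfEdge F P u v) : ConfEdge F P u.swap v.swap :=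
  ⟨confVertex_swap h.1, confVertex_swap h.2.1, h.2.2.symm⟩

theorem GP.symm {u v c} (h : GP F P u v c) : GP F P v u c := by
  induction h with
  | nil u => exact GP.nil u
  | cons e f g c hs hw ih =>
    have := ih.trans (GP.single (confEdge_symm hs))
    rwa [wt_comm, add_comm] at this

theorem GP.swap {u v c} (h : GP F P u v c) : GP F P u.swap v.swap c := by
  induction h with
  | nil u => exact GP.nil _
  | cons e f g c hs hw ih =>
    have := GP.cons _ _ _ _ (confEdge_swap hs) ih
    rwa [wt_swap] at this

theorem GP.toPath {s t c} (h : GP F P s t c) : ∃ k u, IsGraphPath F P s t k u ∧ graphPathWeight k u = c := by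
  induction h with
  | nil u => exact ⟨0, fun _ => u, ⟨rfl, rfl, fun j hj => by omega⟩, by simp [graphPathWeight]⟩
  | cons e f g c hs hw ih =>
    obtain ⟨k, u, ⟨u0, uk, hu⟩, hc⟩ := ih
    refine ⟨k + 1, fun i => Nat.casesOn i e u, ⟨rfl, uk, ?_⟩, ?_⟩
    · intro i hi
      cases i with
      | zero => show ConfEdge F P e (u 0); rw [u0]; exact hs
      | succ i => exact hu i (by omega)
    · rw [graphPathWeight, Finset.sum_range_succ', ← hc, add_comm]
      show wt e (u 0) + _ = _
      rw [u0]; rfl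

theorem GP.ofPath {s t k u} (h : IsGraphPath F P s t k u) : GP F P s t (graphPathWeight k u) := by
  obtain ⟨u0, uk, hu⟩ := h
  have key : ∀ m ≤ k, GP F P (u 0) (u m) (graphPathWeight m u) := by
    intro m
    induction m with
    | zero => intro _; simpa [graphPathWeight] using GP.nil (F := F) (P := P) (u 0)
    | succ m ih =>
      intro hm
      rw [graphPathWeight, Finset.sum_range_succ]
      exact (ih (by omega)).trans (GP.single (hu m (by omega)))
  have := key k le_rfl
  rwa [u0, uk] at this

theorem subdiv {G : Set ℝ} (hG : G.Finite) (φ : ℝ → Conf) (hφ : ∀ p q, p < q → wt (φ p) (φ q) = q - p) :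
    ∀ (m : ℕ) (x x' : ℝ), (G ∩ Ioo x x').ncard = m → x ∈ G → x' ∈ G → x ≤ x' →
      (∀ p q, p ∈ G → q ∈ G → x ≤ p → p < q → q ≤ x' → (∀ w ∈ G, ¬ (p < w ∧ w < q)) → ConfEdge F P (φ p) (φ q)) →
      GP F P (φ x) (φ x') (x' - x) := by
  intro m
  induction m using Nat.strong_induction_on with
  | _ m ih =>
    intro x x' hm hx hx' hle hE
    rcases hle.eq_or_lt with rfl | hlt
    · rw [sub_self]; exact GP.nil _
    by_cases hne : (G ∩ Ioo x x').Nonempty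
    · obtain ⟨w, hw, h1, h2⟩ := hne
      have f1 : (G ∩ Ioo x x').Finite := hG.subset inter_subset_left
      have c1 : (G ∩ Ioo x w).ncard < m := by
        rw [← hm]
        refine ncard_lt_ncard ⟨fun z hz => ⟨hz.1, hz.2.1, hz.2.2.trans h2⟩, fun hs => ?_⟩ f1
        exact lt_irrefl _ (hs ⟨hw, h1, h2⟩).2.2
      have c2 : (G ∩ Ioo w x').ncard < m := by
        rw [← hm]
        refine ncard_lt_ncard ⟨fun z hz => ⟨hz.1, h1.trans hz.2.1, hz.2.2⟩, fun hs => ?_⟩ f1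
        exact lt_irrefl _ (hs ⟨hw, h1, h2⟩).2.1
      have := (ih _ c1 x w rfl hx hw h1.le (fun p q a b c d e f => hE p q a b c d (e.trans h2.le) f)).trans
        (ih _ c2 w x' rfl hw hx' h2.le (fun p q a b c d e f => hE p q a b (h1.le.trans c) d e f))
      convert this using 1; ring
    · have := GP.single (hE x x' hx hx' le_rfl hlt le_rfl (fun w hw hh => hne ⟨w, hw, hh⟩))
      rwa [hφ x x' hlt] at this

theorem gridEdge_h {p q y : ℝ} (hpq : p < q) (hF : HSeg (Fc F) y p q) (hy : IsHorizLineY F P 2 y)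
    (hp : IsVertLineX F P 2 p) (hq : IsVertLineX F P 2 q)
    (hn : ∀ w, IsVertLineX F P 2 w → ¬ (p < w ∧ w < q)) : IsGridEdge F P (p, y) (q, y) := by
  refine ⟨⟨hF.left, hy, hp⟩, ⟨hF.right, hy, hq⟩, Or.inr rfl, ?_, ?_⟩
  · rintro _ ⟨a, b, ha, hb, hab, rfl⟩
    have e : a • (p, y) + b • (q, y) = (a * p + b * q, y) := by
      ext
      · simp
      · simp only [Prod.snd_add, Prod.smul_snd, smul_eq_mul]; rw [← add_mul, hab, one_mul]
    rw [e]
    refine hF _ ?_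
    rw [uIcc_of_le hpq.le]
    obtain rfl : a = 1 - b := by linarith
    constructor <;> nlinarith
  · rintro _ ⟨a, b, ha, hb, hab, rfl⟩ hg
    refine hn _ hg.2.2 ?_
    simp only [Prod.fst_add, Prod.smul_fst, smul_eq_mul]
    obtain rfl : a = 1 - b := by linarith
    constructor <;> nlinarith

theorem gridEdge_v {p q y : ℝ} (hpq : p < q) (hF : VSeg (Fc F) y p q) (hy : IsVertLineX F P 2 y)
    (hp : IsHorizLineY F P 2 p) (hq : IsHorizLineY F P 2 q)
    (hn : ∀ w, IsHorizLineY F P 2 w → ¬ (p < w ∧ w < q)) : IsGridEdge F P (y, p) (y, q) := by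
  refine ⟨⟨hF.left, hp, hy⟩, ⟨hF.right, hq, hy⟩, Or.inl rfl, ?_, ?_⟩
  · rintro _ ⟨a, b, ha, hb, hab, rfl⟩
    have e : a • (y, p) + b • (y, q) = (y, a * p + b * q) := by
      ext
      · simp only [Prod.fst_add, Prod.smul_fst, smul_eq_mul]; rw [← add_mul, hab, one_mul]
      · simp
    rw [e]
    refine hF _ ?_
    rw [uIcc_of_le hpq.le]
    obtain rfl : a = 1 - b := by linarith
    constructor <;> nlinarith
  · rintro _ ⟨a, b, ha, hb, hab, rfl⟩ hg
    refine hn _ hg.2.1 ?_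
    simp only [Prod.snd_add, Prod.smul_snd, smul_eq_mul]
    obtain rfl : a = 1 - b := by linarith
    constructor <;> nlinarith

def uc (e : Cfg) : Conf := ((e.a1, e.a2), (e.b1, e.b2))

theorem sepT_conv {o : Fin 4} {e e' f : Cfg} (h : sepT o e) (h' : sepT o e')
    (h1 : f.a1 ∈ uIcc e.a1 e'.a1) (h2 : f.a2 ∈ uIcc e.a2 e'.a2)
    (h3 : e.b1 = e'.b1 ∧ f.b1 = e.b1) (h4 : e.b2 = e'.b2 ∧ f.b2 = e.b2) : sepT o f := by
  rw [mem_uIcc] at h1 h2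
  fin_cases o <;> simp only [sepT] at * <;> grind

/-- grid lines through both robots -/
def GC (F P : Set (ℝ × ℝ)) (e : Cfg) : Prop :=
  IsGridPoint F P (e.a1, e.a2) ∧ IsGridPoint F P (e.b1, e.b2)

theorem moveA (hX : {x | IsVertLineX F P 2 x}.Finite) (hY : {y | IsHorizLineY F P 2 y}.Finite)
    {x y x' y' b1 b2 : ℝ} {o : Fin 4} (h : GC F P ⟨x, y, b1, b2⟩) (h' : GC F P ⟨x', y', b1, b2⟩)
    (hr : RM (Fc F) x y x' y') (hs : sepT o ⟨x, y, b1, b2⟩) (hs' : sepT o ⟨x', y', b1, b2⟩) :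
    GP F P ((x, y), (b1, b2)) ((x', y'), (b1, b2)) (|x - x'| + |y - y'|) := by
  rcases hr with ⟨rfl, hr⟩ | ⟨rfl, hr⟩
  · rw [sub_self, abs_zero, add_zero]
    wlog hle : x ≤ x' generalizing x x'
    · rw [abs_sub_comm]; exact (this h' hs' hr.symm h hs (not_le.1 hle).le).symm
    rw [abs_sub_comm, abs_of_nonneg (sub_nonneg.2 hle)]
    refine subdiv hX (fun t => ((t, y), (b1, b2))) (fun p q hpq => ?_) _ x x' rfl h.1.2.2 h'.1.2.2 hle ?_
    · simp [wt, l1, abs_of_pos (sub_pos.2 hpq)]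
    · intro p q hp hq h1 h2 h3 h4
      have hv : ∀ t ∈ Icc x x', IsVertLineX F P 2 t → ConfVertex F P ((t, y), (b1, b2)) := by
        intro t ht hl
        rw [← uIcc_of_le hle] at ht
        exact ⟨⟨hr t ht, h.1.2.1, hl⟩, h.2, of_sep (z := ((t, y), (b1, b2))) (o := o)
          (sepT_conv hs hs' ht left_mem_uIcc ⟨rfl, rfl⟩ ⟨rfl, rfl⟩)⟩
      refine ⟨hv p ⟨h1, by linarith⟩ hp, hv q ⟨by linarith, h3⟩ hq, Or.inr ⟨rfl, ?_⟩⟩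
      refine gridEdge_h h2 (hr.sub ?_ ?_) h.1.2.1 hp hq h4
      · rw [uIcc_of_le hle]; constructor <;> linarith
      · rw [uIcc_of_le hle]; constructor <;> linarith
  · rw [sub_self, abs_zero, zero_add]
    wlog hle : y ≤ y' generalizing y y'
    · rw [abs_sub_comm]; exact (this h' hs' hr.symm h hs (not_le.1 hle).le).symm
    rw [abs_sub_comm, abs_of_nonneg (sub_nonneg.2 hle)]
    refine subdiv hY (fun t => ((x, t), (b1, b2))) (fun p q hpq => ?_) _ y y' rfl h.1.2.1 h'.1.2.1 hle ?_
    · simp [wt, l1, abs_of_pos (sub_pos.2 hpq)]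
    · intro p q hp hq h1 h2 h3 h4
      have hv : ∀ t ∈ Icc y y', IsHorizLineY F P 2 t → ConfVertex F P ((x, t), (b1, b2)) := by
        intro t ht hl
        rw [← uIcc_of_le hle] at ht
        exact ⟨⟨hr t ht, hl, h.1.2.2⟩, h.2, of_sep (z := ((x, t), (b1, b2))) (o := o)
          (sepT_conv hs hs' left_mem_uIcc ht ⟨rfl, rfl⟩ ⟨rfl, rfl⟩)⟩
      refine ⟨hv p ⟨h1, by linarith⟩ hp, hv q ⟨by linarith, h3⟩ hq, Or.inr ⟨rfl, ?_⟩⟩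
      refine gridEdge_v h2 (hr.sub ?_ ?_) h.1.2.2 hp hq h4
      · rw [uIcc_of_le hle]; constructor <;> linarith
      · rw [uIcc_of_le hle]; constructor <;> linarith

theorem sepT_sw {o : Fin 4} {e : Cfg} (h : sepT o e) : ∃ o', ∀ e : Cfg, sepT o e → sepT o' ⟨e.b1, e.b2, e.a1, e.a2⟩ := by
  fin_cases o
  · exact ⟨1, fun e h => h⟩
  · exact ⟨0, fun e h => h⟩
  · exact ⟨3, fun e h => h⟩
  · exact ⟨2, fun e h => h⟩

theorem moveB (hX : {x | IsVertLineX F P 2 x}.Finite) (hY : {y | IsHorizLineY F P 2 y}.Finite)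
    {x y x' y' b1 b2 : ℝ} {o : Fin 4} (h : GC F P ⟨b1, b2, x, y⟩) (h' : GC F P ⟨b1, b2, x', y'⟩)
    (hr : RM (Fc F) x y x' y') (hs : sepT o ⟨b1, b2, x, y⟩) (hs' : sepT o ⟨b1, b2, x', y'⟩) :
    GP F P ((b1, b2), (x, y)) ((b1, b2), (x', y')) (|x - x'| + |y - y'|) := by
  obtain ⟨o', ho⟩ := sepT_sw hs
  exact (moveA hX hY (o := o') (b1 := b1) (b2 := b2) ⟨h.2, h.1⟩ ⟨h'.2, h'.1⟩ hr (ho _ hs) (ho _ hs')).swap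

theorem step_GP (hX : {x | IsVertLineX F P 2 x}.Finite) (hY : {y | IsHorizLineY F P 2 y}.Finite)
    {e e' : Cfg} (h : GC F P e) (h' : GC F P e') (hs : Step (Fc F) e e') : GP F P (uc e) (uc e') (cost e e') := by
  obtain ⟨ha, hb, hs⟩ := hs
  obtain ⟨o, ho, ho'⟩ : ∃ o, sepT o e ∧ sepT o e' := by
    rcases hs with (hs | hs) | (hs | hs)
    · exact ⟨0, hs⟩
    · exact ⟨1, hs⟩
    · exact ⟨2, hs⟩
    · exact ⟨3, hs⟩
  have hm : sepT o ⟨e'.a1, e'.a2, e.b1, e.b2⟩ ∨ sepT o ⟨e.a1, e.a2, e'.b1, e'.b2⟩ := by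
    fin_cases o <;> simp only [sepT] at * <;> grind
  rcases hm with hm | hm
  · have m1 := moveA hX hY (o := o) (b1 := e.b1) (b2 := e.b2) h ⟨h'.1, h.2⟩ ha ho hm
    have m2 := moveB hX hY (o := o) (b1 := e'.a1) (b2 := e'.a2) (x := e.b1) (y := e.b2) (x' := e'.b1) (y' := e'.b2) ⟨h'.1, h.2⟩ h' hb hm ho'
    rw [show cost e e' = |e.a1 - e'.a1| + |e.a2 - e'.a2| + (|e.b1 - e'.b1| + |e.b2 - e'.b2|) by simp only [cost]; ring]
    exact m1.trans m2
  · have m1 := moveB hX hY (o := o) (b1 := e.a1) (b2 := e.a2) (x := e.b1) (y := e.b2) (x' := e'.b1) (y' := e'.b2) h ⟨h.1, h'.2⟩ hb ho hm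
    have m2 := moveA hX hY (o := o) (x := e.a1) (y := e.a2) (x' := e'.a1) (y' := e'.a2) (b1 := e'.b1) (b2 := e'.b2) ⟨h.1, h'.2⟩ h' ha hm ho'
    rw [show cost e e' = |e.b1 - e'.b1| + |e.b2 - e'.b2| + (|e.a1 - e'.a1| + |e.a2 - e'.a2|) by simp only [cost]; ring]
    exact m1.trans m2

theorem PW_GP (hX : {x | IsVertLineX F P 2 x}.Finite) (hY : {y | IsHorizLineY F P 2 y}.Finite)
    {n u} (hw : PW (Fc F) n u) (hg : ∀ i ≤ n, GC F P (u i)) :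
    GP F P (uc (u 0)) (uc (u n)) (∑ l ∈ Finset.range n, cost (u l) (u (l + 1))) := by
  have key : ∀ m ≤ n, GP F P (uc (u 0)) (uc (u m)) (∑ l ∈ Finset.range m, cost (u l) (u (l + 1))) := by
    intro m
    induction m with
    | zero => intro _; simpa using GP.nil (F := F) (P := P) (uc (u 0))
    | succ m ih =>
      intro hm
      rw [Finset.sum_range_succ]
      exact (ih (by omega)).trans (step_GP hX hY (hg m (by omega)) (hg (m + 1) hm) (hw.2 m (by omega)))
  exact key n le_rfl

theorem GP_min (hX : {x | IsVertLineX F P 2 x}.Finite) (hY : {y | IsHorizLineY F P 2 y}.Finite)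
    {s t c0} (h0 : GP F P s t c0) : ∃ c, GP F P s t c ∧ ∀ c', GP F P s t c' → c ≤ c' := by
  set V : Set Conf := {u | ConfVertex F P u} with hV
  have fV : V.Finite := by
    have fg : {p | IsGridPoint F P p}.Finite :=
      (hX.prod hY).subset (fun p hp => ⟨hp.2.2, hp.2.1⟩)
    exact (fg.prod fg).subset (fun u hu => ⟨hu.1, hu.2.1⟩)
  set S : Set ℝ := (fun z : Conf × Conf => wt z.1 z.2) '' (V ×ˢ V) with hS
  have hpwo : ((AddSubmonoid.closure S : AddSubmonoid ℝ) : Set ℝ).IsPWO := by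
    refine Set.IsPWO.addSubmonoid_closure ?_ ((fV.prod fV).image _).isPWO
    rintro _ ⟨⟨x, y⟩, ⟨h1, h2⟩, rfl⟩
    exact wt_nonneg _ _
  have sub : ∀ {s t c}, GP F P s t c → c ∈ AddSubmonoid.closure S := by
    intro s t c h
    induction h with
    | nil u => exact AddSubmonoid.zero_mem _
    | cons e f g c hs hw ih =>
      exact AddSubmonoid.add_mem _ (AddSubmonoid.subset_closure ⟨(e, f), ⟨hs.1, hs.2.1⟩, rfl⟩) ih
  obtain ⟨c, hc, hm⟩ := pwo_min (T := {c | GP F P s t c}) (hpwo.mono (fun c hc => sub hc)) ⟨c0, h0⟩ (f := id) monotone_id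
  exact ⟨c, hc, hm⟩
end

end TR

namespace TR

section lin
variable {M : Type*} [AddCommGroup M] [Module ℝ M]

/-- piecewise linear interpolation -/
def lin (u : ℕ → M) (τ : ℝ) : M := u ⌊τ⌋₊ + (τ - (⌊τ⌋₊ : ℝ)) • (u (⌊τ⌋₊ + 1) - u ⌊τ⌋₊)

theorem lin_eq (u : ℕ → M) (j : ℕ) {τ : ℝ} (h : τ ∈ Icc (j : ℝ) (j + 1)) :
    lin u τ = u j + (τ - (j : ℝ)) • (u (j + 1) - u j) := by
  rcases h.2.eq_or_lt with h0 | h0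
  · have : ⌊τ⌋₊ = j + 1 := by
      rw [h0, ← Nat.cast_succ, Nat.floor_natCast]
    rw [lin, this, h0]
    simp
  · have : ⌊τ⌋₊ = j := (Nat.floor_eq_iff (by have := Nat.cast_nonneg (α := ℝ) j; linarith [h.1])).2 ⟨h.1, h0⟩
    rw [lin, this]

theorem lin_nat (u : ℕ → M) (j : ℕ) : lin u j = u j := by
  rw [lin_eq u j ⟨le_rfl, by linarith⟩]; simp
end lin

theorem lin_cont (u : ℕ → Conf) (k : ℕ) : ContinuousOn (lin u) (Icc 0 (k : ℝ)) := by
  induction k with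
  | zero => simp
  | succ k ih =>
    have e : Icc (0 : ℝ) ((k + 1 : ℕ) : ℝ) = Icc 0 (k : ℝ) ∪ Icc (k : ℝ) (k + 1) := by
      rw [Icc_union_Icc_eq_Icc (Nat.cast_nonneg k) (by linarith)]; push_cast; rfl
    rw [e]
    refine ih.union_of_isClosed ?_ isClosed_Icc isClosed_Icc
    refine ContinuousOn.congr (f := fun τ => u k + (τ - (k : ℝ)) • (u (k + 1) - u k)) ?_ (fun τ hτ => lin_eq u k hτ)
    exact Continuous.continuousOn (by fun_prop)

theorem l1_smul (r : ℝ) (v : ℝ × ℝ) : l1 (r • v) = |r| * l1 v := by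
  simp only [l1, Prod.smul_fst, Prod.smul_snd, smul_eq_mul, abs_mul]; ring

theorem lin_var1 (w : ℕ → ℝ × ℝ) (j : ℕ) :
    l1VarOn (lin w) (Icc (j : ℝ) (j + 1)) = ENNReal.ofReal (l1 (w (j + 1) - w j)) := by
  set v := w (j + 1) - w j with hv
  have ed : ∀ a ∈ Icc (j : ℝ) (j + 1), ∀ b ∈ Icc (j : ℝ) (j + 1),
      edist ((WithLp.equiv 1 (ℝ × ℝ)).symm (lin w a)) ((WithLp.equiv 1 (ℝ × ℝ)).symm (lin w b)) =
        ENNReal.ofReal (|a - b| * l1 v) := by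
    intro a ha b hb
    rw [edist_l1, lin_eq w j ha, lin_eq w j hb, ← l1_smul]
    congr 2
    rw [← hv]
    module
  apply le_antisymm
  · have hL : LipschitzOnWith (Real.toNNReal (l1 v)) (fun t => (WithLp.equiv 1 (ℝ × ℝ)).symm (lin w t))
        (Icc (j : ℝ) (j + 1)) := by
      intro a ha b hb
      rw [ed a ha b hb, mul_comm, ENNReal.ofReal_mul (l1_nonneg v), edist_dist, Real.dist_eq]
      rfl
    have h1 := hL.comp_eVariationOn_le (g := id) (s := Icc (j : ℝ) (j + 1)) (fun x hx => hx)
    have h2 : eVariationOn (id : ℝ → ℝ) (Icc (j : ℝ) (j + 1)) ≤ ENNReal.ofReal ((j + 1 : ℝ) - j) := by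
      have := MonotoneOn.eVariationOn_le (f := (id : ℝ → ℝ)) (s := Icc (j : ℝ) (j + 1)) (a := (j : ℝ)) (b := j + 1)
        (monotone_id.monotoneOn _) ⟨le_rfl, by linarith⟩ ⟨by linarith, le_rfl⟩
      rwa [inter_self] at this
    rw [add_sub_cancel_left, ENNReal.ofReal_one] at h2
    calc l1VarOn (lin w) (Icc (j : ℝ) (j + 1)) ≤ _ := h1
      _ ≤ (Real.toNNReal (l1 v) : ℝ≥0∞) * 1 := by gcongr
      _ = _ := by rw [mul_one]; rfl
  · have h1 := eVariationOn.edist_le (fun t => (WithLp.equiv 1 (ℝ × ℝ)).symm (lin w t)) (s := Icc (j : ℝ) (j + 1))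
      (x := (j : ℝ) + 1) (y := j) ⟨by linarith, le_rfl⟩ ⟨le_rfl, by linarith⟩
    rw [ed _ ⟨by linarith, le_rfl⟩ _ ⟨le_rfl, by linarith⟩] at h1
    rw [add_sub_cancel_left, abs_one, one_mul] at h1
    exact h1

theorem lin_var (w : ℕ → ℝ × ℝ) (k : ℕ) :
    l1VarOn (lin w) (Icc 0 (k : ℝ)) = ENNReal.ofReal (∑ j ∈ Finset.range k, l1 (w (j + 1) - w j)) := by
  induction k with
  | zero =>
    simp only [Nat.cast_zero, Icc_self, Finset.range_zero, Finset.sum_empty, ENNReal.ofReal_zero]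
    exact eVariationOn.subsingleton _ subsingleton_singleton
  | succ k ih =>
    rw [Finset.sum_range_succ, ENNReal.ofReal_add (Finset.sum_nonneg fun _ _ => l1_nonneg _) (l1_nonneg _), ← ih,
      ← lin_var1]
    have := eVariationOn.Icc_add_Icc (fun t => (WithLp.equiv 1 (ℝ × ℝ)).symm (lin w t)) (s := univ)
      (a := 0) (b := (k : ℝ)) (c := k + 1) (Nat.cast_nonneg k) (by linarith) trivial
    simp only [univ_inter] at this
    rw [Nat.cast_succ]
    exact this.symm

theorem comp_var (w : ℕ → ℝ × ℝ) (k : ℕ) :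
    l1VarOn (fun a => lin w (a * k)) (Icc 0 1) = ENNReal.ofReal (∑ j ∈ Finset.range k, l1 (w (j + 1) - w j)) := by
  rw [← lin_var]
  have h := eVariationOn.comp_eq_of_monotoneOn (fun t => (WithLp.equiv 1 (ℝ × ℝ)).symm (lin w t))
    (t := Icc (0 : ℝ) 1) (fun a : ℝ => a * k) (fun a _ b _ hab => mul_le_mul_of_nonneg_right hab (Nat.cast_nonneg k))
  rw [image_mul_right_Icc zero_le_one (Nat.cast_nonneg k), zero_mul, one_mul] at h
  exact h

section
variable {F P : Set (ℝ × ℝ)}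

theorem sep_line {a p q θ : ℝ} (h0 : 0 ≤ θ) (h1 : θ ≤ 1)
    (h : (a + 1 ≤ p ∧ a + 1 ≤ q) ∨ (p + 1 ≤ a ∧ q + 1 ≤ a)) : 1 ≤ |a - (p + θ * (q - p))| := by
  rw [le_abs]
  rcases h with h | h
  · right; nlinarith
  · left; nlinarith

theorem sep_cases {a p q : ℝ} (h : 1 ≤ |a - p|) (h' : 1 ≤ |a - q|) :
    ((a + 1 ≤ p ∧ a + 1 ≤ q) ∨ (p + 1 ≤ a ∧ q + 1 ≤ a)) ∨
      ∃ t ∈ Ioo (0 : ℝ) 1, a = p + t * (q - p) := by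
  have key : p + 1 ≤ a ∧ a + 1 ≤ q ∨ q + 1 ≤ a ∧ a + 1 ≤ p → ∃ t ∈ Ioo (0 : ℝ) 1, a = p + t * (q - p) := by
    rintro (h | h)
    · have : 0 < q - p := by linarith
      refine ⟨(a - p) / (q - p), ⟨by apply div_pos <;> linarith, by rw [div_lt_one this]; linarith⟩, ?_⟩
      rw [div_mul_cancel₀ _ this.ne']; ring
    · have : 0 < p - q := by linarith
      refine ⟨(p - a) / (p - q), ⟨by apply div_pos <;> linarith, by rw [div_lt_one this]; linarith⟩, ?_⟩
      field_simp; ring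
  rcases le_abs.1 h with h | h <;> rcases le_abs.1 h' with h' | h'
  · left; right; constructor <;> linarith
  · right; exact key (Or.inl ⟨by linarith, by linarith⟩)
  · right; exact key (Or.inr ⟨by linarith, by linarith⟩)
  · left; left; constructor <;> linarith

theorem edge_sep {a p q : ℝ × ℝ} (ha : IsGridPoint F P a) (he : IsGridEdge F P p q)
    (h1 : 1 ≤ linf (a - p)) (h2 : 1 ≤ linf (a - q)) {θ : ℝ} (t0 : 0 ≤ θ) (t1 : θ ≤ 1) :
    1 ≤ linf (a - (p + θ • (q - p))) := by
  obtain ⟨hp, hq, hl, hs, hn⟩ := he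
  rw [one_le_linf] at *
  simp only [Prod.fst_sub, Prod.snd_sub, Prod.fst_add, Prod.snd_add, Prod.smul_fst, Prod.smul_snd, smul_eq_mul] at *
  have hno : ∀ t ∈ Ioo (0 : ℝ) 1, ¬ IsGridPoint F P (p + t • (q - p)) := by
    intro t ht
    exact hn _ (by rw [openSegment_eq_image']; exact ⟨t, ht, rfl⟩)
  have hin : ∀ t ∈ Ioo (0 : ℝ) 1, p + t • (q - p) ∈ F := by
    intro t ht
    exact hs (by rw [segment_eq_image']; exact ⟨t, ⟨ht.1.le, ht.2.le⟩, rfl⟩)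
  rcases hl with hl | hl
  · rw [← hl] at h2 ⊢
    by_cases hx : 1 ≤ |a.1 - p.1|
    · left; simpa using hx
    · right
      rcases sep_cases (h1.resolve_left hx) (h2.resolve_left hx) with hh | ⟨t, ht, e⟩
      · exact sep_line t0 t1 hh
      · refine absurd ⟨hin t ht, ?_, ?_⟩ (hno t ht)
        · have : (p + t • (q - p)).2 = a.2 := by rw [e]; simp
          rw [this]; exact ha.2.1
        · have : (p + t • (q - p)).1 = p.1 := by simp [← hl]
          rw [this]; exact hp.2.2
  · rw [← hl] at h2 ⊢
    by_cases hx : 1 ≤ |a.2 - p.2|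
    · right; simpa using hx
    · left
      rcases sep_cases (h1.resolve_right hx) (h2.resolve_right hx) with hh | ⟨t, ht, e⟩
      · exact sep_line t0 t1 hh
      · refine absurd ⟨hin t ht, ?_, ?_⟩ (hno t ht)
        · have : (p + t • (q - p)).2 = p.2 := by simp [← hl]
          rw [this]; exact hp.2.1
        · have : (p + t • (q - p)).1 = a.1 := by rw [e]; simp
          rw [this]; exact ha.2.2

theorem edge_free {u v : Conf} (h : ConfEdge F P u v) {θ : ℝ} (t0 : 0 ≤ θ) (t1 : θ ≤ 1) :
    FreeConf F (u + θ • (v - u)) := by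
  obtain ⟨hu, hv, h⟩ := h
  have seg : ∀ {p q : ℝ × ℝ}, IsGridEdge F P p q → p + θ • (q - p) ∈ F := by
    intro p q he
    exact he.2.2.2.1 (by rw [segment_eq_image']; exact ⟨θ, ⟨t0, t1⟩, rfl⟩)
  rcases h with ⟨e, he⟩ | ⟨e, he⟩
  · have e1 : (u + θ • (v - u)).1 = u.1 := by simp [e]
    have e2 : (u + θ • (v - u)).2 = u.2 + θ • (v.2 - u.2) := by simp
    rw [FreeConf, e1, e2]
    exact ⟨hu.1.1, seg he, edge_sep hu.1 he hu.2.2 (by rw [e]; exact hv.2.2) t0 t1⟩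
  · have e1 : (u + θ • (v - u)).2 = u.2 := by simp [e]
    have e2 : (u + θ • (v - u)).1 = u.1 + θ • (v.1 - u.1) := by simp
    rw [FreeConf, e1, e2, linf_comm]
    exact ⟨seg he, hu.2.1.1, edge_sep hu.2.1 he (by rw [linf_comm]; exact hu.2.2)
      (by rw [e, linf_comm]; exact hv.2.2) t0 t1⟩

theorem traversal {s t : Conf} {k u} (h : IsGraphPath F P s t k u) (hs : ConfVertex F P s) :
    ∃ pln, IsPlan s t pln ∧ Feasible F pln ∧ IsEdgeTraversal pln k u ∧
      planCost pln = ENNReal.ofReal (graphPathWeight k u) := by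
  obtain ⟨u0, uk, hu⟩ := h
  have k0 : (0 : ℝ) ≤ k := Nat.cast_nonneg k
  have maps : ∀ a ∈ Icc (0 : ℝ) 1, a * k ∈ Icc (0 : ℝ) k := fun a ha =>
    ⟨mul_nonneg ha.1 k0, by have := mul_le_mul_of_nonneg_right ha.2 k0; rwa [one_mul] at this⟩
  refine ⟨fun a => lin u (a * k), ⟨?_, ?_, ?_⟩, ?_, ⟨?_, ?_⟩, ?_⟩
  · exact (lin_cont u k).comp (by fun_prop) maps
  · have := lin_nat u 0
    simp only [Nat.cast_zero] at this
    simp only [zero_mul, this, u0]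
  · simp only [one_mul, lin_nat, uk]
  · intro a ha
    obtain ⟨h0, h1⟩ := maps a ha
    show FreeConf F (lin u (a * k))
    generalize a * (k : ℝ) = τ at h0 h1 ⊢
    rcases h1.eq_or_lt with h2 | h2
    · rw [h2, lin_nat]
      rcases Nat.eq_zero_or_pos k with h3 | h3
      · rw [h3, u0]; exact ⟨hs.1.1, hs.2.1.1, hs.2.2⟩
      · have := (hu (k - 1) (by omega)).2.1
        rw [Nat.sub_add_cancel h3] at this
        exact ⟨this.1.1, this.2.1.1, this.2.2⟩
    · have hj : ⌊τ⌋₊ < k := (Nat.floor_lt h0).2 h2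
      exact edge_free (hu _ hj) (sub_nonneg.2 (Nat.floor_le h0)) (by linarith [Nat.lt_floor_add_one τ])
  · intro hk a ha
    have := lin_nat u 0
    simp only [Nat.cast_zero] at this
    simp only [hk, Nat.cast_zero, mul_zero, this]
  · intro j hj a ha
    have kp : (0 : ℝ) < k := by exact_mod_cast (by omega : 0 < k)
    have e : (a - (j : ℝ) / k) * k = a * k - j := by field_simp
    rw [e]
    exact lin_eq u j ⟨(div_le_iff₀ kp).1 ha.1, (le_div_iff₀ kp).1 ha.2⟩
  · rw [graphPathWeight, Finset.sum_add_distrib, ENNReal.ofReal_add (Finset.sum_nonneg fun _ _ => l1_nonneg _)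
      (Finset.sum_nonneg fun _ _ => l1_nonneg _), ← comp_var (fun j => (u j).1), ← comp_var (fun j => (u j).2)]
    rfl

theorem main (W : Set (ℝ × ℝ)) (hW : IsRectilinearEnv W)
    (F : Set (ℝ × ℝ)) (hF : F = freeSpace W) (sA sB tA tB : ℝ × ℝ)
    (P : Set (ℝ × ℝ)) (hP : P = {sA, sB, tA, tB})
    (hsV : ConfVertex F P (sA, sB)) (_htV : ConfVertex F P (tA, tB))
    (hreach : ∃ pln, IsPlan (sA, sB) (tA, tB) pln ∧ Feasible F pln) :
    ∃ (k : ℕ) (u : ℕ → (ℝ × ℝ) × (ℝ × ℝ)),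
      IsGraphPath F P (sA, sB) (tA, tB) k u ∧
      (∀ (k' : ℕ) (u' : ℕ → (ℝ × ℝ) × (ℝ × ℝ)),
        IsGraphPath F P (sA, sB) (tA, tB) k' u' →
          graphPathWeight k u ≤ graphPathWeight k' u') ∧
      ∃ pln, IsPlan (sA, sB) (tA, tB) pln ∧ Feasible F pln ∧
        IsEdgeTraversal pln k u ∧
        planCost pln = ENNReal.ofReal (graphPathWeight k u) ∧
        ∀ pln', IsPlan (sA, sB) (tA, tB) pln' → Feasible F pln' →
          planCost pln ≤ planCost pln' := by
  obtain ⟨_, hc, ⟨𝓡, h𝓡, hU⟩, _⟩ := hW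
  obtain ⟨Q, hQ⟩ := rectU_of 𝓡 h𝓡 hU
  have fP : P.Finite := by rw [hP]; simp
  have hg := hQ.hg hc (fP.image Prod.snd)
  have hg' := hQ.hg' hc (fP.image Prod.fst)
  rw [← hF] at hg hg'
  have hX : {x | IsVertLineX F P 2 x}.Finite := by
    simp only [vertl_iff]; exact goodS_fin hg'.fB
  have hY : {y | IsHorizLineY F P 2 y}.Finite := by
    simp only [horiz_iff]; exact goodS_fin hg.fB
  have mA : sA ∈ P := by rw [hP]; simp
  have mB : sB ∈ P := by rw [hP]; simp
  have nA : tA ∈ P := by rw [hP]; simp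
  have nB : tB ∈ P := by rw [hP]; simp
  have key : ∀ pln, IsPlan (sA, sB) (tA, tB) pln → Feasible F pln →
      ∃ c, GP F P (sA, sB) (tA, tB) c ∧ ENNReal.ofReal c ≤ planCost pln := by
    intro pln hp hf
    obtain ⟨R, hR⟩ := hg'.bdd
    obtain ⟨c, hw, hcost⟩ := plan_PR hg (fun x y h => hR y x h) hp hf
    obtain ⟨n, u, hu, u0, un, hs⟩ := hw.toPW
    obtain ⟨n', u', hu', u0', un', hs', hgood⟩ := phases hg hg' hu
      (by rw [u0]; exact ⟨Or.inr ⟨sA, mA, rfl⟩, Or.inr ⟨sB, mB, rfl⟩, Or.inr ⟨sA, mA, rfl⟩, Or.inr ⟨sB, mB, rfl⟩⟩)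
      (by rw [un]; exact ⟨Or.inr ⟨tA, nA, rfl⟩, Or.inr ⟨tB, nB, rfl⟩, Or.inr ⟨tA, nA, rfl⟩, Or.inr ⟨tB, nB, rfl⟩⟩)
    have := PW_GP hX hY hu' (fun i hi => by
      obtain ⟨g1, g2, g3, g4⟩ := hgood i hi
      exact ⟨⟨(hu'.1 i hi).1, horiz_iff.2 g1, vertl_iff.2 g3⟩, ⟨(hu'.1 i hi).2, horiz_iff.2 g2, vertl_iff.2 g4⟩⟩)
    rw [u0', un', u0, un] at this
    exact ⟨_, this, (ENNReal.ofReal_le_ofReal (hs'.trans hs.le)).trans hcost⟩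
  obtain ⟨p0, hp0, hf0⟩ := hreach
  obtain ⟨c0, hc0, _⟩ := key p0 hp0 hf0
  obtain ⟨c, hGP, hmin⟩ := GP_min hX hY hc0
  obtain ⟨k, u, hku, hw⟩ := hGP.toPath
  refine ⟨k, u, hku, fun k' u' h' => by rw [hw]; exact hmin _ (GP.ofPath h'), ?_⟩
  obtain ⟨pln, a1, a2, a3, a4⟩ := traversal hku hsV
  refine ⟨pln, a1, a2, a3, a4, fun pln' h1 h2 => ?_⟩
  obtain ⟨c', h3, h4⟩ := key pln' h1 h2
  rw [a4, hw]
  exact (ENNReal.ofReal_le_ofReal (hmin _ h3)).trans h4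
end

end TR

/-- If `s` and `t` are vertices of the configuration graph and `(s,t)` is
reachable, then there is a minimum-weight path in the configuration graph from `s` to `t`,
and the plan obtained by traversing its edges one after another is a feasible `(s,t)`-plan
whose cost equals the weight of the path and which is optimal among all feasible
`(s,t)`-plans. -/
theorem shortest_graph_path_gives_optimal_plan
    (W : Set (ℝ × ℝ)) (hW : IsRectilinearEnv W)
    (F : Set (ℝ × ℝ)) (hF : F = freeSpace W)
    (sA sB tA tB : ℝ × ℝ)
    (P : Set (ℝ × ℝ)) (hP : P = {sA, sB, tA, tB})
    (hsA : sA ∈ F) (hsB : sB ∈ F) (htA : tA ∈ F) (htB : tB ∈ F)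
    (hsV : ConfVertex F P (sA, sB)) (htV : ConfVertex F P (tA, tB))
    (hreach : ∃ pln, IsPlan (sA, sB) (tA, tB) pln ∧ Feasible F pln) :
    ∃ (k : ℕ) (u : ℕ → (ℝ × ℝ) × (ℝ × ℝ)),
      IsGraphPath F P (sA, sB) (tA, tB) k u ∧
      (∀ (k' : ℕ) (u' : ℕ → (ℝ × ℝ) × (ℝ × ℝ)),
        IsGraphPath F P (sA, sB) (tA, tB) k' u' →
          graphPathWeight k u ≤ graphPathWeight k' u') ∧
      ∃ pln, IsPlan (sA, sB) (tA, tB) pln ∧ Feasible F pln ∧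
        IsEdgeTraversal pln k u ∧
        planCost pln = ENNReal.ofReal (graphPathWeight k u) ∧
        ∀ pln', IsPlan (sA, sB) (tA, tB) pln' → Feasible F pln' →
          planCost pln ≤ planCost pln' := by
  exact TR.main W hW F hF sA sB tA tB P hP hsV htV hreach

end
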